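/- arXiv:1911.00091 — 9 statements merged into one kernel-verified Lean document; each statement's English description precedes it below -/
import Mathlib

section
/- There exists a constant C > 0 with the following property. Let h : [-1,1] × [-1,0] → ℝ be a nonnegative solution of the heat equation on the rectangle [-1,1] × [-1,0]. Then h(0,0) ≥ (1/C) ∫_{-1}^{1} cos(πy/2) · h(y,-1) dy + (1/C) ∫_0^1 t^{-3/2} e^{-1/(4t)} ( h(1,-t) + h(-1,-t) ) dt. -/
open Real Set

/-- `h : ℝ → ℝ → ℝ` (first argument space, second argument time) is a solution of the
heat equation on the rectangle `[-1,1] × [-1,0]`: it is continuous on the closed rectangle,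
smooth on `(-1,1) × (-1,0]`, and satisfies `∂_t h = ∂²_x h` there (the time derivative at
`t = 0` being the one-sided derivative within `(-∞,0]`). -/
def IsHeatSolution (h : ℝ → ℝ → ℝ) : Prop :=
  ContinuousOn (fun p : ℝ × ℝ => h p.1 p.2) (Set.Icc (-1) 1 ×ˢ Set.Icc (-1) 0) ∧
  ContDiffOn ℝ (⊤ : ℕ∞) (fun p : ℝ × ℝ => h p.1 p.2) (Set.Ioo (-1) 1 ×ˢ Set.Ioc (-1) 0) ∧
  ∀ x ∈ Set.Ioo (-1 : ℝ) 1, ∀ t ∈ Set.Ioc (-1 : ℝ) 0,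
    derivWithin (fun s => h x s) (Set.Iic 0) t = deriv (deriv (fun y => h y t)) x

open MeasureTheory Filter Topology

noncomputable def pdx (F : ℝ × ℝ → ℝ) (p : ℝ × ℝ) : ℝ := fderiv ℝ F p (1, 0)
noncomputable def pdt (F : ℝ × ℝ → ℝ) (p : ℝ × ℝ) : ℝ := fderiv ℝ F p (0, 1)

lemma pdx_contDiffOn {F : ℝ × ℝ → ℝ} {U : Set (ℝ × ℝ)} (hU : IsOpen U)
    (hF : ContDiffOn ℝ (⊤ : ℕ∞) F U) : ContDiffOn ℝ (⊤ : ℕ∞) (pdx F) U := by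
  have h := hF.fderiv_of_isOpen hU (m := (⊤ : ℕ∞)) (by simp)
  exact h.clm_apply contDiffOn_const

lemma pdt_contDiffOn {F : ℝ × ℝ → ℝ} {U : Set (ℝ × ℝ)} (hU : IsOpen U)
    (hF : ContDiffOn ℝ (⊤ : ℕ∞) F U) : ContDiffOn ℝ (⊤ : ℕ∞) (pdt F) U := by
  have h := hF.fderiv_of_isOpen hU (m := (⊤ : ℕ∞)) (by simp)
  exact h.clm_apply contDiffOn_const

lemma diffAt_of {F : ℝ × ℝ → ℝ} {U : Set (ℝ × ℝ)} (hU : IsOpen U)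
    (hF : ContDiffOn ℝ (⊤ : ℕ∞) F U) {p : ℝ × ℝ} (hp : p ∈ U) : DifferentiableAt ℝ F p :=
  (hF.contDiffAt (hU.mem_nhds hp)).differentiableAt (by simp)

lemma hasDerivAt_pdx {F : ℝ × ℝ → ℝ} {x s : ℝ} (h : DifferentiableAt ℝ F (x, s)) :
    HasDerivAt (fun y => F (y, s)) (pdx F (x, s)) x := by
  have h1 : HasDerivAt (fun y : ℝ => (y, s)) ((1 : ℝ), (0 : ℝ)) x :=
    (hasDerivAt_id x).prodMk (hasDerivAt_const x s)
  exact h.hasFDerivAt.comp_hasDerivAt x h1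

lemma hasDerivAt_pdt {F : ℝ × ℝ → ℝ} {x s : ℝ} (h : DifferentiableAt ℝ F (x, s)) :
    HasDerivAt (fun y => F (x, y)) (pdt F (x, s)) s := by
  have h1 : HasDerivAt (fun y : ℝ => (x, y)) ((0 : ℝ), (1 : ℝ)) s :=
    (hasDerivAt_const s x).prodMk (hasDerivAt_id s)
  exact h.hasFDerivAt.comp_hasDerivAt s h1

lemma green_heat {V G : ℝ × ℝ → ℝ} {U : Set (ℝ × ℝ)} (hU : IsOpen U)
    (hV : ContDiffOn ℝ (⊤ : ℕ∞) V U) (hG : ContDiffOn ℝ (⊤ : ℕ∞) G U) {a b : ℝ} (hab : a ≤ b)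
    (hR : Icc (-1 : ℝ) 1 ×ˢ Icc a b ⊆ U)
    (hGe : ∀ p ∈ Icc (-1 : ℝ) 1 ×ˢ Icc a b, pdt G p = - pdx (pdx G) p)
    (hVe : ∀ p ∈ Icc (-1 : ℝ) 1 ×ˢ Icc a b, pdt V p ≤ pdx (pdx V) p)
    (hG0 : ∀ p ∈ Icc (-1 : ℝ) 1 ×ˢ Icc a b, 0 ≤ G p)
    (hV1 : ∀ s ∈ Icc a b, V (1, s) = 0) (hV2 : ∀ s ∈ Icc a b, V (-1, s) = 0) :
    (∫ x in (-1 : ℝ)..1, V (x, b) * G (x, b)) +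
      (∫ s in a..b, (- pdx V (1, s) * G (1, s) + pdx V (-1, s) * G (-1, s)))
      ≤ ∫ x in (-1 : ℝ)..1, V (x, a) * G (x, a) := by
  set P : ℝ × ℝ → ℝ := fun p => pdx V p * G p - V p * pdx G p with hP
  set Q : ℝ × ℝ → ℝ := fun p => - (V p * G p) with hQ
  have hVx := pdx_contDiffOn hU hV
  have hGx := pdx_contDiffOn hU hG
  have hPc : ContDiffOn ℝ (⊤ : ℕ∞) P U := (hVx.mul hG).sub (hV.mul hGx)
  have hQc : ContDiffOn ℝ (⊤ : ℕ∞) Q U := (hV.mul hG).neg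
  have hPx : ∀ p ∈ U, pdx P p = pdx (pdx V) p * G p - V p * pdx (pdx G) p := by
    rintro ⟨x, s⟩ hp
    have e1 := hasDerivAt_pdx (diffAt_of hU hPc hp)
    have e2 := ((hasDerivAt_pdx (diffAt_of hU hVx hp)).mul (hasDerivAt_pdx (diffAt_of hU hG hp))).sub
      ((hasDerivAt_pdx (diffAt_of hU hV hp)).mul (hasDerivAt_pdx (diffAt_of hU hGx hp)))
    rw [e1.unique e2]; ring
  have hQt : ∀ p ∈ U, pdt Q p = - (pdt V p * G p + V p * pdt G p) := by
    rintro ⟨x, s⟩ hp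
    have e1 := hasDerivAt_pdt (diffAt_of hU hQc hp)
    have e2 := ((hasDerivAt_pdt (diffAt_of hU hV hp)).mul (hasDerivAt_pdt (diffAt_of hU hG hp))).neg
    rw [e1.unique e2]
  have hsub : Ioo (-1 : ℝ) 1 ×ˢ Ioo a b ⊆ U :=
    (Set.prod_mono Ioo_subset_Icc_self Ioo_subset_Icc_self).trans hR
  have hR' : Icc ((-1 : ℝ), a) (1, b) ⊆ U := by rw [← Icc_prod_Icc]; exact hR
  have key := integral_divergence_prod_Icc_of_hasFDerivAt_of_le P Q (fderiv ℝ P) (fderiv ℝ Q)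
    ((-1 : ℝ), a) (1, b) ⟨by norm_num, hab⟩ (hPc.continuousOn.mono hR') (hQc.continuousOn.mono hR')
    (fun p hp => (diffAt_of hU hPc (hsub hp)).hasFDerivAt)
    (fun p hp => (diffAt_of hU hQc (hsub hp)).hasFDerivAt)
    (by
      refine ContinuousOn.integrableOn_compact isCompact_Icc ?_
      exact ((pdx_contDiffOn hU hPc).continuousOn.add (pdt_contDiffOn hU hQc).continuousOn).mono hR')
  have hpos : 0 ≤ ∫ p in Icc ((-1 : ℝ), a) (1, b), fderiv ℝ P p (1, 0) + fderiv ℝ Q p (0, 1) := by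
    refine setIntegral_nonneg measurableSet_Icc ?_
    intro p hp
    have hp' : p ∈ Icc (-1 : ℝ) 1 ×ˢ Icc a b := by rw [Icc_prod_Icc]; exact hp
    change 0 ≤ pdx P p + pdt Q p
    rw [hPx p (hR' hp), hQt p (hR' hp), hGe p hp']
    have := mul_nonneg (sub_nonneg.2 (hVe p hp')) (hG0 p hp')
    linarith
  rw [key] at hpos
  simp only at hpos
  have i1 : ∫ y in a..b, P (1, y) = ∫ y in a..b, pdx V (1, y) * G (1, y) := by
    refine intervalIntegral.integral_congr fun s hs => ?_
    rw [uIcc_of_le hab] at hs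
    simp [hP, hV1 s hs]
  have i2 : ∫ y in a..b, P (-1, y) = ∫ y in a..b, pdx V (-1, y) * G (-1, y) := by
    refine intervalIntegral.integral_congr fun s hs => ?_
    rw [uIcc_of_le hab] at hs
    simp [hP, hV2 s hs]
  have hc : ∀ x ∈ Icc (-1 : ℝ) 1, IntervalIntegrable (fun s => pdx V (x, s) * G (x, s)) volume a b := by
    intro x hx
    refine ContinuousOn.intervalIntegrable ?_
    rw [uIcc_of_le hab]
    refine (hVx.continuousOn.mul hG.continuousOn).comp (f := fun s => (x, s)) (by fun_prop) ?_
    intro s hs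
    exact hR ⟨hx, hs⟩
  have i3 : (∫ s in a..b, (- pdx V (1, s) * G (1, s) + pdx V (-1, s) * G (-1, s)))
      = - (∫ y in a..b, pdx V (1, y) * G (1, y)) + ∫ y in a..b, pdx V (-1, y) * G (-1, y) := by
    rw [← intervalIntegral.integral_neg, ← intervalIntegral.integral_add]
    · simp only [neg_mul]
    · exact (hc 1 (by norm_num)).neg
    · exact hc (-1) (by norm_num)
  rw [i3]
  rw [i1, i2] at hpos
  simp only [hQ, intervalIntegral.integral_neg] at hpos
  linarith

lemma pdx_comp {F : ℝ × ℝ → ℝ} {k l x s : ℝ} (h : DifferentiableAt ℝ F (k * x, l * s)) :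
    pdx (fun p : ℝ × ℝ => F (k * p.1, l * p.2)) (x, s) = k * pdx F (k * x, l * s) := by
  have h0 : DifferentiableAt ℝ (fun p : ℝ × ℝ => F (k * p.1, l * p.2)) (x, s) :=
    DifferentiableAt.comp (g := F) (f := fun p : ℝ × ℝ => (k * p.1, l * p.2)) (x, s) h (by fun_prop)
  have e1 := hasDerivAt_pdx h0
  have e2 := (hasDerivAt_pdx h).comp x ((hasDerivAt_id x).const_mul k)
  have := e1.unique e2
  rw [this]; ring

lemma pdt_comp {F : ℝ × ℝ → ℝ} {k l x s : ℝ} (h : DifferentiableAt ℝ F (k * x, l * s)) :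
    pdt (fun p : ℝ × ℝ => F (k * p.1, l * p.2)) (x, s) = l * pdt F (k * x, l * s) := by
  have h0 : DifferentiableAt ℝ (fun p : ℝ × ℝ => F (k * p.1, l * p.2)) (x, s) :=
    DifferentiableAt.comp (g := F) (f := fun p : ℝ × ℝ => (k * p.1, l * p.2)) (x, s) h (by fun_prop)
  have e1 := hasDerivAt_pdt h0
  have e2 := (hasDerivAt_pdt h).comp s ((hasDerivAt_id s).const_mul l)
  have := e1.unique e2
  rw [this]; ring

def heatU (r : ℝ) : Set (ℝ × ℝ) :=
  (fun p : ℝ × ℝ => (r * p.1, -r ^ 2 * p.2)) ⁻¹' (Ioo (-1 : ℝ) 1 ×ˢ Ioo (-1 : ℝ) 0)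

lemma heatU_open (r : ℝ) : IsOpen (heatU r) :=
  (isOpen_Ioo.prod isOpen_Ioo).preimage (by fun_prop)

lemma heatU_pos {r : ℝ} {p : ℝ × ℝ} (hp : p ∈ heatU r) : 0 < p.2 := by
  have := hp.2.2
  simp only at this
  by_contra hc
  nlinarith [sq_nonneg r]

lemma heatU_sub {r a b : ℝ} (hr : 0 < r) (hr1 : r < 1) (ha : 0 < a) (hb : b ≤ 1) :
    Icc (-1 : ℝ) 1 ×ˢ Icc a b ⊆ heatU r := by
  rintro ⟨x, s⟩ ⟨hx, hs⟩
  simp only [mem_Icc] at hx hs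
  refine ⟨⟨?_, ?_⟩, ⟨?_, ?_⟩⟩ <;> simp only
  · nlinarith
  · nlinarith
  · nlinarith
  · have : 0 < r ^ 2 * s := by have : 0 < s := by linarith
                               positivity
    linarith

lemma heat_pde {h : ℝ → ℝ → ℝ} (hh : IsHeatSolution h) :
    ∀ p ∈ Ioo (-1 : ℝ) 1 ×ˢ Ioo (-1 : ℝ) 0,
      pdt (fun p : ℝ × ℝ => h p.1 p.2) p = pdx (pdx (fun p : ℝ × ℝ => h p.1 p.2)) p := by
  rintro ⟨x, t⟩ hp
  obtain ⟨_, h2, h3⟩ := hh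
  have hU : IsOpen (Ioo (-1 : ℝ) 1 ×ˢ Ioo (-1 : ℝ) 0) := isOpen_Ioo.prod isOpen_Ioo
  have hF : ContDiffOn ℝ (⊤ : ℕ∞) (fun p : ℝ × ℝ => h p.1 p.2) (Ioo (-1 : ℝ) 1 ×ˢ Ioo (-1 : ℝ) 0) :=
    h2.mono (Set.prod_mono le_rfl Ioo_subset_Ioc_self)
  have e := h3 x hp.1 t (Ioo_subset_Ioc_self hp.2)
  rw [derivWithin_of_mem_nhds (Iic_mem_nhds hp.2.2)] at e
  have e1 := (hasDerivAt_pdt (diffAt_of hU hF hp)).deriv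
  have e2 : deriv (fun y => h y t) =ᶠ[𝓝 x] fun y => pdx (fun p : ℝ × ℝ => h p.1 p.2) (y, t) := by
    filter_upwards [isOpen_Ioo.mem_nhds hp.1] with y hy
    exact (hasDerivAt_pdx (diffAt_of hU hF (p := (y, t)) ⟨hy, hp.2⟩)).deriv
  rw [e2.deriv_eq, (hasDerivAt_pdx (diffAt_of hU (pdx_contDiffOn hU hF) hp)).deriv] at e
  rw [← e, ← e1]

noncomputable def heatG (h : ℝ → ℝ → ℝ) (r : ℝ) (p : ℝ × ℝ) : ℝ := h (r * p.1) (-r ^ 2 * p.2)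

lemma heatG_smooth {h : ℝ → ℝ → ℝ} (hh : IsHeatSolution h) (r : ℝ) :
    ContDiffOn ℝ (⊤ : ℕ∞) (heatG h r) (heatU r) := by
  have hF : ContDiffOn ℝ (⊤ : ℕ∞) (fun p : ℝ × ℝ => h p.1 p.2) (Ioo (-1 : ℝ) 1 ×ˢ Ioo (-1 : ℝ) 0) :=
    hh.2.1.mono (Set.prod_mono le_rfl Ioo_subset_Ioc_self)
  exact hF.comp (f := fun p : ℝ × ℝ => (r * p.1, -r ^ 2 * p.2))
    (ContDiff.contDiffOn (by fun_prop)) (fun p hp => hp)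

lemma heatG_pde {h : ℝ → ℝ → ℝ} (hh : IsHeatSolution h) (r : ℝ) :
    ∀ p ∈ heatU r, pdt (heatG h r) p = - pdx (pdx (heatG h r)) p := by
  rintro ⟨x, s⟩ hp
  have hU : IsOpen (Ioo (-1 : ℝ) 1 ×ˢ Ioo (-1 : ℝ) 0) := isOpen_Ioo.prod isOpen_Ioo
  set F : ℝ × ℝ → ℝ := fun p : ℝ × ℝ => h p.1 p.2 with hFd
  have hF : ContDiffOn ℝ (⊤ : ℕ∞) F (Ioo (-1 : ℝ) 1 ×ˢ Ioo (-1 : ℝ) 0) :=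
    hh.2.1.mono (Set.prod_mono le_rfl Ioo_subset_Ioc_self)
  have hGF : heatG h r = fun p => F (r * p.1, -r ^ 2 * p.2) := rfl
  have e1 : pdt (heatG h r) (x, s) = -r ^ 2 * pdt F (r * x, -r ^ 2 * s) :=
    pdt_comp (diffAt_of hU hF hp)
  have e2 : ∀ p ∈ heatU r, pdx (heatG h r) p = r * pdx F (r * p.1, -r ^ 2 * p.2) :=
    fun p hp => pdx_comp (x := p.1) (s := p.2) (diffAt_of hU hF hp)
  have hFx := pdx_contDiffOn hU hF
  have e3 : pdx (pdx (heatG h r)) (x, s) = r * (r * pdx (pdx F) (r * x, -r ^ 2 * s)) := by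
    have : pdx (heatG h r) =ᶠ[𝓝 (x, s)] fun p => r * pdx F (r * p.1, -r ^ 2 * p.2) := by
      filter_upwards [(heatU_open r).mem_nhds hp] with p hp using e2 p hp
    have h4 : pdx (pdx (heatG h r)) (x, s)
        = pdx (fun p => r * pdx F (r * p.1, -r ^ 2 * p.2)) (x, s) := by
      unfold pdx at this ⊢
      rw [this.fderiv_eq]
    have h5 : DifferentiableAt ℝ (fun p : ℝ × ℝ => pdx F (r * p.1, -r ^ 2 * p.2)) (x, s) :=
      DifferentiableAt.comp (g := pdx F) (f := fun p : ℝ × ℝ => (r * p.1, -r ^ 2 * p.2)) (x, s)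
        (diffAt_of hU hFx hp) (by fun_prop)
    have h6 : pdx (fun p => r * pdx F (r * p.1, -r ^ 2 * p.2)) (x, s)
        = r * pdx (fun p => pdx F (r * p.1, -r ^ 2 * p.2)) (x, s) := by
      have a1 := hasDerivAt_pdx (h5.const_mul r)
      exact a1.unique ((hasDerivAt_pdx h5).const_mul r)
    rw [h4, h6, pdx_comp (diffAt_of hU hFx hp)]
  rw [e1, e3, heat_pde hh _ hp]
  ring

noncomputable def phiK (x s : ℝ) : ℝ := (√s)⁻¹ * Real.exp (-(x ^ 2 / (4 * s)))

noncomputable def wK (x s : ℝ) : ℝ :=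
  1 - Real.cosh ((1 / s - 1) * x) / Real.cosh (1 / s - 1)

lemma phiK_dx (x s : ℝ) : HasDerivAt (fun y => phiK y s) (phiK x s * (-(x / (2 * s)))) x := by
  have h1 : HasDerivAt (fun y : ℝ => -(y ^ 2 / (4 * s))) (-(2 * x / (4 * s))) x := by
    refine (((hasDerivAt_pow 2 x).div_const (4 * s)).neg).congr_deriv ?_
    simp
  have := (h1.exp).const_mul ((√s)⁻¹)
  refine this.congr_deriv ?_
  unfold phiK
  rw [show 2 * x / (4 * s) = x / (2 * s) by rw [show 4 * s = 2 * (2 * s) by ring, mul_div_mul_left _ _ two_ne_zero]]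
  ring

lemma phiK_ds (x : ℝ) {s : ℝ} (hs : 0 < s) :
    HasDerivAt (fun τ => phiK x τ) (phiK x s * (x ^ 2 / (4 * s ^ 2) - 1 / (2 * s))) s := by
  have h1 : HasDerivAt (fun τ : ℝ => -(x ^ 2 / (4 * τ))) (x ^ 2 / (4 * s ^ 2)) s := by
    have h := (((hasDerivAt_id s).const_mul 4).inv (by simp; positivity)).const_mul (-x ^ 2)
    refine (h.congr_deriv ?_).congr_of_eventuallyEq ?_
    · simp; field_simp
    · refine Eventually.of_forall fun τ => ?_
      simp [div_eq_mul_inv]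
  have h2 := (Real.hasDerivAt_sqrt hs.ne').inv (Real.sqrt_pos.2 hs).ne'
  have := h2.mul h1.exp
  refine this.congr_deriv ?_
  unfold phiK
  have hq : √s ≠ 0 := (Real.sqrt_pos.2 hs).ne'
  have hq2 : s = √s ^ 2 := (Real.sq_sqrt hs.le).symm
  have : 1 / (2 * √s) / √s ^ 2 = (√s)⁻¹ * (1 / (2 * s)) := by
    rw [show 1 / (2 * s) = 1 / (2 * √s ^ 2) by rw [← hq2]]
    field_simp
  simp only [Pi.inv_apply]
  linear_combination (-Real.exp (-(x ^ 2 / (4 * s)))) * this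

lemma wK_dx (x s : ℝ) : HasDerivAt (fun y => wK y s)
    (-((1 / s - 1) * Real.sinh ((1 / s - 1) * x) / Real.cosh (1 / s - 1))) x := by
  have h1 := (((hasDerivAt_id x).const_mul (1 / s - 1)).cosh.div_const
    (Real.cosh (1 / s - 1))).const_sub 1
  refine h1.congr_deriv ?_
  simp; ring

lemma wK_dxx (x s : ℝ) : HasDerivAt
    (fun y => -((1 / s - 1) * Real.sinh ((1 / s - 1) * y) / Real.cosh (1 / s - 1)))
    (-((1 / s - 1) ^ 2 * Real.cosh ((1 / s - 1) * x) / Real.cosh (1 / s - 1))) x := by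
  have h1 := ((((hasDerivAt_id x).const_mul (1 / s - 1)).sinh.const_mul (1 / s - 1)).div_const
    (Real.cosh (1 / s - 1))).neg
  refine h1.congr_deriv ?_
  simp; ring

lemma wK_ds (x : ℝ) {s : ℝ} (hs : 0 < s) : HasDerivAt (fun τ => wK x τ)
    ((1 / s) ^ 2 * (x * Real.sinh ((1 / s - 1) * x) / Real.cosh (1 / s - 1)
      - Real.cosh ((1 / s - 1) * x) * Real.sinh (1 / s - 1) / Real.cosh (1 / s - 1) ^ 2)) s := by
  have hc : HasDerivAt (fun τ : ℝ => 1 / τ - 1) (-(1 / s) ^ 2) s := by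
    have := ((hasDerivAt_inv hs.ne').sub_const 1)
    simpa using this
  have hC := Real.cosh_pos (1 / s - 1)
  have h1 := ((hc.mul_const x).cosh.div hc.cosh hC.ne').const_sub 1
  refine h1.congr_deriv ?_
  field_simp
  ring

noncomputable def VK (p : ℝ × ℝ) : ℝ := phiK p.1 p.2 * wK p.1 p.2

lemma VK_smooth : ContDiffOn ℝ (⊤ : ℕ∞) VK {p : ℝ × ℝ | 0 < p.2} := by
  intro p hp
  have hp : 0 < p.2 := hp
  refine ContDiffAt.contDiffWithinAt ?_
  have h2 : ContDiffAt ℝ (⊤ : ℕ∞) (fun p : ℝ × ℝ => p.2) p := contDiffAt_snd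
  have h1 : ContDiffAt ℝ (⊤ : ℕ∞) (fun p : ℝ × ℝ => p.1) p := contDiffAt_fst
  have hc : ContDiffAt ℝ (⊤ : ℕ∞) (fun p : ℝ × ℝ => 1 / p.2 - 1) p :=
    (contDiffAt_const.div h2 hp.ne').sub contDiffAt_const
  unfold VK phiK wK
  refine ContDiffAt.mul (ContDiffAt.mul ?_ ?_) ?_
  · exact (h2.sqrt hp.ne').inv (Real.sqrt_pos.2 hp).ne'
  · exact ((h1.pow 2).div (contDiffAt_const.mul h2) (by positivity)).neg.exp
  · exact contDiffAt_const.sub ((hc.mul h1).cosh.div hc.cosh (Real.cosh_pos _).ne')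

lemma VK_diff {p : ℝ × ℝ} (hp : 0 < p.2) : DifferentiableAt ℝ VK p :=
  diffAt_of (isOpen_lt continuous_const continuous_snd) VK_smooth hp

lemma VK_pdx (x : ℝ) {s : ℝ} (hs : 0 < s) : pdx VK (x, s) = phiK x s * (-(x / (2 * s))) * wK x s
    + phiK x s * (-((1 / s - 1) * Real.sinh ((1 / s - 1) * x) / Real.cosh (1 / s - 1))) :=
  (hasDerivAt_pdx (VK_diff (p := (x, s)) hs)).unique ((phiK_dx x s).mul (wK_dx x s))

lemma wK_ineq {x s : ℝ} (hs : 0 < s) (hs3 : s ≤ 1 / 3) (hx : |x| ≤ 1) :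
    ((1 / s) ^ 2 * (x * Real.sinh ((1 / s - 1) * x) / Real.cosh (1 / s - 1)
      - Real.cosh ((1 / s - 1) * x) * Real.sinh (1 / s - 1) / Real.cosh (1 / s - 1) ^ 2))
    + (x / s) * (-((1 / s - 1) * Real.sinh ((1 / s - 1) * x) / Real.cosh (1 / s - 1)))
    ≤ (-((1 / s - 1) ^ 2 * Real.cosh ((1 / s - 1) * x) / Real.cosh (1 / s - 1))) := by
  have hσ : 3 ≤ 1 / s := by rw [le_div_iff₀ hs]; linarith
  rw [div_eq_mul_one_div x s]
  obtain ⟨c, hc⟩ : ∃ c, c = 1 / s - 1 := ⟨_, rfl⟩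
  have hσc : 1 / s = c + 1 := by linarith
  rw [← hc, hσc]
  have hc2 : 2 ≤ c := by linarith
  have hC := Real.cosh_pos c
  have hK := Real.cosh_pos (c * x)
  have hxS : x * Real.sinh (c * x) ≤ Real.cosh (c * x) := by
    have h1 : |Real.sinh (c * x)| ≤ Real.cosh (c * x) := by
      rw [abs_le]
      have := Real.sinh_lt_cosh (c * x)
      have h2 := Real.sinh_lt_cosh (-(c * x))
      rw [Real.sinh_neg, Real.cosh_neg] at h2
      constructor <;> linarith
    calc x * Real.sinh (c * x) ≤ |x| * |Real.sinh (c * x)| := by rw [← abs_mul]; exact le_abs_self _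
      _ ≤ 1 * |Real.sinh (c * x)| := by gcongr
      _ ≤ _ := by linarith
  have hT : (c + 1) ^ 2 * (Real.cosh c - Real.sinh c) ≤ c * Real.cosh c := by
    rw [Real.cosh_sub_sinh, Real.cosh_eq]
    have he : 1 + 2 * c + 2 * c ^ 2 ≤ Real.exp c * Real.exp c := by
      have := Real.quadratic_le_exp_of_nonneg (x := 2 * c) (by linarith)
      rw [← Real.exp_add, show c + c = 2 * c by ring]
      nlinarith
    have hm : Real.exp c * Real.exp (-c) = 1 := by rw [← Real.exp_add]; simp
    have hp := Real.exp_pos (-c)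
    have h3 : 2 * (c + 1) ^ 2 ≤ c * (Real.exp c * Real.exp c + 1) := by
      have : c * (1 + 2 * c + 2 * c ^ 2 + 1) ≤ c * (Real.exp c * Real.exp c + 1) := by gcongr
      nlinarith [mul_nonneg (sub_nonneg.2 hc2) (sub_nonneg.2 hc2), pow_nonneg (sub_nonneg.2 hc2) 3]
    have h4 : Real.exp c = Real.exp c * Real.exp c * Real.exp (-c) := by
      rw [mul_assoc, hm, mul_one]
    rw [h4]
    nlinarith
  have hT' : (c + 1) - (c + 1) ^ 2 * (Real.sinh c / Real.cosh c) + c ^ 2 ≤ 0 := by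
    have : (c + 1) ^ 2 * (1 - Real.sinh c / Real.cosh c) ≤ c := by
      rw [show 1 - Real.sinh c / Real.cosh c = (Real.cosh c - Real.sinh c) / Real.cosh c by field_simp,
        ← mul_div_assoc, div_le_iff₀ hC]
      exact hT
    nlinarith
  have e : (c + 1) ^ 2 * (x * Real.sinh (c * x) / Real.cosh c
      - Real.cosh (c * x) * Real.sinh c / Real.cosh c ^ 2)
      + x * (c + 1) * -(c * Real.sinh (c * x) / Real.cosh c)
      - -(c ^ 2 * Real.cosh (c * x) / Real.cosh c)
      = ((c + 1) * (x * Real.sinh (c * x)) + Real.cosh (c * x) *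
        (- ((c + 1) ^ 2 * (Real.sinh c / Real.cosh c)) + c ^ 2)) / Real.cosh c := by
    field_simp
    ring
  rw [← sub_nonpos, e]
  apply div_nonpos_of_nonpos_of_nonneg _ hC.le
  nlinarith [mul_le_mul_of_nonneg_left hxS (show 0 ≤ c + 1 by linarith), mul_nonneg hK.le (neg_nonneg.2 hT')]

lemma phiK_nonneg (x s : ℝ) : 0 ≤ phiK x s := by unfold phiK; positivity

lemma VK_sub {x s : ℝ} (hs : 0 < s) (hs3 : s ≤ 1 / 3) (hx : |x| ≤ 1) :
    pdt VK (x, s) ≤ pdx (pdx VK) (x, s) := by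
  have hU : IsOpen {p : ℝ × ℝ | 0 < p.2} := isOpen_lt continuous_const continuous_snd
  have e1 := (hasDerivAt_pdt (VK_diff (p := (x, s)) hs)).unique ((phiK_ds x hs).mul (wK_ds x hs))
  have e2 := hasDerivAt_pdx (diffAt_of hU (pdx_contDiffOn hU VK_smooth) (p := (x, s)) hs)
  have e3 : (fun y => pdx VK (y, s)) = fun y => phiK y s * (-(y / (2 * s))) * wK y s
    + phiK y s * (-((1 / s - 1) * Real.sinh ((1 / s - 1) * y) / Real.cosh (1 / s - 1))) :=
    funext fun y => VK_pdx y hs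
  rw [e3] at e2
  have e4 := e2.unique ((((phiK_dx x s).mul ((hasDerivAt_id x).div_const (2 * s)).neg).mul
    (wK_dx x s)).add ((phiK_dx x s).mul (wK_dxx x s)))
  rw [e1, e4]
  have := mul_le_mul_of_nonneg_left (wK_ineq hs hs3 hx) (phiK_nonneg x s)
  simp only [id, Pi.mul_apply, Pi.neg_apply]
  have ha : x ^ 2 / (4 * s ^ 2) = (x / (2 * s)) ^ 2 := by rw [div_pow]; ring
  have hb : x / s = 2 * (x / (2 * s)) := by field_simp
  rw [ha]
  rw [hb] at this
  nlinarith

noncomputable def WK (p : ℝ × ℝ) : ℝ := Real.cos (π * p.1 / 2) * Real.exp (-(π ^ 2 / 4 * p.2))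

lemma WK_smooth : ContDiff ℝ (⊤ : ℕ∞) WK := by
  unfold WK
  fun_prop

lemma WK_diff (p : ℝ × ℝ) : DifferentiableAt ℝ WK p := WK_smooth.differentiable (by simp) p

lemma WK_pdx (x s : ℝ) :
    pdx WK (x, s) = -(π / 2) * Real.sin (π * x / 2) * Real.exp (-(π ^ 2 / 4 * s)) := by
  have h1 : HasDerivAt (fun y : ℝ => π * y / 2) (π / 2) x := by
    refine (((hasDerivAt_id x).const_mul π).div_const 2).congr_deriv (by simp)
  rw [(hasDerivAt_pdx (WK_diff (x, s))).unique (h1.cos.mul_const (Real.exp (-(π ^ 2 / 4 * s))))]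
  ring

lemma WK_pde (x s : ℝ) : pdt WK (x, s) = pdx (pdx WK) (x, s) := by
  have h1 : HasDerivAt (fun y : ℝ => π * y / 2) (π / 2) x := by
    refine (((hasDerivAt_id x).const_mul π).div_const 2).congr_deriv (by simp)
  have h2 : HasDerivAt (fun y : ℝ => -(π ^ 2 / 4 * y)) (-(π ^ 2 / 4)) s := by
    refine (((hasDerivAt_id s).const_mul (π ^ 2 / 4)).neg).congr_deriv (by simp)
  have hs := pdx_contDiffOn isOpen_univ WK_smooth.contDiffOn
  have e2 := hasDerivAt_pdx (diffAt_of isOpen_univ hs (mem_univ (x, s)))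
  rw [funext fun y => WK_pdx y s] at e2
  rw [(hasDerivAt_pdt (WK_diff (x, s))).unique (h2.exp.const_mul (Real.cos (π * x / 2))),
    e2.unique ((h1.sin.const_mul (-(π / 2))).mul_const _)]
  ring

noncomputable def kk (s : ℝ) : ℝ := s ^ (-(3 : ℝ) / 2) * Real.exp (-(1 / (4 * s)))

lemma kk_eq {s : ℝ} (hs : 0 < s) : kk s = s⁻¹ * phiK 1 s := by
  unfold kk phiK
  rw [show (-(3 : ℝ) / 2) = (-1) + (-(1 / 2)) by norm_num, Real.rpow_add hs, Real.rpow_neg_one,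
    Real.rpow_neg hs.le, ← Real.sqrt_eq_rpow]
  simp; ring

lemma kk_nonneg {s : ℝ} (hs : 0 < s) : 0 ≤ kk s := by
  unfold kk; positivity

lemma kk_cont : ContinuousOn kk (Ioi 0) := by
  intro s hs
  have hs : 0 < s := hs
  unfold kk
  refine ContinuousAt.continuousWithinAt ?_
  refine ContinuousAt.mul (Real.continuousAt_rpow_const _ _ (Or.inl hs.ne')) ?_
  refine (ContinuousAt.div continuousAt_const (by fun_prop) (by positivity)).neg.rexp

lemma kk_le {s : ℝ} (hs : 1 / 3 ≤ s) : kk s ≤ 6 := by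
  have h0 : 0 < s := by linarith
  rw [kk_eq h0]
  unfold phiK
  have h1 : s⁻¹ ≤ 3 := by rw [inv_le_comm₀ h0 (by norm_num)]; linarith
  have h2 : (√s)⁻¹ ≤ 2 := by
    rw [inv_le_comm₀ (Real.sqrt_pos.2 h0) (by norm_num)]
    apply Real.le_sqrt_of_sq_le; norm_num; linarith
  have h3 : Real.exp (-(1 ^ 2 / (4 * s))) ≤ 1 := by
    rw [Real.exp_le_one_iff]; simp; positivity
  calc s⁻¹ * ((√s)⁻¹ * Real.exp (-(1 ^ 2 / (4 * s)))) ≤ 3 * (2 * 1) := by gcongr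
    _ = 6 := by norm_num

lemma wK_one (s : ℝ) : wK 1 s = 0 := by
  unfold wK; rw [mul_one, div_self (Real.cosh_pos _).ne', sub_self]

lemma wK_even (x s : ℝ) : wK (-x) s = wK x s := by
  unfold wK; rw [mul_neg, Real.cosh_neg]

lemma phiK_even (x s : ℝ) : phiK (-x) s = phiK x s := by
  unfold phiK; rw [neg_sq]

lemma wK_le (x s : ℝ) : wK x s ≤ 1 := by
  unfold wK
  have := div_nonneg (Real.cosh_pos ((1 / s - 1) * x)).le (Real.cosh_pos (1 / s - 1)).le
  linarith

lemma VK_flux {s : ℝ} (hs : 0 < s) (hs3 : s ≤ 1 / 3) : (1 / 3) * kk s ≤ - pdx VK (1, s) := by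
  rw [VK_pdx 1 hs, wK_one, kk_eq hs, mul_one]
  have hσ : 3 ≤ 1 / s := by rw [le_div_iff₀ hs]; linarith
  have ht : 1 / 2 ≤ Real.sinh (1 / s - 1) / Real.cosh (1 / s - 1) := by
    rw [le_div_iff₀ (Real.cosh_pos _), Real.cosh_eq, Real.sinh_eq]
    have h1 := Real.add_one_le_exp (1 / s - 1)
    have h2 : Real.exp (-(1 / s - 1)) ≤ 1 := by rw [Real.exp_le_one_iff]; linarith
    linarith
  rw [mul_div_assoc]
  have h3 : 1 / 3 * (1 / s) ≤ (1 / s - 1) * (Real.sinh (1 / s - 1) / Real.cosh (1 / s - 1)) := by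
    nlinarith
  have := mul_le_mul_of_nonneg_left h3 (phiK_nonneg 1 s)
  rw [inv_eq_one_div]
  linarith

lemma VK_flux' (x : ℝ) {s : ℝ} (hs : 0 < s) : pdx VK (-x, s) = - pdx VK (x, s) := by
  rw [VK_pdx _ hs, VK_pdx _ hs, wK_even, phiK_even, mul_neg (1 / s - 1) x, Real.sinh_neg]
  ring

lemma VK_third {x : ℝ} (hx : |x| ≤ 1) :
    Real.exp (-1) / 4 * Real.cos (π * x / 2) ≤ VK (x, 1 / 3) := by
  have hphi : Real.exp (-1) ≤ phiK x (1 / 3) := by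
    unfold phiK
    have h1 : (1 : ℝ) ≤ (√(1 / 3))⁻¹ := by
      rw [one_le_inv₀ (by positivity)]
      apply Real.sqrt_le_one.2 ; norm_num
    have h2 : Real.exp (-1) ≤ Real.exp (-(x ^ 2 / (4 * (1 / 3)))) := by
      apply Real.exp_le_exp.2
      have : x ^ 2 ≤ 1 := by rwa [sq_le_one_iff_abs_le_one]
      rw [show x ^ 2 / (4 * (1 / 3)) = 3 / 4 * x ^ 2 by ring]
      linarith
    calc Real.exp (-1) = 1 * Real.exp (-1) := by ring
      _ ≤ _ := by gcongr
  have hw : (1 / 2) * (1 - |x|) ≤ wK x (1 / 3) := by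
    unfold wK
    norm_num
    have hC2 : 2 ≤ Real.cosh 2 := by
      rw [Real.cosh_eq]
      have h := Real.quadratic_le_exp_of_nonneg (x := 2) (by norm_num)
      have := Real.exp_pos (-2)
      linarith
    have hcx : Real.cosh (2 * x) ≤ (1 - |x|) + |x| * Real.cosh 2 := by
      have hy : ∀ y : ℝ, 0 ≤ y → y ≤ 1 → Real.cosh (2 * y) ≤ (1 - y) + y * Real.cosh 2 := by
        intro y h0 h1
        have c1 := convexOn_exp.2 (mem_univ 0) (mem_univ 2) (sub_nonneg.2 h1) h0 (by ring)
        have c2 := convexOn_exp.2 (mem_univ 0) (mem_univ (-2)) (sub_nonneg.2 h1) h0 (by ring)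
        simp only [smul_eq_mul, mul_zero, zero_add, Real.exp_zero, mul_one] at c1 c2
        rw [Real.cosh_eq, Real.cosh_eq, mul_comm 2 y, ← mul_neg]
        linarith
      have := hy |x| (abs_nonneg x) hx
      rwa [← abs_two, ← abs_mul, Real.cosh_abs, abs_two] at this
    have : Real.cosh (2 * x) / Real.cosh 2 ≤ 1 - 1 / 2 * (1 - |x|) := by
      rw [div_le_iff₀ (by linarith)]
      nlinarith [abs_nonneg x]
    linarith
  have hcos : Real.cos (π * x / 2) ≤ 2 * (1 - |x|) := by
    have h1 : Real.cos (π * x / 2) = Real.sin (π / 2 * (1 - |x|)) := by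
      rw [← Real.cos_abs, ← Real.cos_pi_div_two_sub]
      congr 1
      rw [abs_div, abs_mul, abs_of_pos Real.pi_pos, abs_two]; ring
    rw [h1]
    have h0 : 0 ≤ 1 - |x| := by linarith
    have := Real.sin_le (x := π / 2 * (1 - |x|)) (by positivity)
    nlinarith [Real.pi_le_four]
  unfold VK
  have hx0 : 0 ≤ 1 - |x| := by linarith
  calc Real.exp (-1) / 4 * Real.cos (π * x / 2) ≤ Real.exp (-1) / 4 * (2 * (1 - |x|)) := by gcongr
    _ = Real.exp (-1) * ((1 / 2) * (1 - |x|)) := by ring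
    _ ≤ phiK x (1 / 3) * wK x (1 / 3) := by
      apply mul_le_mul hphi hw (by positivity) (phiK_nonneg _ _)

noncomputable def mm : ℝ := Real.exp (-1) / 4 * Real.exp (-(π ^ 2 / 4)) / 6

lemma mm_pos : 0 < mm := by unfold mm; positivity

lemma mm_le : mm ≤ 1 / 3 := by
  unfold mm
  have h1 : Real.exp (-1) ≤ 1 := by rw [Real.exp_le_one_iff]; norm_num
  have h2 : Real.exp (-(π ^ 2 / 4)) ≤ 1 := by rw [Real.exp_le_one_iff]; simp; positivity
  have : Real.exp (-1) * Real.exp (-(π ^ 2 / 4)) ≤ 1 * 1 := by gcongr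
  linarith

lemma cos_nonneg_of {x : ℝ} (hx : x ∈ Icc (-1 : ℝ) 1) : 0 ≤ Real.cos (π * x / 2) := by
  have := Real.pi_pos
  apply Real.cos_nonneg_of_mem_Icc
  constructor <;> nlinarith [hx.1, hx.2]

lemma stage_main {h : ℝ → ℝ → ℝ} (hh : IsHeatSolution h)
    (h0 : ∀ x ∈ Set.Icc (-1 : ℝ) 1, ∀ t ∈ Set.Icc (-1 : ℝ) 0, 0 ≤ h x t)
    {r ε : ℝ} (hr : 0 < r) (hr1 : r < 1) (hε : 0 < ε) (hε3 : ε ≤ 1 / 3) :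
    mm * ((∫ x in (-1 : ℝ)..1, Real.cos (π * x / 2) * heatG h r (x, 1)) +
      ∫ s in ε..1, kk s * (heatG h r (1, s) + heatG h r (-1, s))) ≤
      ∫ x in (-1 : ℝ)..1, phiK x ε * heatG h r (x, ε) := by
  set G := heatG h r with hGd
  have hU := heatU_open r
  have hGs : ContDiffOn ℝ (⊤ : ℕ∞) G (heatU r) := heatG_smooth hh r
  have hsubU : ∀ {a b : ℝ}, 0 < a → b ≤ 1 → Icc (-1 : ℝ) 1 ×ˢ Icc a b ⊆ heatU r :=
    fun ha hb => heatU_sub hr hr1 ha hb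
  have hG0 : ∀ x ∈ Icc (-1 : ℝ) 1, ∀ s ∈ Icc (0 : ℝ) 1, 0 ≤ G (x, s) := by
    intro x hx s hs
    refine h0 _ ⟨?_, ?_⟩ _ ⟨?_, ?_⟩ <;> simp only <;> nlinarith [hx.1, hx.2, hs.1, hs.2, mul_nonneg (sq_nonneg r) hs.1]
  have cx : ∀ s, 0 < s → s ≤ 1 → ContinuousOn (fun x => G (x, s)) (uIcc (-1) 1) := by
    intro s hs hs1
    rw [uIcc_of_le (by norm_num)]
    exact hGs.continuousOn.comp (f := fun x => (x, s)) (by fun_prop)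
      (fun x hx => hsubU hs hs1 ⟨hx, le_rfl, le_rfl⟩)
  have cs : ∀ x ∈ Icc (-1 : ℝ) 1, ∀ a b, 0 < a → a ≤ b → b ≤ 1 →
      ContinuousOn (fun s => G (x, s)) (uIcc a b) := by
    intro x hx a b ha hab hb
    rw [uIcc_of_le hab]
    exact hGs.continuousOn.comp (f := fun s => (x, s)) (by fun_prop)
      (fun s hs => hsubU ha hb ⟨hx, hs⟩)
  have m1 : (1 : ℝ) ∈ Icc (-1 : ℝ) 1 := by norm_num
  have m2 : (-1 : ℝ) ∈ Icc (-1 : ℝ) 1 := by norm_num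
  have cB : ∀ a b, 0 < a → a ≤ b → b ≤ 1 →
      ContinuousOn (fun s => G (1, s) + G (-1, s)) (uIcc a b) := fun a b ha hab hb =>
    (cs 1 m1 a b ha hab hb).add (cs (-1) m2 a b ha hab hb)
  have ck : ∀ a b, 0 < a → a ≤ b → ContinuousOn kk (uIcc a b) := by
    intro a b ha hab
    rw [uIcc_of_le hab]
    exact kk_cont.mono fun s hs => lt_of_lt_of_le ha hs.1
  have nB : ∀ s ∈ Icc (0 : ℝ) 1, 0 ≤ G (1, s) + G (-1, s) := fun s hs =>
    add_nonneg (hG0 1 m1 s hs) (hG0 (-1) m2 s hs)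
  -- stage 1
  have hVU : ContDiffOn ℝ (⊤ : ℕ∞) VK (heatU r) := VK_smooth.mono fun p hp => heatU_pos hp
  have g1 := green_heat hU hVU hGs hε3 (hsubU hε (by norm_num))
    (fun p hp => heatG_pde hh r p (hsubU hε (by norm_num) hp))
    (fun p hp => VK_sub (lt_of_lt_of_le hε hp.2.1) hp.2.2 (abs_le.2 hp.1))
    (fun p hp => hG0 p.1 hp.1 p.2 ⟨hε.le.trans hp.2.1, hp.2.2.trans (by norm_num)⟩)
    (fun s _ => by simp [VK, wK_one]) (fun s _ => by simp [VK, wK_even, wK_one])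
  -- stage 2
  have g2 := green_heat hU WK_smooth.contDiffOn hGs (show (1 / 3 : ℝ) ≤ 1 by norm_num)
    (hsubU (by norm_num) le_rfl)
    (fun p hp => heatG_pde hh r p (hsubU (by norm_num) le_rfl hp))
    (fun p hp => (WK_pde p.1 p.2).le)
    (fun p hp => hG0 p.1 hp.1 p.2 ⟨le_trans (by norm_num) hp.2.1, hp.2.2⟩)
    (fun s _ => by simp [WK]) (fun s _ => by simp [WK, neg_div])
  have hVc : ∀ s, 0 < s → ContinuousOn (fun x => VK (x, s)) (uIcc (-1) 1) := fun s hs =>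
    VK_smooth.continuousOn.comp (f := fun x => (x, s)) (by fun_prop) (fun x _ => hs)
  have le11 : (-1 : ℝ) ≤ 1 := by norm_num
  have le31 : (1 / 3 : ℝ) ≤ 1 := by norm_num
  have ccos : ContinuousOn (fun x : ℝ => Real.cos (π * x / 2)) (uIcc (-1) 1) := by fun_prop
  -- bounds
  have b1 : ∫ x in (-1 : ℝ)..1, VK (x, ε) * G (x, ε) ≤ ∫ x in (-1 : ℝ)..1, phiK x ε * G (x, ε) := by
    refine intervalIntegral.integral_mono_on le11
      ((hVc ε hε).mul (cx ε hε (by linarith))).intervalIntegrable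
      (ContinuousOn.mul ?_ (cx ε hε (by linarith))).intervalIntegrable ?_
    · unfold phiK; fun_prop
    · intro x hx
      refine mul_le_mul_of_nonneg_right ?_ (hG0 x hx ε ⟨hε.le, by linarith⟩)
      exact mul_le_of_le_one_right (phiK_nonneg _ _) (wK_le _ _)
  have b2 : ∫ s in ε..(1 / 3), mm * (kk s * (G (1, s) + G (-1, s))) ≤
      ∫ s in ε..(1 / 3), (- pdx VK (1, s) * G (1, s) + pdx VK (-1, s) * G (-1, s)) := by
    refine intervalIntegral.integral_mono_on hε3
      (continuousOn_const.mul ((ck _ _ hε hε3).mul (cB _ _ hε hε3 le31))).intervalIntegrable ?_ ?_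
    · have hx : ∀ x ∈ Icc (-1 : ℝ) 1, ContinuousOn (fun s => pdx VK (x, s)) (uIcc ε (1 / 3)) := by
        intro x hx
        rw [uIcc_of_le hε3]
        exact (pdx_contDiffOn hU hVU).continuousOn.comp (f := fun s => (x, s)) (by fun_prop)
          (fun s hs => hsubU hε le31 ⟨hx, hs⟩)
      exact (((hx 1 m1).neg.mul (cs 1 m1 _ _ hε hε3 le31)).add
        ((hx _ m2).mul (cs _ m2 _ _ hε hε3 le31))).intervalIntegrable
    · intro s hs
      have hs0 : 0 < s := lt_of_lt_of_le hε hs.1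
      have hf := VK_flux hs0 hs.2
      rw [VK_flux' 1 hs0]
      have hm : mm * kk s ≤ - pdx VK (1, s) :=
        (mul_le_mul_of_nonneg_right mm_le (kk_nonneg hs0)).trans hf
      have := mul_le_mul_of_nonneg_right hm (nB s ⟨hs0.le, hs.2.trans le31⟩)
      linarith
  have b3 : Real.exp (-1) / 4 * ∫ x in (-1 : ℝ)..1, WK (x, 1 / 3) * G (x, 1 / 3) ≤
      ∫ x in (-1 : ℝ)..1, VK (x, 1 / 3) * G (x, 1 / 3) := by
    rw [← intervalIntegral.integral_const_mul]
    refine intervalIntegral.integral_mono_on le11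
      (continuousOn_const.mul (ContinuousOn.mul ?_ (cx _ (by norm_num) le31))).intervalIntegrable
      ((hVc _ (by norm_num)).mul (cx _ (by norm_num) le31)).intervalIntegrable ?_
    · unfold WK; fun_prop
    · intro x hx
      rw [← mul_assoc]
      refine mul_le_mul_of_nonneg_right ?_ (hG0 x hx _ (by norm_num))
      refine le_trans ?_ (VK_third (abs_le.2 hx))
      have h2 : Real.exp (-(π ^ 2 / 4 * (1 / 3))) ≤ 1 := by rw [Real.exp_le_one_iff]; simp; positivity
      have := mul_le_of_le_one_right (cos_nonneg_of hx) h2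
      exact mul_le_mul_of_nonneg_left this (by positivity)
  have b4 : Real.exp (-1) / 4 * ∫ x in (-1 : ℝ)..1, WK (x, 1) * G (x, 1)
      ≥ mm * ∫ x in (-1 : ℝ)..1, Real.cos (π * x / 2) * G (x, 1) := by
    rw [← intervalIntegral.integral_const_mul, ← intervalIntegral.integral_const_mul]
    refine intervalIntegral.integral_mono_on le11
      (continuousOn_const.mul (ccos.mul (cx _ (by norm_num) le_rfl))).intervalIntegrable
      (continuousOn_const.mul (ContinuousOn.mul ?_ (cx _ (by norm_num) le_rfl))).intervalIntegrable ?_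
    · unfold WK; fun_prop
    · intro x hx
      have hn := mul_nonneg (cos_nonneg_of hx) (hG0 x hx 1 (by norm_num))
      have : mm ≤ Real.exp (-1) / 4 * Real.exp (-(π ^ 2 / 4)) := by
        unfold mm; exact div_le_self (by positivity) (by norm_num)
      have := mul_le_mul_of_nonneg_right this hn
      simp only [WK, mul_one]
      linarith
  have b5 : Real.exp (-1) / 4 * ∫ s in (1 / 3 : ℝ)..1, (- pdx WK (1, s) * G (1, s) + pdx WK (-1, s) * G (-1, s))
      ≥ ∫ s in (1 / 3 : ℝ)..1, mm * (kk s * (G (1, s) + G (-1, s))) := by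
    rw [← intervalIntegral.integral_const_mul]
    refine intervalIntegral.integral_mono_on le31
      (continuousOn_const.mul ((ck _ _ (by norm_num) le31).mul (cB _ _ (by norm_num) le31 le_rfl))).intervalIntegrable ?_ ?_
    · refine (continuousOn_const.mul ((ContinuousOn.mul ?_ (cs 1 m1 _ _ (by norm_num) le31 le_rfl)).add
        (ContinuousOn.mul ?_ (cs _ m2 _ _ (by norm_num) le31 le_rfl)))).intervalIntegrable
      · simp only [WK_pdx]; fun_prop
      · simp only [WK_pdx]; fun_prop
    · intro s hs
      have hs0 : 0 < s := lt_of_lt_of_le (by norm_num) hs.1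
      have e1 : pdx WK (1, s) = -(π / 2) * Real.exp (-(π ^ 2 / 4 * s)) := by
        rw [WK_pdx]; simp
      have e2 : pdx WK (-1, s) = (π / 2) * Real.exp (-(π ^ 2 / 4 * s)) := by
        rw [WK_pdx]; simp [neg_div]
      rw [e1, e2]
      have hn := nB s ⟨hs0.le, hs.2⟩
      have hq : Real.exp (-(π ^ 2 / 4)) ≤ Real.exp (-(π ^ 2 / 4 * s)) := by
        apply Real.exp_le_exp.2
        have := mul_le_of_le_one_right (show 0 ≤ π ^ 2 / 4 by positivity) hs.2
        linarith
      have hp : 1 ≤ π / 2 := by linarith [Real.two_le_pi]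
      have : mm * kk s ≤ Real.exp (-1) / 4 * (π / 2 * Real.exp (-(π ^ 2 / 4 * s))) := by
        calc mm * kk s ≤ mm * 6 := mul_le_mul_of_nonneg_left (kk_le hs.1) mm_pos.le
          _ = Real.exp (-1) / 4 * (1 * Real.exp (-(π ^ 2 / 4))) := by unfold mm; ring
          _ ≤ _ := by gcongr
      have := mul_le_mul_of_nonneg_right this hn
      linarith
  have b6 : ∫ s in ε..1, mm * (kk s * (G (1, s) + G (-1, s))) =
      (∫ s in ε..(1 / 3), mm * (kk s * (G (1, s) + G (-1, s)))) +
      ∫ s in (1 / 3 : ℝ)..1, mm * (kk s * (G (1, s) + G (-1, s))) := by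
    refine (intervalIntegral.integral_add_adjacent_intervals ?_ ?_).symm
    · exact (continuousOn_const.mul ((ck _ _ hε hε3).mul (cB _ _ hε hε3 le31))).intervalIntegrable
    · exact (continuousOn_const.mul ((ck _ _ (by norm_num) le31).mul (cB _ _ (by norm_num) le31 le_rfl))).intervalIntegrable
  rw [mul_add, ← intervalIntegral.integral_const_mul (a := ε), b6]
  have g2' := mul_le_mul_of_nonneg_left g2 (show 0 ≤ Real.exp (-1) / 4 by positivity)
  rw [mul_add] at g2'
  linarith

noncomputable def HH (h : ℝ → ℝ → ℝ) (x t : ℝ) : ℝ :=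
  h (max (-1) (min 1 x)) (max (-1) (min 0 t))

lemma HH_eq {h : ℝ → ℝ → ℝ} {x t : ℝ} (hx : x ∈ Icc (-1 : ℝ) 1) (ht : t ∈ Icc (-1 : ℝ) 0) :
    HH h x t = h x t := by
  unfold HH
  rw [min_eq_right hx.2, max_eq_right hx.1, min_eq_right ht.2, max_eq_right ht.1]

lemma clamp1 (x : ℝ) : max (-1) (min 1 x) ∈ Icc (-1 : ℝ) 1 :=
  ⟨le_max_left _ _, max_le (by norm_num) (min_le_left _ _)⟩

lemma clamp0 (x : ℝ) : max (-1) (min 0 x) ∈ Icc (-1 : ℝ) 0 :=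
  ⟨le_max_left _ _, max_le (by norm_num) (min_le_left _ _)⟩

lemma HH_cont {h : ℝ → ℝ → ℝ} (hh : IsHeatSolution h) :
    Continuous (fun p : ℝ × ℝ => HH h p.1 p.2) :=
  hh.1.comp_continuous (f := fun p : ℝ × ℝ => (max (-1) (min 1 p.1), max (-1) (min 0 p.2)))
    (by fun_prop) (fun p => ⟨clamp1 _, clamp0 _⟩)

lemma HH_bdd {h : ℝ → ℝ → ℝ} (hh : IsHeatSolution h) : ∃ M, ∀ x t, |HH h x t| ≤ M := by
  obtain ⟨M, hM⟩ := (isCompact_Icc.prod isCompact_Icc).exists_bound_of_continuousOn hh.1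
  exact ⟨M, fun x t => hM (_, _) ⟨clamp1 x, clamp0 t⟩⟩

lemma stage_eps {h : ℝ → ℝ → ℝ} (hh : IsHeatSolution h)
    (h0 : ∀ x ∈ Set.Icc (-1 : ℝ) 1, ∀ t ∈ Set.Icc (-1 : ℝ) 0, 0 ≤ h x t)
    {ε : ℝ} (hε : 0 < ε) (hε3 : ε ≤ 1 / 3) :
    mm * ((∫ x in (-1 : ℝ)..1, Real.cos (π * x / 2) * h x (-1)) +
      ∫ s in ε..1, kk s * (h 1 (-s) + h (-1) (-s))) ≤
      ∫ x in (-1 : ℝ)..1, phiK x ε * HH h x (-ε) := by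
  have hc : ∀ {X : Type} [TopologicalSpace X] {f g : X → ℝ}, Continuous f → Continuous g →
      Continuous fun z => HH h (f z) (g z) := fun hf hg => (HH_cont hh).comp (hf.prodMk hg)
  have le11 : (-1 : ℝ) ≤ 1 := by norm_num
  have leε : ε ≤ 1 := by linarith
  have kc : Continuous fun s => kk (max s ε) :=
    kk_cont.comp_continuous (by fun_prop) (fun s => lt_of_lt_of_le hε (le_max_right _ _))
  have pc : Continuous fun x => phiK x ε := by unfold phiK; fun_prop
  set A : ℝ → ℝ := fun r => ∫ x in (-1 : ℝ)..1, Real.cos (π * x / 2) * HH h (r * x) (-r ^ 2 * 1) with hA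
  set B : ℝ → ℝ := fun r => ∫ s in ε..1, kk (max s ε) *
    (HH h (r * 1) (-r ^ 2 * s) + HH h (r * (-1)) (-r ^ 2 * s)) with hB
  set D : ℝ → ℝ := fun r => ∫ x in (-1 : ℝ)..1, phiK x ε * HH h (r * x) (-r ^ 2 * ε) with hD
  have cA : Continuous A := by
    refine intervalIntegral.continuous_parametric_intervalIntegral_of_continuous' ?_ _ _
    exact Continuous.mul (by fun_prop) (hc (by fun_prop) (by fun_prop))
  have cB : Continuous B := by
    refine intervalIntegral.continuous_parametric_intervalIntegral_of_continuous' ?_ _ _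
    exact Continuous.mul (kc.comp continuous_snd)
      ((hc (by fun_prop) (by fun_prop)).add (hc (by fun_prop) (by fun_prop)))
  have cD : Continuous D := by
    refine intervalIntegral.continuous_parametric_intervalIntegral_of_continuous' ?_ _ _
    exact Continuous.mul (pc.comp continuous_snd) (hc (by fun_prop) (by fun_prop))
  have hmem : ∀ r ∈ Icc (0 : ℝ) 1, ∀ x ∈ Icc (-1 : ℝ) 1, r * x ∈ Icc (-1 : ℝ) 1 := by
    intro r hr x hx
    constructor <;> nlinarith [hr.1, hr.2, hx.1, hx.2]
  have hmem' : ∀ r ∈ Icc (0 : ℝ) 1, ∀ s ∈ Icc (0 : ℝ) 1, -r ^ 2 * s ∈ Icc (-1 : ℝ) 0 := by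
    intro r hr s hs
    have h1 : r ^ 2 ≤ 1 := pow_le_one₀ hr.1 hr.2
    have h2 := mul_nonneg (sq_nonneg r) hs.1
    constructor
    · nlinarith [hs.2, hs.1]
    · linarith
  have eA : ∀ r ∈ Icc (0 : ℝ) 1, A r = ∫ x in (-1 : ℝ)..1, Real.cos (π * x / 2) * heatG h r (x, 1) := by
    intro r hr
    refine intervalIntegral.integral_congr fun x hx => ?_
    rw [uIcc_of_le le11] at hx
    rw [HH_eq (hmem r hr x hx) (hmem' r hr 1 (by norm_num))]
    rfl
  have eB : ∀ r ∈ Icc (0 : ℝ) 1, B r = ∫ s in ε..1, kk s * (heatG h r (1, s) + heatG h r (-1, s)) := by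
    intro r hr
    refine intervalIntegral.integral_congr fun s hs => ?_
    rw [uIcc_of_le leε] at hs
    have hs' : s ∈ Icc (0 : ℝ) 1 := ⟨hε.le.trans hs.1, hs.2⟩
    rw [HH_eq (hmem r hr 1 (by norm_num)) (hmem' r hr s hs'),
      HH_eq (hmem r hr (-1) (by norm_num)) (hmem' r hr s hs'), max_eq_left hs.1]
    rfl
  have eD : ∀ r ∈ Icc (0 : ℝ) 1, D r = ∫ x in (-1 : ℝ)..1, phiK x ε * heatG h r (x, ε) := by
    intro r hr
    refine intervalIntegral.integral_congr fun x hx => ?_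
    rw [uIcc_of_le le11] at hx
    rw [HH_eq (hmem r hr x hx) (hmem' r hr ε ⟨hε.le, leε⟩)]
    rfl
  have hr : ∀ᶠ r in 𝓝[<] (1 : ℝ), mm * (A r + B r) ≤ D r := by
    filter_upwards [Ioo_mem_nhdsLT (show (0 : ℝ) < 1 by norm_num)] with r hr
    have hr' := Ioo_subset_Icc_self hr
    rw [eA r hr', eB r hr', eD r hr']
    exact stage_main hh h0 hr.1 hr.2 hε hε3
  have lim : mm * (A 1 + B 1) ≤ D 1 := by
    refine le_of_tendsto_of_tendsto (b := 𝓝[<] (1 : ℝ)) (f := fun r => mm * (A r + B r)) (g := D) ?_ ?_ hr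
    · exact ((continuous_const.mul (cA.add cB)).tendsto 1).mono_left nhdsWithin_le_nhds
    · exact (cD.tendsto 1).mono_left nhdsWithin_le_nhds
  rw [eA 1 (by norm_num), eB 1 (by norm_num)] at lim
  simpa [heatG, hD] using lim

lemma J_eq (H : ℝ → ℝ) {ε : ℝ} (hε : 0 < ε) :
    ∫ x, phiK x ε * H x = ∫ y, Real.exp (-(1 / 4) * y ^ 2) * H (√ε * y) := by
  have hq : 0 < √ε := Real.sqrt_pos.2 hε
  have := Measure.integral_comp_mul_left (fun x => Real.exp (-(x ^ 2 / (4 * ε))) * H x) (√ε)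
  rw [abs_of_pos (inv_pos.2 hq), smul_eq_mul, ← integral_const_mul] at this
  simp only [phiK, mul_assoc]
  rw [← this]
  congr 1
  ext y
  rw [mul_pow, Real.sq_sqrt hε.le]
  congr 2
  field_simp

lemma J_bound {h : ℝ → ℝ → ℝ} (hh : IsHeatSolution h)
    (h0 : ∀ x ∈ Set.Icc (-1 : ℝ) 1, ∀ t ∈ Set.Icc (-1 : ℝ) 0, 0 ≤ h x t)
    {ε : ℝ} (hε : 0 < ε) :
    ∫ x in (-1 : ℝ)..1, phiK x ε * HH h x (-ε) ≤
      ∫ y, Real.exp (-(1 / 4) * y ^ 2) * HH h (√ε * y) (-ε) := by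
  rw [← J_eq (fun x => HH h x (-ε)) hε, intervalIntegral.integral_of_le (by norm_num)]
  refine setIntegral_le_integral ?_ (Eventually.of_forall fun x =>
    mul_nonneg (phiK_nonneg _ _) (h0 _ (clamp1 _) _ (clamp0 _)))
  obtain ⟨M, hM⟩ := HH_bdd hh
  have h1 : Integrable (fun x => phiK x ε) := by
    have := (integrable_exp_neg_mul_sq (b := 1 / (4 * ε)) (by positivity)).const_mul ((√ε)⁻¹)
    refine this.congr (Eventually.of_forall fun x => ?_)
    simp only [phiK]
    congr 2; ring
  refine h1.mul_bdd (c := M) ?_ (Eventually.of_forall fun x => hM _ _)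
  have : Continuous fun x => HH h x (-ε) := (HH_cont hh).comp (continuous_id.prodMk continuous_const)
  exact this.aestronglyMeasurable

lemma J_lim {h : ℝ → ℝ → ℝ} (hh : IsHeatSolution h) :
    Tendsto (fun ε => ∫ y, Real.exp (-(1 / 4) * y ^ 2) * HH h (√ε * y) (-ε)) (𝓝[>] 0)
      (𝓝 (√(π / (1 / 4)) * h 0 0)) := by
  obtain ⟨M, hM⟩ := HH_bdd hh
  have hc : ∀ {X : Type} [TopologicalSpace X] {f g : X → ℝ}, Continuous f → Continuous g →
      Continuous fun z => HH h (f z) (g z) := fun hf hg => (HH_cont hh).comp (hf.prodMk hg)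
  have : Continuous (fun ε => ∫ y, Real.exp (-(1 / 4) * y ^ 2) * HH h (√ε * y) (-ε)) := by
    refine continuous_of_dominated (bound := fun y => Real.exp (-(1 / 4) * y ^ 2) * M) ?_ ?_ ?_ ?_
    · intro ε
      exact (Continuous.mul (by fun_prop) (hc (by fun_prop) (by fun_prop))).aestronglyMeasurable
    · intro ε
      refine Eventually.of_forall fun y => ?_
      rw [norm_mul, Real.norm_of_nonneg (Real.exp_pos _).le]
      exact mul_le_mul_of_nonneg_left (hM _ _) (Real.exp_pos _).le
    · exact (integrable_exp_neg_mul_sq (by norm_num)).mul_const M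
    · refine Eventually.of_forall fun y => ?_
      exact Continuous.mul (by fun_prop) (hc (by fun_prop) (by fun_prop))
  have h2 := (this.tendsto 0).mono_left (nhdsWithin_le_nhds (s := Ioi 0))
  convert h2 using 2
  simp only [Real.sqrt_zero, zero_mul, neg_zero]
  rw [integral_mul_const, integral_gaussian, HH_eq (by norm_num) (by norm_num)]

/-- There is a constant `C > 0` such that every nonnegative solution of the heat equation on
the rectangle `[-1,1] × [-1,0]` satisfies
`h(0,0) ≥ (1/C) ∫_{-1}^{1} cos(πy/2) h(y,-1) dy
          + (1/C) ∫_0^1 t^{-3/2} e^{-1/(4t)} (h(1,-t) + h(-1,-t)) dt`. -/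
theorem heat_solution_value_lower_bound :
    ∃ C > (0 : ℝ), ∀ h : ℝ → ℝ → ℝ, IsHeatSolution h →
      (∀ x ∈ Set.Icc (-1 : ℝ) 1, ∀ t ∈ Set.Icc (-1 : ℝ) 0, 0 ≤ h x t) →
      h 0 0 ≥ (1 / C) * (∫ y in (-1 : ℝ)..1, Real.cos (Real.pi * y / 2) * h y (-1))
        + (1 / C) * (∫ t in (0 : ℝ)..1,
            t ^ (-(3 : ℝ) / 2) * Real.exp (-(1 / (4 * t))) * (h 1 (-t) + h (-1) (-t))) := by
  have hq : 0 < √(π / (1 / 4)) := Real.sqrt_pos.2 (by positivity)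
  refine ⟨√(π / (1 / 4)) / mm, div_pos hq mm_pos, ?_⟩
  intro h hh h0
  set I : ℝ := ∫ y in (-1 : ℝ)..1, Real.cos (Real.pi * y / 2) * h y (-1) with hI
  have hE : ∀ ε ∈ Ioc (0 : ℝ) (1 / 3), mm * (I + ∫ s in ε..1, kk s * (h 1 (-s) + h (-1) (-s))) ≤
      ∫ y, Real.exp (-(1 / 4) * y ^ 2) * HH h (√ε * y) (-ε) := fun ε hε =>
    (stage_eps hh h0 hε.1 hε.2).trans (J_bound hh h0 hε.1)
  have hJ := J_lim hh
  have hev : ∀ᶠ ε in 𝓝[>] (0 : ℝ), ε ∈ Ioc (0 : ℝ) (1 / 3) := Ioc_mem_nhdsGT (by norm_num)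
  suffices hs : mm * (I + ∫ s in (0 : ℝ)..1, kk s * (h 1 (-s) + h (-1) (-s)))
      ≤ √(π / (1 / 4)) * h 0 0 by
    change h 0 0 ≥ 1 / (√(π / (1 / 4)) / mm) * I + 1 / (√(π / (1 / 4)) / mm) *
      ∫ s in (0 : ℝ)..1, kk s * (h 1 (-s) + h (-1) (-s))
    rw [one_div_div, ← mul_add, div_mul_eq_mul_div, ge_iff_le, div_le_iff₀ hq]
    linarith
  by_cases hint : IntervalIntegrable (fun s => kk s * (h 1 (-s) + h (-1) (-s))) volume 0 1
  · have hc : Tendsto (fun ε => ∫ s in ε..1, kk s * (h 1 (-s) + h (-1) (-s))) (𝓝[>] (0 : ℝ))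
        (𝓝 (∫ s in (0 : ℝ)..1, kk s * (h 1 (-s) + h (-1) (-s)))) := by
      have h1 := intervalIntegral.continuousOn_primitive_interval_left
        (f := fun s => kk s * (h 1 (-s) + h (-1) (-s))) (a := 0) (b := 1) (μ := volume)
        ((intervalIntegrable_iff' (by finiteness)).1 hint)
      have h2 := h1 0 left_mem_uIcc
      refine h2.mono_left ?_
      rw [uIcc_of_le zero_le_one, ← nhdsWithin_Ioc_eq_nhdsGT (zero_lt_one (α := ℝ))]
      exact nhdsWithin_mono _ Ioc_subset_Icc_self
    exact le_of_tendsto_of_tendsto ((hc.const_add I).const_mul mm) hJ (hev.mono hE)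
  · rw [intervalIntegral.integral_undef hint, add_zero]
    refine ge_of_tendsto hJ (hev.mono fun ε hε => le_trans ?_ (hE ε hε))
    refine mul_le_mul_of_nonneg_left ?_ mm_pos.le
    have : 0 ≤ ∫ s in ε..1, kk s * (h 1 (-s) + h (-1) (-s)) := by
      refine intervalIntegral.integral_nonneg (by linarith [hε.2]) fun s hs => ?_
      have hs0 : 0 < s := lt_of_lt_of_le hε.1 hs.1
      have ht : -s ∈ Icc (-1 : ℝ) 0 := ⟨by linarith [hs.2], by linarith⟩
      exact mul_nonneg (kk_nonneg hs0)
        (add_nonneg (h0 1 (by norm_num) _ ht) (h0 (-1) (by norm_num) _ ht))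
    linarith
end

section
/- There exists a constant C > 0 with the following property. Let h : [-1,1] × [-1,0] → ℝ be a nonnegative solution of the heat equation on the rectangle [-1,1] × [-1,0]. Then |∂²_x h(0,0)| ≤ C ∫_{-1}^{1} cos(πy/2) · h(y,-1) dy + C ∫_0^1 t^{-7/2} e^{-1/(4t)} ( h(1,-t) + h(-1,-t) ) dt. -/
open Real Set

noncomputable def hG (x s : ℝ) : ℝ := Real.exp (-(x ^ 2 / (4 * s))) / √s
noncomputable def hG1 (x s : ℝ) : ℝ := (-x / (2 * s)) * hG x s
noncomputable def hK (x s : ℝ) : ℝ := (x ^ 2 / (4 * s ^ 2) - 1 / (2 * s)) * hG x s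
noncomputable def hK1 (x s : ℝ) : ℝ := (-x ^ 3 / (8 * s ^ 3) + 3 * x / (4 * s ^ 2)) * hG x s
noncomputable def hK2 (x s : ℝ) : ℝ :=
  (x ^ 4 / (16 * s ^ 4) - 3 * x ^ 2 / (4 * s ^ 3) + 3 / (4 * s ^ 2)) * hG x s

lemma hG_dx (x s : ℝ) (hs : 0 < s) : HasDerivAt (fun y => hG y s) (hG1 x s) x := by
  unfold hG1 hG
  have h1 : HasDerivAt (fun y : ℝ => -(y ^ 2 / (4 * s))) (-(2 * x / (4 * s))) x := by
    simpa using! (((hasDerivAt_id x).pow 2).div_const (4 * s)).neg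
  refine (h1.exp.div_const (√s)).congr_deriv ?_
  field_simp
  ring

lemma hG1_dx (x s : ℝ) (hs : 0 < s) : HasDerivAt (fun y => hG1 y s) (hK x s) x := by
  unfold hG1
  have h1 : HasDerivAt (fun y : ℝ => -y / (2 * s)) (-1 / (2 * s)) x := by
    simpa using ((hasDerivAt_id x).neg).div_const (2 * s)
  refine (h1.mul (hG_dx x s hs)).congr_deriv ?_
  unfold hK hG1
  field_simp
  ring

lemma hK_dx (x s : ℝ) (hs : 0 < s) : HasDerivAt (fun y => hK y s) (hK1 x s) x := by
  unfold hK
  have h1 : HasDerivAt (fun y : ℝ => y ^ 2 / (4 * s ^ 2) - 1 / (2 * s)) (2 * x / (4 * s ^ 2)) x := by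
    simpa using (((hasDerivAt_id x).pow 2).div_const (4 * s ^ 2)).sub_const (1 / (2 * s))
  refine (h1.mul (hG_dx x s hs)).congr_deriv ?_
  unfold hK1 hG1
  field_simp
  ring

lemma hK1_dx (x s : ℝ) (hs : 0 < s) : HasDerivAt (fun y => hK1 y s) (hK2 x s) x := by
  unfold hK1
  have h1 : HasDerivAt (fun y : ℝ => -y ^ 3 / (8 * s ^ 3) + 3 * y / (4 * s ^ 2))
      (-(3 * x ^ 2) / (8 * s ^ 3) + 3 * 1 / (4 * s ^ 2)) x := by
    have a := (((hasDerivAt_id x).pow 3).neg).div_const (8 * s ^ 3)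
    have b := (((hasDerivAt_id x).const_mul 3).div_const (4 * s ^ 2))
    simpa using! a.add b
  refine (h1.mul (hG_dx x s hs)).congr_deriv ?_
  unfold hK2 hG1
  field_simp
  ring

lemma hG_ds (x s : ℝ) (hs : 0 < s) : HasDerivAt (fun r => hG x r) (hK x s) s := by
  unfold hG
  have h1 : HasDerivAt (fun r : ℝ => -(x ^ 2 / (4 * r))) (x ^ 2 / (4 * s ^ 2)) s := by
    have := ((((hasDerivAt_id s).const_mul 4).inv (by simp; positivity)).const_mul (x ^ 2)).neg
    refine (this.congr_deriv ?_).congr_of_eventuallyEq ?_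
    · simp; field_simp
    · filter_upwards with r
      simp [div_eq_mul_inv]
  have h2 := Real.hasDerivAt_sqrt hs.ne'
  refine (h1.exp.div h2 (by positivity)).congr_deriv ?_
  unfold hK hG
  have h3 : √s ^ 2 = s := Real.sq_sqrt hs.le
  have h4 : 0 < √s := Real.sqrt_pos.2 hs
  field_simp
  rw [h3]
  ring

lemma hK_ds (x s : ℝ) (hs : 0 < s) : HasDerivAt (fun r => hK x r) (hK2 x s) s := by
  unfold hK
  have h1 : HasDerivAt (fun r : ℝ => x ^ 2 / (4 * r ^ 2) - 1 / (2 * r))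
      (-x ^ 2 / (2 * s ^ 3) + 1 / (2 * s ^ 2)) s := by
    have a := ((((hasDerivAt_id s).pow 2).const_mul 4).inv (by simp; positivity)).const_mul (x ^ 2)
    have b := (((hasDerivAt_id s).const_mul 2).inv (by simp; positivity))
    refine ((a.sub b).congr_deriv ?_).congr_of_eventuallyEq ?_
    · simp; field_simp; ring
    · filter_upwards with r
      simp [div_eq_mul_inv]
  refine (h1.mul (hG_ds x s hs)).congr_deriv ?_
  unfold hK2 hK
  field_simp
  ring

lemma hG_cont : ContinuousOn (fun p : ℝ × ℝ => hG p.1 p.2) {p | 0 < p.2} := by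
  unfold hG
  have : ∀ p ∈ {p : ℝ × ℝ | 0 < p.2}, p.2 ≠ 0 := fun p hp => ne_of_gt hp
  have h4 : ∀ p ∈ {p : ℝ × ℝ | 0 < p.2}, √p.2 ≠ 0 := fun p hp => (Real.sqrt_pos.2 hp).ne'
  refine ContinuousOn.div ?_ (by fun_prop) h4
  refine Real.continuous_exp.comp_continuousOn (ContinuousOn.neg (ContinuousOn.div (by fun_prop) (by fun_prop) ?_))
  intro p hp
  have := this p hp
  simpa

lemma hK_cont : ContinuousOn (fun p : ℝ × ℝ => hK p.1 p.2) {p | 0 < p.2} := by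
  unfold hK
  have : ∀ p ∈ {p : ℝ × ℝ | 0 < p.2}, p.2 ≠ 0 := fun p hp => ne_of_gt hp
  refine ContinuousOn.mul (ContinuousOn.sub ?_ ?_) hG_cont <;>
  refine ContinuousOn.div (by fun_prop) (by fun_prop) ?_ <;>
  · intro p hp
    have := this p hp
    simpa

lemma hK2_cont : ContinuousOn (fun p : ℝ × ℝ => hK2 p.1 p.2) {p | 0 < p.2} := by
  unfold hK2
  have : ∀ p ∈ {p : ℝ × ℝ | 0 < p.2}, p.2 ≠ 0 := fun p hp => ne_of_gt hp
  refine ContinuousOn.mul (ContinuousOn.add (ContinuousOn.sub ?_ ?_) ?_) hG_cont <;>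
  refine ContinuousOn.div (by fun_prop) (by fun_prop) ?_ <;>
  · intro p hp
    have := this p hp
    simpa

lemma hG_neg (x s : ℝ) : hG (-x) s = hG x s := by simp [hG]
lemma hK_neg (x s : ℝ) : hK (-x) s = hK x s := by simp [hK, hG_neg]
lemma hK1_neg (x s : ℝ) : hK1 (-x) s = - hK1 x s := by simp only [hK1, hG_neg]; ring
lemma hG1_neg (x s : ℝ) : hG1 (-x) s = - hG1 x s := by simp only [hG1, hG_neg]; ring

lemma exp_small (a : ℝ) (ha : 0 < a) (m : ℕ) :
    ∃ D > 0, ∀ s : ℝ, 0 < s → Real.exp (-(a / s)) ≤ D * s ^ m := by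
  refine ⟨m.factorial / a ^ m, by positivity, fun s hs => ?_⟩
  have := Real.pow_div_factorial_le_exp (x := a / s) (by positivity) m
  rw [Real.exp_neg, inv_le_comm₀ (Real.exp_pos _) (by positivity)]
  refine le_trans (le_of_eq ?_) this
  rw [div_pow]
  field_simp

lemma sqrt_ge (s : ℝ) (hs : 0 < s) (h1 : s ≤ 1) : s ≤ √s := by
  rw [Real.le_sqrt hs.le hs.le]; nlinarith

lemma hG_nonneg (x s : ℝ) : 0 ≤ hG x s := by unfold hG; positivity

lemma hG_le (c x s : ℝ) (hs : 0 < s) (h1 : s ≤ 1) (hc : c ≤ x ^ 2) :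
    hG x s ≤ Real.exp (-((c / 4) / s)) / s := by
  unfold hG
  have := sqrt_ge s hs h1
  have e : c / 4 / s ≤ x ^ 2 / (4 * s) := by
    rw [div_div]; gcongr
  gcongr

/-- far-field smallness -/
lemma far_small : ∃ D > 0, ∀ x s : ℝ, 0 < s → s ≤ 1 → 1 ≤ |x| → |x| ≤ 3 →
    |hG x s| ≤ D * s ∧ |hG1 x s| ≤ D * s ∧ |hK x s| ≤ D * s := by
  obtain ⟨D, hD, H⟩ := exp_small (1/4) (by norm_num) 4
  refine ⟨3 * D, by positivity, fun x s hs h1 hx hx3 => ?_⟩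
  have hx2 : 1 ≤ x ^ 2 := by rw [← sq_abs]; nlinarith
  have hx9 : x ^ 2 ≤ 9 := by rw [← sq_abs]; nlinarith [abs_nonneg x]
  have hg := hG_le 1 x s hs h1 hx2
  have hg0 := hG_nonneg x s
  have hg3 : hG x s ≤ D * s ^ 3 := by
    refine hg.trans ?_
    rw [div_le_iff₀ hs]
    refine (H s hs).trans (le_of_eq (by ring))
  have key : ∀ q : ℝ, |q| ≤ 3 / s ^ 2 → |q * hG x s| ≤ 3 * D * s := by
    intro q hq
    rw [abs_mul, abs_of_nonneg hg0]
    calc |q| * hG x s ≤ 3 / s ^ 2 * (D * s ^ 3) := by gcongr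
      _ = 3 * D * s := by field_simp
  have hs2 : s ^ 2 ≤ s := by nlinarith
  have e1 : 1 ≤ 1 / s ^ 2 := by rw [le_div_iff₀ (by positivity)]; nlinarith
  have e2 : 1 / s ≤ 1 / s ^ 2 := by gcongr
  have e3 : 3 / s ^ 2 = 3 * (1 / s ^ 2) := by ring
  refine ⟨?_, ?_, ?_⟩
  · have := key 1 (by rw [abs_one]; linarith)
    simpa using this
  · refine key _ ?_
    rw [abs_div, abs_neg, abs_of_pos (by positivity : 0 < 2 * s)]
    calc |x| / (2 * s) ≤ 3 / (2 * s) := by gcongr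
      _ = 3 / 2 * (1 / s) := by field_simp
      _ ≤ _ := by have := one_div_pos.2 hs; rw [e3]; linarith
  · refine key _ ?_
    have e4 : x ^ 2 / (4 * s ^ 2) ≤ 9 / 4 * (1 / s ^ 2) := by
      calc x ^ 2 / (4 * s ^ 2) ≤ 9 / (4 * s ^ 2) := by gcongr
        _ = _ := by field_simp
    have e5 : 0 ≤ x ^ 2 / (4 * s ^ 2) := by positivity
    have e6 : 1 / (2 * s) = 1 / 2 * (1 / s) := by field_simp
    have := one_div_pos.2 hs
    rw [abs_le, e3, e6]
    constructor <;> linarith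

lemma hK2_three : ∃ B > 0, ∀ s : ℝ, 0 < s → s ≤ 1 → |hK2 3 s| ≤ 2 * B * Real.exp (-(1 / s)) := by
  obtain ⟨D, hD, H⟩ := exp_small (5/4) (by norm_num) 5
  refine ⟨7 * D, by positivity, fun s hs h1 => ?_⟩
  have hg := hG_le 9 3 s hs h1 (by norm_num)
  have hg0 := hG_nonneg 3 s
  have hg4 : hG 3 s ≤ D * s ^ 4 * Real.exp (-(1 / s)) := by
    refine hg.trans ?_
    rw [div_le_iff₀ hs]
    have : Real.exp (-(9 / 4 / s)) = Real.exp (-(5 / 4 / s)) * Real.exp (-(1 / s)) := by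
      rw [← Real.exp_add]; congr 1; field_simp; norm_num
    rw [this]
    calc _ ≤ D * s ^ 5 * Real.exp (-(1 / s)) := by gcongr; exact H s hs
      _ = _ := by ring
  have hq : |(3 : ℝ) ^ 4 / (16 * s ^ 4) - 3 * 3 ^ 2 / (4 * s ^ 3) + 3 / (4 * s ^ 2)| ≤ 14 / s ^ 4 := by
    have : (3 : ℝ) ^ 4 / (16 * s ^ 4) - 3 * 3 ^ 2 / (4 * s ^ 3) + 3 / (4 * s ^ 2)
      = (81 / 16 - 27 / 4 * s + 3 / 4 * s ^ 2) / s ^ 4 := by field_simp; ring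
    rw [this, abs_div, abs_of_pos (by positivity : 0 < s ^ 4)]
    gcongr
    rw [abs_le]
    constructor <;> nlinarith
  unfold hK2
  rw [abs_mul, abs_of_nonneg hg0]
  calc _ ≤ 14 / s ^ 4 * (D * s ^ 4 * Real.exp (-(1 / s))) := by gcongr
    _ = _ := by field_simp; ring

noncomputable def hW (s : ℝ) : ℝ := s ^ (-(7 : ℝ) / 2) * Real.exp (-(1 / (4 * s)))

lemma hW_eq (s : ℝ) (hs : 0 < s) : hW s = hG 1 s / s ^ 3 := by
  unfold hW hG
  have : s ^ (-(7 : ℝ) / 2) = 1 / (√s * s ^ 3) := by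
    rw [Real.sqrt_eq_rpow, ← Real.rpow_natCast, ← Real.rpow_add hs, one_div, ← Real.rpow_neg hs.le]
    norm_num
  rw [this]
  simp only [one_pow]
  field_simp

lemma hW_nonneg (s : ℝ) (hs : 0 ≤ s) : 0 ≤ hW s := by unfold hW; positivity

lemma hW_bdd : ∃ D > 0, ∀ s : ℝ, 0 < s → s ≤ 1 → hW s ≤ D := by
  obtain ⟨D, hD, H⟩ := exp_small (1/4) (by norm_num) 4
  refine ⟨D, hD, fun s hs h1 => ?_⟩
  rw [hW_eq s hs, div_le_iff₀ (by positivity)]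
  refine (hG_le 1 1 s hs h1 (by norm_num)).trans ?_
  rw [div_le_iff₀ hs]
  exact (H s hs).trans (le_of_eq (by ring))

lemma hW_int : IntervalIntegrable hW MeasureTheory.volume 0 1 := by
  obtain ⟨D, hD, H⟩ := hW_bdd
  rw [intervalIntegrable_iff_integrableOn_Ioc_of_le zero_le_one]
  refine MeasureTheory.Measure.integrableOn_of_bounded (M := D) (by simp) ?_ ?_
  · have : Measurable hW := by unfold hW; fun_prop
    exact this.aestronglyMeasurable
  · refine (MeasureTheory.ae_restrict_mem measurableSet_Ioc).mono fun s hs => ?_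
    rw [Real.norm_of_nonneg (hW_nonneg s hs.1.le)]
    exact H s hs.1 hs.2

lemma hW_exp (s : ℝ) (hs : 0 < s) (h1 : s ≤ 1) : Real.exp (-(1 / s)) ≤ hW s := by
  unfold hW
  have a : 1 ≤ s ^ (-(7 : ℝ) / 2) := Real.one_le_rpow_of_pos_of_le_one_of_nonpos hs h1 (by norm_num)
  have b : Real.exp (-(1 / s)) ≤ Real.exp (-(1 / (4 * s))) := by gcongr; linarith
  nlinarith [Real.exp_pos (-(1 / s))]

lemma hK1_bd (s : ℝ) (hs : 0 < s) (h1 : s ≤ 1) : |hK1 1 s| ≤ hW s ∧ |hK1 3 s| ≤ 6 * hW s := by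
  have g1 := hG_nonneg 1 s
  have g3 := hG_nonneg 3 s
  have g31 : hG 3 s ≤ hG 1 s := by unfold hG; gcongr; norm_num
  rw [hW_eq s hs]
  unfold hK1
  rw [abs_mul, abs_mul, abs_of_nonneg g1, abs_of_nonneg g3]
  constructor
  · have : |(-1 ^ 3 / (8 * s ^ 3) + 3 * 1 / (4 * s ^ 2) : ℝ)| ≤ 1 / s ^ 3 := by
      have : (-1 ^ 3 / (8 * s ^ 3) + 3 * 1 / (4 * s ^ 2) : ℝ) = (-1 / 8 + 3 / 4 * s) / s ^ 3 := by
        field_simp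
      rw [this, abs_div, abs_of_pos (by positivity : 0 < s ^ 3)]
      gcongr
      rw [abs_le]; constructor <;> linarith
    calc _ ≤ 1 / s ^ 3 * hG 1 s := by gcongr
      _ = _ := by field_simp
  · have : |(-3 ^ 3 / (8 * s ^ 3) + 3 * 3 / (4 * s ^ 2) : ℝ)| ≤ 6 / s ^ 3 := by
      have : (-3 ^ 3 / (8 * s ^ 3) + 3 * 3 / (4 * s ^ 2) : ℝ) = (-27 / 8 + 9 / 4 * s) / s ^ 3 := by
        field_simp; ring
      rw [this, abs_div, abs_of_pos (by positivity : 0 < s ^ 3)]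
      gcongr
      rw [abs_le]; constructor <;> linarith
    calc _ ≤ 6 / s ^ 3 * hG 1 s := by gcongr
      _ = _ := by field_simp

noncomputable def hV (B σ y s : ℝ) : ℝ :=
  σ * (hK y s - hK (y - 2) s - hK (y + 2) s + hK 3 s) + B * (1 - y ^ 2) * Real.exp (-(1 / s))
noncomputable def hVy (B σ y s : ℝ) : ℝ :=
  σ * (hK1 y s - hK1 (y - 2) s - hK1 (y + 2) s) - 2 * B * y * Real.exp (-(1 / s))
noncomputable def hVyy (B σ y s : ℝ) : ℝ :=
  σ * (hK2 y s - hK2 (y - 2) s - hK2 (y + 2) s) - 2 * B * Real.exp (-(1 / s))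
noncomputable def hVs (B σ y s : ℝ) : ℝ :=
  σ * (hK2 y s - hK2 (y - 2) s - hK2 (y + 2) s + hK2 3 s)
    + B * (1 - y ^ 2) * (Real.exp (-(1 / s)) * (1 / s ^ 2))

lemma hV_dy (B σ y s : ℝ) (hs : 0 < s) : HasDerivAt (fun x => hV B σ x s) (hVy B σ y s) y := by
  have a := hK_dx y s hs
  have b := (hK_dx (y - 2) s hs).comp_sub_const y 2
  have c := (hK_dx (y + 2) s hs).comp_add_const y 2
  have d := ((((hasDerivAt_id y).pow 2).const_sub 1).const_mul B).mul_const (Real.exp (-(1 / s)))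
  have e := ((((a.sub b).sub c).add_const (hK 3 s)).const_mul σ).add d
  refine e.congr_deriv ?_
  unfold hVy
  simp
  ring

lemma hVy_dy (B σ y s : ℝ) (hs : 0 < s) : HasDerivAt (fun x => hVy B σ x s) (hVyy B σ y s) y := by
  have a := hK1_dx y s hs
  have b := (hK1_dx (y - 2) s hs).comp_sub_const y 2
  have c := (hK1_dx (y + 2) s hs).comp_add_const y 2
  have d := ((hasDerivAt_id y).const_mul (2 * B)).mul_const (Real.exp (-(1 / s)))
  have e := (((a.sub b).sub c).const_mul σ).sub d
  refine e.congr_deriv ?_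
  unfold hVyy
  simp

lemma hV_ds (B σ y s : ℝ) (hs : 0 < s) : HasDerivAt (fun r => hV B σ y r) (hVs B σ y s) s := by
  have a := hK_ds y s hs
  have b := hK_ds (y - 2) s hs
  have c := hK_ds (y + 2) s hs
  have c3 := hK_ds 3 s hs
  have d0 : HasDerivAt (fun r : ℝ => -(1 / r)) (1 / s ^ 2) s := by
    simpa [one_div] using! (hasDerivAt_inv hs.ne').neg
  have d := d0.exp.const_mul (B * (1 - y ^ 2))
  exact ((((a.sub b).sub c).add c3).const_mul σ).add d

lemma hexp_cont : ContinuousOn (fun p : ℝ × ℝ => Real.exp (-(1 / p.2))) {p | 0 < p.2} := by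
  refine Real.continuous_exp.comp_continuousOn (ContinuousOn.neg (ContinuousOn.div (by fun_prop) (by fun_prop) ?_))
  exact fun p hp => ne_of_gt hp

lemma shift_cont {f : ℝ → ℝ → ℝ} (hf : ContinuousOn (fun p : ℝ × ℝ => f p.1 p.2) {p | 0 < p.2})
    (a : ℝ) : ContinuousOn (fun p : ℝ × ℝ => f (p.1 + a) p.2) {p | 0 < p.2} := by
  have : ContinuousOn (fun p : ℝ × ℝ => (p.1 + a, p.2)) {p | 0 < p.2} := by fun_prop
  exact hf.comp this (fun p hp => hp)

lemma three_cont {f : ℝ → ℝ → ℝ} (hf : ContinuousOn (fun p : ℝ × ℝ => f p.1 p.2) {p | 0 < p.2})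
    (a : ℝ) : ContinuousOn (fun p : ℝ × ℝ => f a p.2) {p | 0 < p.2} := by
  have : ContinuousOn (fun p : ℝ × ℝ => (a, p.2)) {p | 0 < p.2} := by fun_prop
  exact hf.comp this (fun p hp => hp)

lemma hV_cont (B σ : ℝ) : ContinuousOn (fun p : ℝ × ℝ => hV B σ p.1 p.2) {p | 0 < p.2} := by
  unfold hV
  have a := hK_cont
  have b := shift_cont hK_cont (-2)
  have c := shift_cont hK_cont 2
  have d := three_cont hK_cont 3
  have e := hexp_cont
  simp only [← sub_eq_add_neg] at b
  exact (continuousOn_const.mul (((a.sub b).sub c).add d)).add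
    (ContinuousOn.mul (by fun_prop) e)

lemma hVyy_cont (B σ : ℝ) : ContinuousOn (fun p : ℝ × ℝ => hVyy B σ p.1 p.2) {p | 0 < p.2} := by
  unfold hVyy
  have a := hK2_cont
  have b := shift_cont hK2_cont (-2)
  have c := shift_cont hK2_cont 2
  have e := hexp_cont
  simp only [← sub_eq_add_neg] at b
  exact (continuousOn_const.mul (((a.sub b).sub c))).sub
    (ContinuousOn.mul (by fun_prop) e)

lemma hVs_cont (B σ : ℝ) : ContinuousOn (fun p : ℝ × ℝ => hVs B σ p.1 p.2) {p | 0 < p.2} := by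
  unfold hVs
  have a := hK2_cont
  have b := shift_cont hK2_cont (-2)
  have c := shift_cont hK2_cont 2
  have d := three_cont hK2_cont 3
  have e := hexp_cont
  simp only [← sub_eq_add_neg] at b
  refine (continuousOn_const.mul (((a.sub b).sub c).add d)).add
    (ContinuousOn.mul (by fun_prop) (e.mul (ContinuousOn.div (by fun_prop) (by fun_prop) ?_)))
  exact fun p hp => pow_ne_zero _ (ne_of_gt hp)

lemma hV_one (B σ s : ℝ) : hV B σ 1 s = 0 := by
  unfold hV
  have := hK_neg 1 s
  norm_num
  right; linarith

lemma hV_neg (B σ y s : ℝ) : hV B σ (-y) s = hV B σ y s := by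
  unfold hV
  have h1 := hK_neg y s
  have h2 := hK_neg (y + 2) s
  have h3 := hK_neg (y - 2) s
  rw [show -y - 2 = -(y + 2) by ring, show -y + 2 = -(y - 2) by ring, h1, h2, h3]
  ring

lemma hVy_neg (B σ y s : ℝ) : hVy B σ (-y) s = - hVy B σ y s := by
  unfold hVy
  have h1 := hK1_neg y s
  have h2 := hK1_neg (y + 2) s
  have h3 := hK1_neg (y - 2) s
  rw [show -y - 2 = -(y + 2) by ring, show -y + 2 = -(y - 2) by ring, h1, h2, h3]
  ring

lemma hV_super (B σ : ℝ) (hB : 0 < B) (hσ : |σ| = 1)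
    (H : ∀ s : ℝ, 0 < s → s ≤ 1 → |hK2 3 s| ≤ 2 * B * Real.exp (-(1 / s)))
    (y s : ℝ) (hs : 0 < s) (h1 : s ≤ 1) (hy : y ∈ Icc (-1 : ℝ) 1) :
    hVyy B σ y s ≤ hVs B σ y s := by
  unfold hVyy hVs
  have := H s hs h1
  have h2 : |σ * hK2 3 s| ≤ 2 * B * Real.exp (-(1 / s)) := by rw [abs_mul, hσ, one_mul]; exact this
  have h3 : 0 ≤ B * (1 - y ^ 2) * (Real.exp (-(1 / s)) * (1 / s ^ 2)) := by
    have : 0 ≤ 1 - y ^ 2 := by nlinarith [hy.1, hy.2]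
    positivity
  have := (abs_le.1 h2).1
  linarith

lemma hVy_bd (B σ : ℝ) (hB : 0 < B) (hσ : |σ| = 1) (s : ℝ) (hs : 0 < s) (h1 : s ≤ 1) :
    |hVy B σ 1 s| ≤ (8 + 2 * B) * hW s := by
  obtain ⟨a, b⟩ := hK1_bd s hs h1
  have c := hW_exp s hs h1
  have d := hK1_neg 1 s
  have e : hVy B σ 1 s = σ * (2 * hK1 1 s - hK1 3 s) - 2 * B * Real.exp (-(1 / s)) := by
    unfold hVy; norm_num [d]; left; ring
  rw [e]
  have f : |σ * (2 * hK1 1 s - hK1 3 s)| ≤ 8 * hW s := by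
    rw [abs_mul, hσ, one_mul]
    rw [abs_le] at *
    constructor <;> linarith
  have g : 2 * B * Real.exp (-(1 / s)) ≤ 2 * B * hW s := by gcongr
  have g' : 0 ≤ 2 * B * Real.exp (-(1 / s)) := by positivity
  rw [abs_le] at *
  constructor <;> linarith

lemma cos_lb (y : ℝ) (hy : y ∈ Icc (-1 : ℝ) 1) : 1 - |y| ≤ Real.cos (Real.pi * y / 2) := by
  have hp := Real.pi_pos
  have h0 := abs_nonneg y
  have h1 : |y| ≤ 1 := abs_le.2 hy
  have := Real.one_sub_mul_le_cos (x := Real.pi * |y| / 2) (by positivity) (by nlinarith)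
  have e : Real.cos (Real.pi * |y| / 2) = Real.cos (Real.pi * y / 2) := by
    rcases abs_cases y with h | h <;> rw [h.1]
    rw [← Real.cos_neg]; congr 1; ring
  rw [e] at this
  refine le_trans (le_of_eq ?_) this
  field_simp

lemma hV_top (B σ : ℝ) : ∃ M > 0, ∀ y ∈ Icc (-1 : ℝ) 1,
    hV B σ y 1 ≤ M * Real.cos (Real.pi * y / 2) := by
  have hc : ContinuousOn (fun y => hVy B σ y 1) (Icc (0 : ℝ) 1) := fun y _ =>
    (hVy_dy B σ y 1 one_pos).continuousAt.continuousWithinAt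
  obtain ⟨M, hM⟩ := isCompact_Icc.exists_bound_of_continuousOn hc
  have key : ∀ y ∈ Icc (0 : ℝ) 1, hV B σ y 1 ≤ (|M| + 1) * (1 - y) := by
    intro y hy
    have := (convex_Icc (0 : ℝ) 1).norm_image_sub_le_of_norm_hasDerivWithin_le
      (fun x _ => (hV_dy B σ x 1 one_pos).hasDerivWithinAt) hM
      (show (1 : ℝ) ∈ Icc (0 : ℝ) 1 by simp) hy
    rw [hV_one, sub_zero] at this
    have h2 := (Real.le_norm_self _).trans this
    rw [Real.norm_eq_abs, abs_sub_comm, abs_of_nonneg (by linarith [hy.2])] at h2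
    have := le_abs_self M
    nlinarith [hy.2]
  refine ⟨|M| + 1, by positivity, fun y hy => ?_⟩
  have e : hV B σ |y| 1 = hV B σ y 1 := by
    rcases abs_cases y with h | h <;> rw [h.1]
    rw [hV_neg]
  rw [← e]
  refine (key _ ⟨abs_nonneg _, abs_le.2 hy⟩).trans ?_
  gcongr
  exact cos_lb y hy

lemma hV_rest (B σ : ℝ) (hB : 0 < B) (hσ : |σ| = 1) : ∃ D > 0, ∀ y ∈ Icc (-1 : ℝ) 1, ∀ s : ℝ,
    0 < s → s ≤ 1 → |hV B σ y s - σ * hK y s| ≤ D * s := by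
  obtain ⟨D, hD, H⟩ := far_small
  obtain ⟨E, hE, He⟩ := exp_small 1 one_pos 1
  refine ⟨3 * D + B * E, by positivity, fun y hy s hs h1 => ?_⟩
  have a := (H (y - 2) s hs h1 (by rw [le_abs]; right; linarith [hy.2])
    (by rw [abs_le]; constructor <;> linarith [hy.1, hy.2])).2.2
  have b := (H (y + 2) s hs h1 (by rw [le_abs]; left; linarith [hy.1])
    (by rw [abs_le]; constructor <;> linarith [hy.1, hy.2])).2.2
  have c := (H 3 s hs h1 (by norm_num) (by norm_num)).2.2
  have e := He s hs
  rw [pow_one] at e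
  have e1 : hV B σ y s - σ * hK y s =
    σ * (- hK (y - 2) s - hK (y + 2) s + hK 3 s) + B * (1 - y ^ 2) * Real.exp (-(1 / s)) := by
    unfold hV; ring
  have f : |σ * (- hK (y - 2) s - hK (y + 2) s + hK 3 s)| ≤ 3 * D * s := by
    rw [abs_mul, hσ, one_mul]
    rw [abs_le] at *
    constructor <;> linarith
  have y1 : 0 ≤ 1 - y ^ 2 := by nlinarith [hy.1, hy.2]
  have y2 : 1 - y ^ 2 ≤ 1 := by nlinarith
  have g : B * (1 - y ^ 2) * Real.exp (-(1 / s)) ≤ B * 1 * (E * s) := by gcongr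
  have g' : 0 ≤ B * (1 - y ^ 2) * Real.exp (-(1 / s)) := by positivity
  rw [e1]
  rw [abs_le] at *
  constructor <;> linarith

structure HGood (g g1 g2 : ℝ → ℝ → ℝ) : Prop where
  c0 : ContinuousOn (fun p : ℝ × ℝ => g p.1 p.2) (Icc (-1) 1 ×ˢ Icc 0 1)
  c1 : ContinuousOn (fun p : ℝ × ℝ => g1 p.1 p.2) (Icc (-1) 1 ×ˢ Icc 0 1)
  c2 : ContinuousOn (fun p : ℝ × ℝ => g2 p.1 p.2) (Icc (-1) 1 ×ˢ Icc 0 1)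
  d1 : ∀ y ∈ Icc (-1 : ℝ) 1, ∀ s ∈ Icc (0 : ℝ) 1, HasDerivAt (fun x => g x s) (g1 y s) y
  d2 : ∀ y ∈ Icc (-1 : ℝ) 1, ∀ s ∈ Icc (0 : ℝ) 1, HasDerivAt (fun x => g1 x s) (g2 y s) y
  dt : ∀ y ∈ Icc (-1 : ℝ) 1, ∀ s ∈ Ioo (0 : ℝ) 1, HasDerivAt (fun r => g y r) (-(g2 y s)) s
  nn : ∀ y ∈ Icc (-1 : ℝ) 1, ∀ s ∈ Icc (0 : ℝ) 1, 0 ≤ g y s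

lemma slice_s {f : ℝ → ℝ → ℝ} {S T : Set ℝ}
    (hf : ContinuousOn (fun p : ℝ × ℝ => f p.1 p.2) (S ×ˢ T)) {y : ℝ} (hy : y ∈ S) :
    ContinuousOn (fun s => f y s) T := by
  have : ContinuousOn (fun s : ℝ => (y, s)) T := by fun_prop
  exact hf.comp this (fun s hs => ⟨hy, hs⟩)

lemma slice_y {f : ℝ → ℝ → ℝ} {S T : Set ℝ}
    (hf : ContinuousOn (fun p : ℝ × ℝ => f p.1 p.2) (S ×ˢ T)) {s : ℝ} (hs : s ∈ T) :
    ContinuousOn (fun y => f y s) S := by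
  have : ContinuousOn (fun y : ℝ => (y, s)) S := by fun_prop
  exact hf.comp this (fun y hy => ⟨hy, hs⟩)

lemma green {g g1 g2 : ℝ → ℝ → ℝ} (h : HGood g g1 g2) (B σ : ℝ) (hB : 0 < B) (hσ : |σ| = 1)
    (H : ∀ s : ℝ, 0 < s → s ≤ 1 → |hK2 3 s| ≤ 2 * B * Real.exp (-(1 / s)))
    (ε : ℝ) (h0 : 0 < ε) (h1 : ε < 1) :
    (∫ y in (-1 : ℝ)..1, hV B σ y ε * g y ε) ≤ (∫ y in (-1 : ℝ)..1, hV B σ y 1 * g y 1)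
      + (8 + 2 * B) * ∫ s in (0 : ℝ)..1, hW s * (g 1 s + g (-1) s) := by
  have hR : Icc (-1 : ℝ) 1 ×ˢ Icc ε 1 ⊆ Icc (-1 : ℝ) 1 ×ˢ Icc 0 1 :=
    prod_mono le_rfl (Icc_subset_Icc h0.le le_rfl)
  have hP : Icc (-1 : ℝ) 1 ×ˢ Icc ε 1 ⊆ {p : ℝ × ℝ | 0 < p.2} := fun p hp => h0.trans_le hp.2.1
  have m1 : (1 : ℝ) ∈ Icc (-1 : ℝ) 1 := by simp
  have m2 : (-1 : ℝ) ∈ Icc (-1 : ℝ) 1 := by simp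
  have c0 := h.c0.mono hR
  have c2 := h.c2.mono hR
  have v := (hV_cont B σ).mono hP
  have vs := (hVs_cont B σ).mono hP
  have vyy := (hVyy_cont B σ).mono hP
  set F : ℝ → ℝ → ℝ := fun y s => hVs B σ y s * g y s - hV B σ y s * g2 y s with hF
  have cF : ContinuousOn (fun p : ℝ × ℝ => F p.1 p.2) (Icc (-1) 1 ×ˢ Icc ε 1) :=
    (vs.mul c0).sub (v.mul c2)
  have iF : MeasureTheory.IntegrableOn (Function.uncurry F) (uIoc (-1 : ℝ) 1 ×ˢ uIoc ε 1)
      (MeasureTheory.volume.prod MeasureTheory.volume) := by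
    rw [uIoc_of_le (by norm_num), uIoc_of_le h1.le]
    have : MeasureTheory.IntegrableOn (Function.uncurry F) (Icc (-1 : ℝ) 1 ×ˢ Icc ε 1) :=
      ContinuousOn.integrableOn_compact (isCompact_Icc.prod isCompact_Icc) cF
    exact this.mono_set (prod_mono Ioc_subset_Icc_self Ioc_subset_Icc_self)
  have st1 : ∀ y ∈ Icc (-1 : ℝ) 1,
      ∫ s in ε..1, F y s = hV B σ y 1 * g y 1 - hV B σ y ε * g y ε := by
    intro y hy
    refine intervalIntegral.integral_eq_sub_of_hasDerivAt_of_le h1.le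
      ((slice_s v hy).mul (slice_s c0 hy)) (fun s hs => ?_) ?_
    · have hs0 : 0 < s := h0.trans hs.1
      refine ((hV_ds B σ y s hs0).mul (h.dt y hy s ⟨hs0, hs.2⟩)).congr_deriv ?_
      simp only [hF]; ring
    · refine ContinuousOn.intervalIntegrable ?_
      rw [uIcc_of_le h1.le]
      exact slice_s cF hy
  have sw := MeasureTheory.intervalIntegral_intervalIntegral_swap iF
  have e1 : ∫ y in (-1 : ℝ)..1, ∫ s in ε..1, F y s =
      (∫ y in (-1 : ℝ)..1, hV B σ y 1 * g y 1) - ∫ y in (-1 : ℝ)..1, hV B σ y ε * g y ε := by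
    rw [← intervalIntegral.integral_sub]
    · refine intervalIntegral.integral_congr fun y hy => ?_
      rw [uIcc_of_le (by norm_num)] at hy
      exact st1 y hy
    · refine ContinuousOn.intervalIntegrable ?_
      rw [uIcc_of_le (by norm_num)]
      exact (slice_y v (right_mem_Icc.2 h1.le)).mul (slice_y c0 (right_mem_Icc.2 h1.le))
    · refine ContinuousOn.intervalIntegrable ?_
      rw [uIcc_of_le (by norm_num)]
      exact (slice_y v (left_mem_Icc.2 h1.le)).mul (slice_y c0 (left_mem_Icc.2 h1.le))
  have st3 : ∀ s ∈ Icc ε 1, -((8 + 2 * B) * (hW s * (g 1 s + g (-1) s))) ≤ ∫ y in (-1 : ℝ)..1, F y s := by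
    intro s hs
    have hs0 : 0 < s := h0.trans_le hs.1
    have hs01 : s ∈ Icc (0 : ℝ) 1 := ⟨hs0.le, hs.2⟩
    have cL : ContinuousOn (fun y => hVyy B σ y s * g y s - hV B σ y s * g2 y s) (Icc (-1) 1) :=
      ((slice_y vyy hs).mul (slice_y c0 hs)).sub ((slice_y v hs).mul (slice_y c2 hs))
    have eq : ∫ y in (-1 : ℝ)..1, (hVyy B σ y s * g y s - hV B σ y s * g2 y s) =
        hVy B σ 1 s * (g 1 s + g (-1) s) := by
      rw [intervalIntegral.integral_eq_sub_of_hasDerivAt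
        (f := fun y => hVy B σ y s * g y s - hV B σ y s * g1 y s)]
      · have a := hV_neg B σ 1 s
        have b := hVy_neg B σ 1 s
        rw [a, b, hV_one]
        ring
      · intro y hy
        rw [uIcc_of_le (by norm_num)] at hy
        refine (((hVy_dy B σ y s hs0).mul (h.d1 y hy s hs01)).sub
          ((hV_dy B σ y s hs0).mul (h.d2 y hy s hs01))).congr_deriv ?_
        ring
      · refine ContinuousOn.intervalIntegrable ?_
        rwa [uIcc_of_le (by norm_num)]
    have mono : ∫ y in (-1 : ℝ)..1, (hVyy B σ y s * g y s - hV B σ y s * g2 y s) ≤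
        ∫ y in (-1 : ℝ)..1, F y s := by
      refine intervalIntegral.integral_mono_on (by norm_num) ?_ ?_ fun y hy => ?_
      · refine ContinuousOn.intervalIntegrable ?_
        rwa [uIcc_of_le (by norm_num)]
      · refine ContinuousOn.intervalIntegrable ?_
        rw [uIcc_of_le (by norm_num)]
        exact slice_y cF hs
      · have a := hV_super B σ hB hσ H y s hs0 hs.2 hy
        have b := h.nn y hy s hs01
        have := mul_le_mul_of_nonneg_right a b
        simp only [hF]; linarith
    have a := (abs_le.1 (hVy_bd B σ hB hσ s hs0 hs.2)).1
    have b : 0 ≤ g 1 s + g (-1) s := add_nonneg (h.nn 1 m1 s hs01) (h.nn (-1) m2 s hs01)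
    have := mul_le_mul_of_nonneg_right a b
    linarith
  have iW : IntervalIntegrable (fun s => hW s * (g 1 s + g (-1) s)) MeasureTheory.volume 0 1 := by
    refine hW_int.mul_continuousOn ?_
    rw [uIcc_of_le zero_le_one]
    exact (slice_s h.c0 m1).add (slice_s h.c0 m2)
  have iW' : IntervalIntegrable (fun s => hW s * (g 1 s + g (-1) s)) MeasureTheory.volume ε 1 := by
    refine iW.mono_set ?_
    rw [uIcc_of_le zero_le_one, uIcc_of_le h1.le]
    exact Icc_subset_Icc h0.le le_rfl
  have iI : IntervalIntegrable (fun s => ∫ y in (-1 : ℝ)..1, F y s) MeasureTheory.volume ε 1 := by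
    rw [intervalIntegrable_iff_integrableOn_Ioc_of_le h1.le]
    rw [uIoc_of_le (by norm_num), uIoc_of_le h1.le] at iF
    unfold MeasureTheory.IntegrableOn at iF ⊢
    rw [← MeasureTheory.Measure.prod_restrict] at iF
    have := iF.integral_prod_right
    refine this.congr (Filter.Eventually.of_forall fun s => ?_)
    simp only [Function.uncurry]
    rw [intervalIntegral.integral_of_le (by norm_num)]
  have st4 : ∫ s in ε..1, -((8 + 2 * B) * (hW s * (g 1 s + g (-1) s))) ≤
      ∫ s in ε..1, ∫ y in (-1 : ℝ)..1, F y s :=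
    intervalIntegral.integral_mono_on h1.le (iW'.const_mul _).neg iI st3
  rw [intervalIntegral.integral_neg, intervalIntegral.integral_const_mul, ← sw, e1] at st4
  have st5 : ∫ s in ε..1, hW s * (g 1 s + g (-1) s) ≤ ∫ s in (0 : ℝ)..1, hW s * (g 1 s + g (-1) s) := by
    refine intervalIntegral.integral_mono_interval h0.le h1.le le_rfl ?_ iW
    refine (MeasureTheory.ae_restrict_mem measurableSet_Ioc).mono fun s hs => ?_
    have hs01 : s ∈ Icc (0 : ℝ) 1 := ⟨hs.1.le, hs.2⟩
    exact mul_nonneg (hW_nonneg s hs.1.le) (add_nonneg (h.nn 1 m1 s hs01) (h.nn (-1) m2 s hs01))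
  have : (8 + 2 * B) * (∫ s in ε..1, hW s * (g 1 s + g (-1) s)) ≤
    (8 + 2 * B) * ∫ s in (0 : ℝ)..1, hW s * (g 1 s + g (-1) s) := by gcongr
  linarith

open Filter Topology

lemma peak {g g1 g2 : ℝ → ℝ → ℝ} (h : HGood g g1 g2) :
    Tendsto (fun r : ℝ => ∫ y in (-1 : ℝ)..1, hG y (r ^ 2) * g2 y (r ^ 2)) (𝓝[>] 0)
      (𝓝 (√(4 * Real.pi) * g2 0 0)) := by
  have hmem : ∀ᶠ r : ℝ in 𝓝[>] 0, r ∈ Ioo (0 : ℝ) 1 := Ioo_mem_nhdsGT one_pos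
  obtain ⟨M, hM⟩ := (isCompact_Icc.prod isCompact_Icc).exists_bound_of_continuousOn h.c2
  have hE : MeasureTheory.Integrable (fun z : ℝ => Real.exp (-(1 / 4) * z ^ 2)) :=
    integrable_exp_neg_mul_sq (by norm_num)
  set Φ : ℝ → ℝ → ℝ := fun r z =>
    (Icc (-(1 / r)) (1 / r)).indicator (fun z => Real.exp (-(1 / 4) * z ^ 2) * g2 (r * z) (r ^ 2)) z with hΦ
  have inn : ∀ r ∈ Ioo (0 : ℝ) 1, ∀ z ∈ Icc (-(1 / r)) (1 / r), r * z ∈ Icc (-1 : ℝ) 1 := by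
    intro r hr z hz
    have h1 : r * (1 / r) = 1 := by have := hr.1; field_simp
    constructor
    · nlinarith [mul_le_mul_of_nonneg_left hz.1 hr.1.le]
    · nlinarith [mul_le_mul_of_nonneg_left hz.2 hr.1.le]
  have inr : ∀ r ∈ Ioo (0 : ℝ) 1, r ^ 2 ∈ Icc (0 : ℝ) 1 := by
    intro r hr
    constructor <;> nlinarith [hr.1, hr.2]
  have eq : ∀ r ∈ Ioo (0 : ℝ) 1, ∫ z, Φ r z = ∫ y in (-1 : ℝ)..1, hG y (r ^ 2) * g2 y (r ^ 2) := by
    intro r hr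
    have hr0 := hr.1
    have hr' : -(1 / r) ≤ 1 / r := by have := one_div_pos.2 hr0; linarith
    simp only [hΦ]
    rw [MeasureTheory.integral_indicator measurableSet_Icc, MeasureTheory.integral_Icc_eq_integral_Ioc,
      ← intervalIntegral.integral_of_le hr']
    have sub := intervalIntegral.integral_comp_mul_left (a := -(1 / r)) (b := 1 / r)
      (fun y => hG y (r ^ 2) * g2 y (r ^ 2)) hr0.ne'
    have e1 : r * -(1 / r) = -1 := by field_simp
    have e2 : r * (1 / r) = 1 := by field_simp
    rw [e1, e2] at sub
    have e3 : ∫ y in (-1 : ℝ)..1, hG y (r ^ 2) * g2 y (r ^ 2) =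
        r * ∫ z in (-(1 / r))..(1 / r), hG (r * z) (r ^ 2) * g2 (r * z) (r ^ 2) := by
      rw [sub, smul_eq_mul]; field_simp
    rw [e3, ← intervalIntegral.integral_const_mul]
    refine intervalIntegral.integral_congr fun z _ => ?_
    simp only [hG, Real.sqrt_sq hr0.le]
    have : -((r * z) ^ 2 / (4 * r ^ 2)) = -(1 / 4) * z ^ 2 := by field_simp
    rw [this]
    field_simp
  have lim : Tendsto (fun r => ∫ z, Φ r z) (𝓝[>] 0)
      (𝓝 (∫ z, Real.exp (-(1 / 4) * z ^ 2) * g2 0 0)) := by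
    refine MeasureTheory.tendsto_integral_filter_of_dominated_convergence
      (fun z => Real.exp (-(1 / 4) * z ^ 2) * M) ?_ ?_ (hE.mul_const M) ?_
    · filter_upwards [hmem] with r hr
      refine AEMeasurable.aestronglyMeasurable ?_
      simp only [hΦ]
      rw [aemeasurable_indicator_iff measurableSet_Icc]
      refine ContinuousOn.aemeasurable ?_ measurableSet_Icc
      refine ContinuousOn.mul (by fun_prop) ?_
      have : ContinuousOn (fun z : ℝ => (r * z, r ^ 2)) (Icc (-(1 / r)) (1 / r)) := by fun_prop
      exact h.c2.comp this (fun z hz => ⟨inn r hr z hz, inr r hr⟩)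
    · filter_upwards [hmem] with r hr
      refine Eventually.of_forall fun z => ?_
      have M0 : 0 ≤ M := (norm_nonneg _).trans (hM (0, 0) (by simp))
      by_cases hz : z ∈ Icc (-(1 / r)) (1 / r)
      · simp only [hΦ, indicator_of_mem hz, norm_mul, Real.norm_of_nonneg (Real.exp_pos _).le]
        gcongr
        exact hM (r * z, r ^ 2) ⟨inn r hr z hz, inr r hr⟩
      · simp only [hΦ, indicator_of_notMem hz, norm_zero]
        positivity
    · refine Eventually.of_forall fun z => ?_
      have hev : ∀ᶠ r : ℝ in 𝓝[>] 0, z ∈ Icc (-(1 / r)) (1 / r) := by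
        have : Tendsto (fun r : ℝ => 1 / r) (𝓝[>] 0) atTop := by
          simpa [one_div] using tendsto_inv_nhdsGT_zero (𝕜 := ℝ)
        filter_upwards [this.eventually_ge_atTop |z|] with r hr
        exact abs_le.1 hr
      have t0 : Tendsto (fun r : ℝ => (r * z, r ^ 2)) (𝓝[>] 0) (𝓝[Icc (-1) 1 ×ˢ Icc 0 1] (0, 0)) := by
        refine tendsto_nhdsWithin_iff.2 ⟨?_, ?_⟩
        · have : Continuous (fun r : ℝ => (r * z, r ^ 2)) := by fun_prop
          have := (this.tendsto 0).mono_left (nhdsWithin_le_nhds (s := Ioi 0))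
          simpa using this
        · filter_upwards [hev, hmem] with r h1 hr
          exact ⟨inn r hr z h1, inr r hr⟩
      have t1 := (h.c2 (0, 0) (by simp)).tendsto.comp t0
      refine (t1.const_mul (Real.exp (-(1 / 4) * z ^ 2))).congr' ?_
      filter_upwards [hev] with r hr
      simp only [hΦ, indicator_of_mem hr, Function.comp]
  have val : ∫ z, Real.exp (-(1 / 4) * z ^ 2) * g2 0 0 = √(4 * Real.pi) * g2 0 0 := by
    rw [MeasureTheory.integral_mul_const, integral_gaussian]
    congr 2; ring
  rw [← val]
  refine lim.congr' ?_
  filter_upwards [hmem] with r hr using eq r hr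

lemma I_lim {g g1 g2 : ℝ → ℝ → ℝ} (h : HGood g g1 g2) (B σ : ℝ) (hB : 0 < B) (hσ : |σ| = 1) :
    Tendsto (fun r : ℝ => ∫ y in (-1 : ℝ)..1, hV B σ y (r ^ 2) * g y (r ^ 2)) (𝓝[>] 0)
      (𝓝 (σ * (√(4 * Real.pi) * g2 0 0))) := by
  have hmem : ∀ᶠ r : ℝ in 𝓝[>] 0, r ∈ Ioo (0 : ℝ) 1 := Ioo_mem_nhdsGT one_pos
  have m1 : (1 : ℝ) ∈ Icc (-1 : ℝ) 1 := by simp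
  have m2 : (-1 : ℝ) ∈ Icc (-1 : ℝ) 1 := by simp
  have inr : ∀ r ∈ Ioo (0 : ℝ) 1, r ^ 2 ∈ Icc (0 : ℝ) 1 := by
    intro r hr
    constructor <;> nlinarith [hr.1, hr.2]
  obtain ⟨M, hM⟩ := (isCompact_Icc.prod isCompact_Icc).exists_bound_of_continuousOn h.c0
  obtain ⟨M1, hM1⟩ := (isCompact_Icc.prod isCompact_Icc).exists_bound_of_continuousOn h.c1
  have M0 : 0 ≤ M := (norm_nonneg _).trans (hM (0, 0) (by simp))
  have M10 : 0 ≤ M1 := (norm_nonneg _).trans (hM1 (0, 0) (by simp))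
  obtain ⟨D, hD, HD⟩ := hV_rest B σ hB hσ
  obtain ⟨E, hE, HE⟩ := far_small
  have r2 : Tendsto (fun r : ℝ => r ^ 2) (𝓝[>] 0) (𝓝 0) := by
    have : Continuous (fun r : ℝ => r ^ 2) := by fun_prop
    simpa using (this.tendsto 0).mono_left (nhdsWithin_le_nhds (s := Ioi 0))
  -- integrability helpers
  have cV : ∀ s : ℝ, 0 < s → ContinuousOn (fun y => hV B σ y s) (Icc (-1) 1) := fun s hs y _ =>
    (hV_dy B σ y s hs).continuousAt.continuousWithinAt
  have cK : ∀ s : ℝ, 0 < s → ContinuousOn (fun y => hK y s) (Icc (-1) 1) := fun s hs y _ =>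
    (hK_dx y s hs).continuousAt.continuousWithinAt
  have cG : ∀ s : ℝ, 0 < s → ContinuousOn (fun y => hG y s) (Icc (-1) 1) := fun s hs y _ =>
    (hG_dx y s hs).continuousAt.continuousWithinAt
  have A : Tendsto (fun r : ℝ => ∫ y in (-1 : ℝ)..1, (hV B σ y (r ^ 2) - σ * hK y (r ^ 2)) * g y (r ^ 2))
      (𝓝[>] 0) (𝓝 0) := by
    have up : Tendsto (fun r : ℝ => D * r ^ 2 * M * |(1 : ℝ) - (-1)|) (𝓝[>] 0) (𝓝 0) := by
      simpa using ((r2.const_mul D).mul_const M).mul_const (|(1 : ℝ) - (-1)|)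
    refine squeeze_zero_norm' ?_ up
    filter_upwards [hmem] with r hr
    refine intervalIntegral.norm_integral_le_of_norm_le_const fun y hy => ?_
    rw [uIoc_of_le (by norm_num)] at hy
    have hy' := Ioc_subset_Icc_self hy
    rw [norm_mul]
    have a := HD y hy' (r ^ 2) (by have := hr.1; positivity) (inr r hr).2
    have b := hM (y, r ^ 2) ⟨hy', inr r hr⟩
    rw [Real.norm_eq_abs]
    have := hD
    gcongr
  have Bd : Tendsto (fun r : ℝ => (hG1 1 (r ^ 2) * g 1 (r ^ 2) - hG 1 (r ^ 2) * g1 1 (r ^ 2)) -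
      (hG1 (-1) (r ^ 2) * g (-1) (r ^ 2) - hG (-1) (r ^ 2) * g1 (-1) (r ^ 2))) (𝓝[>] 0) (𝓝 0) := by
    have key : ∀ (f k : ℝ → ℝ → ℝ) (N : ℝ) (x : ℝ), 0 ≤ N →
        (∀ r ∈ Ioo (0 : ℝ) 1, |f x (r ^ 2)| ≤ E * r ^ 2) →
        (∀ r ∈ Ioo (0 : ℝ) 1, ‖k x (r ^ 2)‖ ≤ N) →
        Tendsto (fun r : ℝ => f x (r ^ 2) * k x (r ^ 2)) (𝓝[>] 0) (𝓝 0) := by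
      intro f k N x hN hf hk
      have up : Tendsto (fun r : ℝ => E * r ^ 2 * N) (𝓝[>] 0) (𝓝 0) := by
        simpa using ((r2.const_mul E).mul_const N)
      refine squeeze_zero_norm' ?_ up
      filter_upwards [hmem] with r hr
      rw [norm_mul]
      have a := hf r hr
      have b := hk r hr
      rw [Real.norm_eq_abs]
      gcongr
    have f1 := fun r (hr : r ∈ Ioo (0 : ℝ) 1) =>
      HE 1 (r ^ 2) (by have := hr.1; positivity) (inr r hr).2 (by norm_num) (by norm_num)
    have f2 := fun r (hr : r ∈ Ioo (0 : ℝ) 1) =>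
      HE (-1) (r ^ 2) (by have := hr.1; positivity) (inr r hr).2 (by norm_num) (by norm_num)
    have t1 := key hG1 g M 1 M0 (fun r hr => (f1 r hr).2.1) (fun r hr => hM (1, r ^ 2) ⟨m1, inr r hr⟩)
    have t2 := key hG g1 M1 1 M10 (fun r hr => (f1 r hr).1) (fun r hr => hM1 (1, r ^ 2) ⟨m1, inr r hr⟩)
    have t3 := key hG1 g M (-1) M0 (fun r hr => (f2 r hr).2.1) (fun r hr => hM (-1, r ^ 2) ⟨m2, inr r hr⟩)
    have t4 := key hG g1 M1 (-1) M10 (fun r hr => (f2 r hr).1) (fun r hr => hM1 (-1, r ^ 2) ⟨m2, inr r hr⟩)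
    simpa using (t1.sub t2).sub (t3.sub t4)
  have P := peak h
  have tot := A.add ((Bd.add P).const_mul σ)
  rw [zero_add, zero_add] at tot
  refine tot.congr' ?_
  filter_upwards [hmem] with r hr
  have hr2 : 0 < r ^ 2 := by have := hr.1; positivity
  have cg := slice_y h.c0 (inr r hr)
  have cg2 := slice_y h.c2 (inr r hr)
  have ii : ∀ f : ℝ → ℝ, ContinuousOn f (Icc (-1) 1) →
      IntervalIntegrable f MeasureTheory.volume (-1) 1 := by
    intro f hf
    refine ContinuousOn.intervalIntegrable ?_
    rwa [uIcc_of_le (by norm_num)]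
  have ibp : ∫ y in (-1 : ℝ)..1, (hK y (r ^ 2) * g y (r ^ 2) - hG y (r ^ 2) * g2 y (r ^ 2)) =
      (hG1 1 (r ^ 2) * g 1 (r ^ 2) - hG 1 (r ^ 2) * g1 1 (r ^ 2)) -
      (hG1 (-1) (r ^ 2) * g (-1) (r ^ 2) - hG (-1) (r ^ 2) * g1 (-1) (r ^ 2)) := by
    refine intervalIntegral.integral_eq_sub_of_hasDerivAt
      (f := fun y => hG1 y (r ^ 2) * g y (r ^ 2) - hG y (r ^ 2) * g1 y (r ^ 2)) (fun y hy => ?_) ?_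
    · rw [uIcc_of_le (by norm_num)] at hy
      refine (((hG1_dx y _ hr2).mul (h.d1 y hy _ (inr r hr))).sub
          ((hG_dx y _ hr2).mul (h.d2 y hy _ (inr r hr)))).congr_deriv ?_
      ring
    · exact ii _ (((cK _ hr2).mul cg).sub ((cG _ hr2).mul cg2))
  rw [← ibp, ← intervalIntegral.integral_add, ← intervalIntegral.integral_const_mul,
    ← intervalIntegral.integral_add]
  · refine intervalIntegral.integral_congr fun y _ => ?_
    ring
  · exact ii _ (((cV _ hr2).sub ((cK _ hr2).const_smul σ)).mul cg)
  · exact (ii _ (((((cK _ hr2).mul cg).sub ((cG _ hr2).mul cg2))).add ((cG _ hr2).mul cg2))).const_mul σ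
  · exact ii _ (((cK _ hr2).mul cg).sub ((cG _ hr2).mul cg2))
  · exact ii _ ((cG _ hr2).mul cg2)

lemma one_side (σ : ℝ) (hσ : |σ| = 1) : ∃ C > 0, ∀ g g1 g2 : ℝ → ℝ → ℝ, HGood g g1 g2 →
    σ * g2 0 0 ≤ C * (∫ y in (-1 : ℝ)..1, Real.cos (Real.pi * y / 2) * g y 1)
      + C * ∫ s in (0 : ℝ)..1, hW s * (g 1 s + g (-1) s) := by
  obtain ⟨B, hB, H⟩ := hK2_three
  obtain ⟨M, hM, HM⟩ := hV_top B σ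
  refine ⟨M + (8 + 2 * B), by positivity, fun g g1 g2 h => ?_⟩
  have m1 : (1 : ℝ) ∈ Icc (-1 : ℝ) 1 := by simp
  have m2 : (-1 : ℝ) ∈ Icc (-1 : ℝ) 1 := by simp
  have m01 : (1 : ℝ) ∈ Icc (0 : ℝ) 1 := by simp
  have hmem : ∀ᶠ r : ℝ in 𝓝[>] 0, r ∈ Ioo (0 : ℝ) 1 := Ioo_mem_nhdsGT one_pos
  set X := ∫ y in (-1 : ℝ)..1, Real.cos (Real.pi * y / 2) * g y 1 with hX
  set Y := ∫ s in (0 : ℝ)..1, hW s * (g 1 s + g (-1) s) with hY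
  have X0 : 0 ≤ X := by
    refine intervalIntegral.integral_nonneg (by norm_num) fun y hy => ?_
    have := cos_lb y hy
    have h2 := abs_le.2 hy
    exact mul_nonneg (by linarith) (h.nn y hy 1 m01)
  have Y0 : 0 ≤ Y := by
    refine intervalIntegral.integral_nonneg (by norm_num) fun s hs => ?_
    exact mul_nonneg (hW_nonneg s hs.1) (add_nonneg (h.nn 1 m1 s hs) (h.nn (-1) m2 s hs))
  have top : (∫ y in (-1 : ℝ)..1, hV B σ y 1 * g y 1) ≤ M * X := by
    have cg := slice_y h.c0 m01
    rw [hX, ← intervalIntegral.integral_const_mul]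
    refine intervalIntegral.integral_mono_on (by norm_num) ?_ ?_ fun y hy => ?_
    · refine ContinuousOn.intervalIntegrable ?_
      rw [uIcc_of_le (by norm_num)]
      exact ContinuousOn.mul (fun y _ => (hV_dy B σ y 1 one_pos).continuousAt.continuousWithinAt) cg
    · refine ContinuousOn.intervalIntegrable ?_
      rw [uIcc_of_le (by norm_num)]
      exact continuousOn_const.mul (ContinuousOn.mul (by fun_prop) cg)
    · rw [← mul_assoc]
      exact mul_le_mul_of_nonneg_right (HM y hy) (h.nn y hy 1 m01)
  have bd : σ * (√(4 * Real.pi) * g2 0 0) ≤ M * X + (8 + 2 * B) * Y := by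
    refine le_of_tendsto (I_lim h B σ hB hσ) ?_
    filter_upwards [hmem] with r hr
    have := green h B σ hB hσ H (r ^ 2) (by have := hr.1; positivity) (by nlinarith [hr.1, hr.2])
    linarith
  have sq : 1 ≤ √(4 * Real.pi) := by
    rw [Real.one_le_sqrt]; nlinarith [Real.pi_gt_three]
  have big : σ * (√(4 * Real.pi) * g2 0 0) ≤ (M + (8 + 2 * B)) * X + (M + (8 + 2 * B)) * Y := by
    nlinarith [mul_nonneg hM.le Y0, mul_nonneg (by positivity : 0 ≤ 8 + 2 * B) X0]
  have nonneg : 0 ≤ (M + (8 + 2 * B)) * X + (M + (8 + 2 * B)) * Y := by positivity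
  by_cases hs : 0 ≤ σ * g2 0 0
  · nlinarith
  · linarith

lemma dx_exists {H : ℝ × ℝ → ℝ}
    (hH : ContDiffOn ℝ (⊤ : ℕ∞) H (Ioo (-1 : ℝ) 1 ×ˢ Ioc (-1 : ℝ) 0)) :
    ∃ H1 : ℝ × ℝ → ℝ, ContDiffOn ℝ (⊤ : ℕ∞) H1 (Ioo (-1 : ℝ) 1 ×ˢ Ioc (-1 : ℝ) 0) ∧
      ∀ x ∈ Ioo (-1 : ℝ) 1, ∀ t ∈ Ioc (-1 : ℝ) 0, HasDerivAt (fun y => H (y, t)) (H1 (x, t)) x := by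
  set S := Ioo (-1 : ℝ) 1 ×ˢ Ioc (-1 : ℝ) 0 with hS
  have uS : UniqueDiffOn ℝ S := (uniqueDiffOn_Ioo _ _).prod (uniqueDiffOn_Ioc _ _)
  refine ⟨fun p => fderivWithin ℝ H S p (1, 0), ?_, ?_⟩
  · have := hH.fderivWithin (m := ((⊤ : ℕ∞) : WithTop ℕ∞)) uS (by simp)
    exact this.clm_apply contDiffOn_const
  · intro x hx t ht
    have hd : DifferentiableWithinAt ℝ H S (x, t) :=
      (hH.differentiableOn (by simp)) (x, t) ⟨hx, ht⟩
    have h1 : HasDerivWithinAt (fun y : ℝ => (y, t)) (1, 0) (Ioo (-1) 1) x :=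
      ((hasDerivAt_id x).prodMk (hasDerivAt_const x t)).hasDerivWithinAt
    have mt : MapsTo (fun y : ℝ => (y, t)) (Ioo (-1 : ℝ) 1) S := fun y hy => ⟨hy, ht⟩
    have := hd.hasFDerivWithinAt.comp_hasDerivWithinAt x h1 mt
    exact this.hasDerivAt (Ioo_mem_nhds hx.1 hx.2)

lemma scaled_good {h : ℝ → ℝ → ℝ} (hh : IsHeatSolution h)
    (hn : ∀ x ∈ Set.Icc (-1 : ℝ) 1, ∀ t ∈ Set.Icc (-1 : ℝ) 0, 0 ≤ h x t) (r : ℝ) (hr : r ∈ Ioo (0 : ℝ) 1) :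
    ∃ g1 g2 : ℝ → ℝ → ℝ, HGood (fun y s => h (r * y) (-(r ^ 2 * s))) g1 g2 ∧
      g2 0 0 = r ^ 2 * deriv (deriv (fun y => h y 0)) 0 := by
  obtain ⟨hc, hs, he⟩ := hh
  obtain ⟨H1, cH1, dH1⟩ := dx_exists hs
  obtain ⟨H2, cH2, dH2⟩ := dx_exists cH1
  have hr0 := hr.1
  have hr1 := hr.2
  have dd : ∀ x ∈ Ioo (-1 : ℝ) 1, ∀ t ∈ Ioc (-1 : ℝ) 0, deriv (deriv (fun y => h y t)) x = H2 (x, t) := by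
    intro x hx t ht
    have : deriv (fun y => h y t) =ᶠ[𝓝 x] fun y => H1 (y, t) := by
      filter_upwards [Ioo_mem_nhds hx.1 hx.2] with y hy
      exact (dH1 y hy t ht).deriv
    rw [this.deriv_eq]
    exact (dH2 x hx t ht).deriv
  have ix : ∀ y ∈ Icc (-1 : ℝ) 1, r * y ∈ Ioo (-1 : ℝ) 1 := by
    intro y hy
    constructor <;> nlinarith [hy.1, hy.2]
  have hr2 : r ^ 2 < 1 := by nlinarith
  have hr20 : 0 < r ^ 2 := by positivity
  have it : ∀ s ∈ Icc (0 : ℝ) 1, -(r ^ 2 * s) ∈ Ioc (-1 : ℝ) 0 := by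
    intro s hs
    constructor <;> nlinarith [hs.1, hs.2]
  have mp : ContinuousOn (fun p : ℝ × ℝ => (r * p.1, -(r ^ 2 * p.2))) (Icc (-1) 1 ×ˢ Icc 0 1) := by
    fun_prop
  have mt : MapsTo (fun p : ℝ × ℝ => (r * p.1, -(r ^ 2 * p.2))) (Icc (-1) 1 ×ˢ Icc 0 1)
      (Ioo (-1 : ℝ) 1 ×ˢ Ioc (-1 : ℝ) 0) := fun p hp => ⟨ix _ hp.1, it _ hp.2⟩
  refine ⟨fun y s => r * H1 (r * y, -(r ^ 2 * s)), fun y s => r ^ 2 * H2 (r * y, -(r ^ 2 * s)), ?_, ?_⟩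
  · refine ⟨hs.continuousOn.comp mp mt, continuousOn_const.mul (cH1.continuousOn.comp mp mt),
      continuousOn_const.mul (cH2.continuousOn.comp mp mt), ?_, ?_, ?_, ?_⟩
    · intro y hy s hs'
      have a := dH1 _ (ix y hy) _ (it s hs')
      have b := (hasDerivAt_id y).const_mul r
      refine (HasDerivAt.comp y a b).congr_deriv ?_
      simp; ring
    · intro y hy s hs'
      have a := dH2 _ (ix y hy) _ (it s hs')
      have b := (hasDerivAt_id y).const_mul r
      refine ((HasDerivAt.comp y a b).const_mul r).congr_deriv ?_
      simp; ring
    · intro y hy s hs'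
      have hs'' : s ∈ Icc (0 : ℝ) 1 := Ioo_subset_Icc_self hs'
      have hx := ix y hy
      have ht := it s hs''
      have ht0 : -(r ^ 2 * s) < 0 := by nlinarith [hs'.1]
      have hd : DifferentiableWithinAt ℝ (fun p : ℝ × ℝ => h p.1 p.2) (Ioo (-1 : ℝ) 1 ×ˢ Ioc (-1 : ℝ) 0)
        (r * y, -(r ^ 2 * s)) := (hs.differentiableOn (by simp)) _ ⟨hx, ht⟩
      have h1 : HasDerivWithinAt (fun t : ℝ => (r * y, t)) (0, 1) (Ioc (-1) 0) (-(r ^ 2 * s)) :=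
        ((hasDerivAt_const _ (r * y)).prodMk (hasDerivAt_id _)).hasDerivWithinAt
      have h2 := hd.hasFDerivWithinAt.comp_hasDerivWithinAt _ h1 (fun t ht => ⟨hx, ht⟩)
      have h3 := h2.hasDerivAt (Ioc_mem_nhds ht.1 ht0)
      have h4 : HasDerivAt (fun t => h (r * y) t) (H2 (r * y, -(r ^ 2 * s))) (-(r ^ 2 * s)) := by
        have e := he _ hx _ ht
        rw [derivWithin_of_mem_nhds (Iic_mem_nhds ht0), dd _ hx _ ht] at e
        rw [← e]
        exact h3.differentiableAt.hasDerivAt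
      have b := ((hasDerivAt_id s).const_mul (r ^ 2)).neg
      refine (HasDerivAt.comp s h4 b).congr_deriv ?_
      simp; ring
    · intro y hy s hs'
      exact hn _ (Ioo_subset_Icc_self (ix y hy)) _ (Ioc_subset_Icc_self (it s hs'))
  · rw [dd 0 (by norm_num) 0 (by norm_num)]
    simp

lemma pt_lim {h : ℝ → ℝ → ℝ} (hc : ContinuousOn (fun p : ℝ × ℝ => h p.1 p.2) (Set.Icc (-1) 1 ×ˢ Set.Icc (-1) 0))
    (y s : ℝ) (hy : y ∈ Icc (-1 : ℝ) 1) (hs : s ∈ Icc (0 : ℝ) 1) :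
    Tendsto (fun r : ℝ => h (r * y) (-(r ^ 2 * s))) (𝓝[<] 1) (𝓝 (h y (-s))) := by
  have hmem : ∀ᶠ r : ℝ in 𝓝[<] 1, r ∈ Ioo (0 : ℝ) 1 := Ioo_mem_nhdsLT one_pos
  have t0 : Tendsto (fun r : ℝ => (r * y, -(r ^ 2 * s))) (𝓝[<] 1) (𝓝[Icc (-1) 1 ×ˢ Icc (-1) 0] (y, -s)) := by
    refine tendsto_nhdsWithin_iff.2 ⟨?_, ?_⟩
    · have : Continuous (fun r : ℝ => (r * y, -(r ^ 2 * s))) := by fun_prop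
      have := (this.tendsto 1).mono_left (nhdsWithin_le_nhds (s := Iio 1))
      simpa using this
    · filter_upwards [hmem] with r hr
      have hr2 : r ^ 2 < 1 := by nlinarith [hr.1, hr.2]
      have hr20 : 0 ≤ r ^ 2 := by positivity
      refine ⟨⟨?_, ?_⟩, ⟨?_, ?_⟩⟩ <;> simp only <;> nlinarith [hr.1, hr.2, hy.1, hy.2, hs.1, hs.2]
  exact (hc (y, -s) ⟨hy, by simpa using hs.2, by simpa using hs.1⟩).tendsto.comp t0

theorem heat_solution_second_derivative_bound :
    ∃ C > (0 : ℝ), ∀ h : ℝ → ℝ → ℝ, IsHeatSolution h →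
      (∀ x ∈ Set.Icc (-1 : ℝ) 1, ∀ t ∈ Set.Icc (-1 : ℝ) 0, 0 ≤ h x t) →
      |deriv (deriv (fun y => h y 0)) 0| ≤
        C * (∫ y in (-1 : ℝ)..1, Real.cos (Real.pi * y / 2) * h y (-1))
          + C * (∫ t in (0 : ℝ)..1,
              t ^ (-(7 : ℝ) / 2) * Real.exp (-(1 / (4 * t))) * (h 1 (-t) + h (-1) (-t))) := by
  obtain ⟨C1, hC1, K1⟩ := one_side 1 (by norm_num)
  obtain ⟨C2, hC2, K2⟩ := one_side (-1) (by norm_num)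
  refine ⟨C1 + C2, by positivity, fun h hh hn => ?_⟩
  obtain ⟨hc, hs, he⟩ := id hh
  have hmem : ∀ᶠ r : ℝ in 𝓝[<] 1, r ∈ Ioo (0 : ℝ) 1 := Ioo_mem_nhdsLT one_pos
  have m1 : (1 : ℝ) ∈ Icc (-1 : ℝ) 1 := by simp
  have m2 : (-1 : ℝ) ∈ Icc (-1 : ℝ) 1 := by simp
  have m01 : (1 : ℝ) ∈ Icc (0 : ℝ) 1 := by simp
  obtain ⟨M, hM⟩ := (isCompact_Icc.prod isCompact_Icc).exists_bound_of_continuousOn hc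
  have sc : ∀ r ∈ Ioo (0 : ℝ) 1, ∀ y ∈ Icc (-1 : ℝ) 1, ∀ s ∈ Icc (0 : ℝ) 1,
      (r * y, -(r ^ 2 * s)) ∈ Icc (-1 : ℝ) 1 ×ˢ Icc (-1 : ℝ) 0 := by
    intro r hr y hy s hs
    have hr2 : r ^ 2 < 1 := by nlinarith [hr.1, hr.2]
    have hr20 : 0 ≤ r ^ 2 := by positivity
    refine ⟨⟨?_, ?_⟩, ⟨?_, ?_⟩⟩ <;> simp only <;> nlinarith [hr.1, hr.2, hy.1, hy.2, hs.1, hs.2]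
  have cR : ∀ r ∈ Ioo (0 : ℝ) 1, ContinuousOn (fun p : ℝ × ℝ => h (r * p.1) (-(r ^ 2 * p.2)))
      (Icc (-1) 1 ×ˢ Icc 0 1) := by
    intro r hr
    have mp : ContinuousOn (fun p : ℝ × ℝ => (r * p.1, -(r ^ 2 * p.2))) (Icc (-1) 1 ×ˢ Icc 0 1) := by
      fun_prop
    exact hc.comp mp (fun p hp => sc r hr p.1 hp.1 p.2 hp.2)
  set X := ∫ y in (-1 : ℝ)..1, Real.cos (Real.pi * y / 2) * h y (-1) with hX
  set Y := ∫ s in (0 : ℝ)..1, s ^ (-(7 : ℝ) / 2) * Real.exp (-(1 / (4 * s))) * (h 1 (-s) + h (-1) (-s)) with hY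
  have LX : Tendsto (fun r : ℝ => ∫ y in (-1 : ℝ)..1, Real.cos (Real.pi * y / 2) * h (r * y) (-(r ^ 2 * 1)))
      (𝓝[<] 1) (𝓝 X) := by
    refine intervalIntegral.tendsto_integral_filter_of_dominated_convergence (fun _ => M) ?_ ?_ ?_ ?_
    · filter_upwards [hmem] with r hr
      rw [uIoc_of_le (by norm_num)]
      refine ContinuousOn.aestronglyMeasurable ?_ measurableSet_Ioc
      have cc : ContinuousOn (fun y : ℝ => Real.cos (Real.pi * y / 2)) (Icc (-1) 1) := by fun_prop
      exact (cc.mul (slice_y (f := fun y s => h (r * y) (-(r ^ 2 * s))) (cR r hr) m01)).mono Ioc_subset_Icc_self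
    · filter_upwards [hmem] with r hr
      refine Eventually.of_forall fun y hy => ?_
      rw [uIoc_of_le (by norm_num)] at hy
      have b := hM _ (sc r hr y (Ioc_subset_Icc_self hy) 1 m01)
      rw [norm_mul]
      have a := Real.abs_cos_le_one (Real.pi * y / 2)
      rw [← Real.norm_eq_abs] at a
      calc _ ≤ 1 * M := by gcongr
        _ = M := one_mul _
    · exact intervalIntegrable_const
    · refine Eventually.of_forall fun y hy => ?_
      rw [uIoc_of_le (by norm_num)] at hy
      exact (pt_lim hc y 1 (Ioc_subset_Icc_self hy) m01).const_mul _
  have LY : Tendsto (fun r : ℝ => ∫ s in (0 : ℝ)..1, hW s * (h (r * 1) (-(r ^ 2 * s)) + h (r * (-1)) (-(r ^ 2 * s))))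
      (𝓝[<] 1) (𝓝 Y) := by
    have mW : Measurable hW := by unfold hW; fun_prop
    refine intervalIntegral.tendsto_integral_filter_of_dominated_convergence (fun s => hW s * (M + M)) ?_ ?_ ?_ ?_
    · filter_upwards [hmem] with r hr
      rw [uIoc_of_le (by norm_num)]
      refine mW.aestronglyMeasurable.mul ?_
      refine ContinuousOn.aestronglyMeasurable ?_ measurableSet_Ioc
      exact ((slice_s (f := fun y s => h (r * y) (-(r ^ 2 * s))) (cR r hr) m1).add (slice_s (f := fun y s => h (r * y) (-(r ^ 2 * s))) (cR r hr) m2)).mono Ioc_subset_Icc_self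
    · filter_upwards [hmem] with r hr
      refine Eventually.of_forall fun s hs => ?_
      rw [uIoc_of_le (by norm_num)] at hs
      have b := hM _ (sc r hr 1 m1 s (Ioc_subset_Icc_self hs))
      have b' := hM _ (sc r hr (-1) m2 s (Ioc_subset_Icc_self hs))
      have w := hW_nonneg s hs.1.le
      rw [norm_mul, Real.norm_of_nonneg w]
      gcongr
      exact norm_add_le_of_le b b'
    · exact hW_int.mul_const _
    · refine Eventually.of_forall fun s hs => ?_
      rw [uIoc_of_le (by norm_num)] at hs
      have hs' := Ioc_subset_Icc_self hs
      exact ((pt_lim hc 1 s m1 hs').add (pt_lim hc (-1) s m2 hs')).const_mul (hW s)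
  have L2 : Tendsto (fun r : ℝ => r ^ 2 * deriv (deriv (fun y => h y 0)) 0) (𝓝[<] 1)
      (𝓝 (deriv (deriv (fun y => h y 0)) 0)) := by
    have : Continuous (fun r : ℝ => r ^ 2 * deriv (deriv (fun y => h y 0)) 0) := by fun_prop
    simpa using (this.tendsto 1).mono_left (nhdsWithin_le_nhds (s := Iio 1))
  have side : ∀ σ C : ℝ, (∀ g g1 g2 : ℝ → ℝ → ℝ, HGood g g1 g2 →
      σ * g2 0 0 ≤ C * (∫ y in (-1 : ℝ)..1, Real.cos (Real.pi * y / 2) * g y 1)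
        + C * ∫ s in (0 : ℝ)..1, hW s * (g 1 s + g (-1) s)) →
      σ * deriv (deriv (fun y => h y 0)) 0 ≤ C * X + C * Y := by
    intro σ C K
    refine le_of_tendsto_of_tendsto (L2.const_mul σ) ((LX.const_mul C).add (LY.const_mul C)) ?_
    filter_upwards [hmem] with r hr
    obtain ⟨g1, g2, hg, e⟩ := scaled_good hh hn r hr
    have := K _ g1 g2 hg
    rw [e] at this
    exact this
  have X0 : 0 ≤ X := by
    refine intervalIntegral.integral_nonneg (by norm_num) fun y hy => ?_
    have := cos_lb y hy
    have h2 := abs_le.2 hy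
    exact mul_nonneg (by linarith) (hn y hy (-1) (by simp))
  have Y0 : 0 ≤ Y := by
    refine intervalIntegral.integral_nonneg (by norm_num) fun s hs => ?_
    have hs' : -s ∈ Icc (-1 : ℝ) 0 := ⟨by linarith [hs.2], by linarith [hs.1]⟩
    exact mul_nonneg (hW_nonneg s hs.1) (add_nonneg (hn 1 m1 _ hs') (hn (-1) m2 _ hs'))
  have s1 := side 1 C1 K1
  have s2 := side (-1) C2 K2
  have p1 := mul_nonneg hC1.le X0
  have p2 := mul_nonneg hC1.le Y0
  have p3 := mul_nonneg hC2.le X0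
  have p4 := mul_nonneg hC2.le Y0
  rw [abs_le]
  constructor <;> linarith
end

section
/- Let Γ⁺, Γ⁰, Γ⁻ : ℝ → [0,∞) be nondecreasing functions and set Γ := Γ⁺ + Γ⁰ + Γ⁻. Suppose there is a function ε : ℝ → [0,∞) with ε(τ) → 0 as τ → -∞ such that for all τ: Γ⁺(τ-1) ≤ e^{-1} Γ⁺(τ) + ε(τ) Γ(τ), |Γ⁰(τ-1) − Γ⁰(τ)| ≤ ε(τ) Γ(τ), and Γ⁻(τ-1) ≥ e · Γ⁻(τ) − ε(τ) Γ(τ). Then at least one of the following holds: (a) for every α > 0 there exists τ₀ such that Γ⁰(τ) + Γ⁻(τ) ≤ α Γ⁺(τ) for all τ ≤ τ₀; or (b) for every α > 0 there exists τ₀ such that Γ⁺(τ) + Γ⁻(τ) ≤ α Γ⁰(τ) for all τ ≤ τ₀. -/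
open Real Filter

/-- Merle–Zaag type dichotomy: let `Γ⁺, Γ⁰, Γ⁻ : ℝ → [0,∞)` be nondecreasing, set
`Γ = Γ⁺ + Γ⁰ + Γ⁻`, and suppose the discrete inequalities
`Γ⁺(τ-1) ≤ e⁻¹ Γ⁺(τ) + ε(τ) Γ(τ)`, `|Γ⁰(τ-1) − Γ⁰(τ)| ≤ ε(τ) Γ(τ)`,
`Γ⁻(τ-1) ≥ e Γ⁻(τ) − ε(τ) Γ(τ)` hold with `ε(τ) → 0` as `τ → -∞`. Then either
`Γ⁰ + Γ⁻ ≤ α Γ⁺` eventually as `τ → -∞` for every `α > 0`, or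
`Γ⁺ + Γ⁻ ≤ α Γ⁰` eventually as `τ → -∞` for every `α > 0`. -/
theorem merle_zaag_dichotomy (Γp Γ₀ Γm ε : ℝ → ℝ)
    (hΓp_nonneg : ∀ τ, 0 ≤ Γp τ) (hΓ₀_nonneg : ∀ τ, 0 ≤ Γ₀ τ) (hΓm_nonneg : ∀ τ, 0 ≤ Γm τ)
    (hΓp_mono : Monotone Γp) (hΓ₀_mono : Monotone Γ₀) (hΓm_mono : Monotone Γm)
    (hε_nonneg : ∀ τ, 0 ≤ ε τ) (hε : Tendsto ε atBot (nhds 0))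
    (hp : ∀ τ, Γp (τ - 1) ≤ (Real.exp 1)⁻¹ * Γp τ + ε τ * (Γp τ + Γ₀ τ + Γm τ))
    (h₀ : ∀ τ, |Γ₀ (τ - 1) - Γ₀ τ| ≤ ε τ * (Γp τ + Γ₀ τ + Γm τ))
    (hm : ∀ τ, Γm (τ - 1) ≥ Real.exp 1 * Γm τ - ε τ * (Γp τ + Γ₀ τ + Γm τ)) :
    (∀ α > (0 : ℝ), ∃ τ₀ : ℝ, ∀ τ ≤ τ₀, Γ₀ τ + Γm τ ≤ α * Γp τ) ∨
    (∀ α > (0 : ℝ), ∃ τ₀ : ℝ, ∀ τ ≤ τ₀, Γp τ + Γm τ ≤ α * Γ₀ τ) := by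
  have he : (2.7:ℝ) < Real.exp 1 := by have := Real.exp_one_gt_d9; linarith
  have hei : (Real.exp 1)⁻¹ ≤ 3/8 := by
    rw [inv_le_comm₀ (by positivity) (by norm_num)]; linarith
  have core : ∀ d > (0:ℝ), ∃ T : ℝ, ∀ τ ≤ T, Γm τ ≤ d * (Γp τ + Γ₀ τ) ∧
      Γp (τ - 1) ≤ 3/8 * Γp τ + d * (Γp τ + Γ₀ τ) ∧
      Γ₀ τ - Γ₀ (τ - 1) ≤ d * (Γp τ + Γ₀ τ) := by
    intro d hd
    have hm0 : (0:ℝ) < min (1/2) (d/2) := by positivity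
    obtain ⟨T, hT⟩ := eventually_atBot.1 (hε.eventually (gt_mem_nhds hm0))
    refine ⟨T, fun τ hτ => ?_⟩
    have h1 := hT τ hτ
    have h2 : ε τ ≤ 1/2 := h1.le.trans (min_le_left _ _)
    have h3 : ε τ ≤ d/2 := h1.le.trans (min_le_right _ _)
    have e0 := hε_nonneg τ
    have p0 := hΓp_nonneg τ
    have z0 := hΓ₀_nonneg τ
    have m0 := hΓm_nonneg τ
    have hS : 0 ≤ Γp τ + Γ₀ τ := by linarith
    have a1 : Γm (τ - 1) ≤ Γm τ := hΓm_mono (by linarith)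
    have a2 := hm τ
    have a3 : 2.7 * Γm τ ≤ Real.exp 1 * Γm τ := by gcongr
    have a4 : ε τ * Γm τ ≤ 1/2 * Γm τ := by gcongr
    have a5 : Γm τ ≤ ε τ * (Γp τ + Γ₀ τ) := by nlinarith
    have a6 : ε τ * (Γp τ + Γ₀ τ) ≤ d/2 * (Γp τ + Γ₀ τ) := by gcongr
    have a7 : ε τ * (Γp τ + Γ₀ τ + Γm τ) ≤ d * (Γp τ + Γ₀ τ) := by
      have : ε τ * (Γp τ + Γ₀ τ + Γm τ) = ε τ * (Γp τ + Γ₀ τ) + ε τ * Γm τ := by ring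
      nlinarith
    have hdS : 0 ≤ d * (Γp τ + Γ₀ τ) := by positivity
    refine ⟨by linarith, ?_, ?_⟩
    · have := hp τ
      have b : (Real.exp 1)⁻¹ * Γp τ ≤ 3/8 * Γp τ := by gcongr
      linarith
    · have := (abs_le.1 (h₀ τ)).1
      linarith
  by_cases H : ∃ β > (0:ℝ), ∀ T : ℝ, ∃ τ ≤ T, Γp τ ≤ β * Γ₀ τ
  · right
    obtain ⟨β, hβ, H⟩ := H
    intro α hα
    obtain ⟨η, hη, hη1, hη2⟩ : ∃ η > (0:ℝ), η ≤ 1/4 ∧ η ≤ α/16 :=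
      ⟨min (1/4) (α/16), by positivity, min_le_left _ _, min_le_right _ _⟩
    obtain ⟨d, hd, hdη⟩ : ∃ d > (0:ℝ), d * (2 + β + α) = η :=
      ⟨η / (2 + β + α), by positivity, by field_simp⟩
    obtain ⟨T, hT⟩ := core d hd
    obtain ⟨t, ht, htr⟩ := H T
    have zstep : ∀ s ≤ T, ∀ r ≤ β + 1, Γp s ≤ r * Γ₀ s →
        d * (Γp s + Γ₀ s) ≤ η * Γ₀ s ∧ 3/4 * Γ₀ s ≤ Γ₀ (s-1) := by
      intro s hs r hr hps
      obtain ⟨-, -, h3⟩ := hT s hs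
      have z0 := hΓ₀_nonneg s
      have c1 : Γp s + Γ₀ s ≤ (2 + β + α) * Γ₀ s := by nlinarith
      have c2 : d * (Γp s + Γ₀ s) ≤ η * Γ₀ s := by
        calc _ ≤ d * ((2 + β + α) * Γ₀ s) := by gcongr
          _ = _ := by rw [← hdη]; ring
      have c3 : η * Γ₀ s ≤ 1/4 * Γ₀ s := by gcongr
      exact ⟨c2, by linarith⟩
    have rb : ∀ n : ℕ, β * (1/2)^n + 4 * η ≤ β + 1 := by
      intro n
      have : (1/2:ℝ)^n ≤ 1 := pow_le_one₀ (by norm_num) (by norm_num)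
      nlinarith
    have sT : ∀ n : ℕ, t - n ≤ T := by
      intro n
      have : (0:ℝ) ≤ n := n.cast_nonneg
      linarith
    have ind : ∀ n : ℕ, Γp (t - n) ≤ (β * (1/2)^n + 4 * η) * Γ₀ (t - n) := by
      intro n
      induction n with
      | zero =>
        have := hΓ₀_nonneg t
        simp only [Nat.cast_zero, sub_zero, pow_zero, mul_one]
        nlinarith
      | succ n ih =>
        obtain ⟨c1, c2⟩ := zstep _ (sT n) _ (rb n) ih
        obtain ⟨-, h2, -⟩ := hT _ (sT n)
        have e1 : t - ((n+1 : ℕ):ℝ) = t - n - 1 := by push_cast; ring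
        rw [e1, pow_succ]
        set r := β * (1/2)^n with hr
        have r0 : 0 ≤ r := by positivity
        have k : (r/2 + 4 * η) * (3/4 * Γ₀ (t - n)) ≤ (r/2 + 4 * η) * Γ₀ (t - n - 1) := by
          gcongr
        have z0 := hΓ₀_nonneg (t - n)
        have k2 : 0 ≤ η * Γ₀ (t - n) := by positivity
        have e2 : β * ((1/2)^n * (1/2)) = r / 2 := by rw [hr]; ring
        rw [e2]
        nlinarith
    obtain ⟨N, hN⟩ := exists_pow_lt_of_lt_one (show 0 < α / (8 * β) by positivity)
      (show (1/2:ℝ) < 1 by norm_num)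
    refine ⟨t - N, fun σ hσ => ?_⟩
    have hNn : (N:ℝ) ≤ t - σ := by linarith
    have hnn : 0 ≤ t - σ := (Nat.cast_nonneg N).trans hNn
    set n := ⌊t - σ⌋₊ with hn
    have n1 : N ≤ n := Nat.le_floor hNn
    have n2 : (n:ℝ) ≤ t - σ := Nat.floor_le hnn
    have n3 : t - σ < n + 1 := Nat.lt_floor_add_one _
    have q1 : β * (1/2)^n ≤ α/8 := by
      have : (1/2:ℝ)^n ≤ (1/2)^N := pow_le_pow_of_le_one (by norm_num) (by norm_num) n1
      calc β * (1/2)^n ≤ β * (α / (8 * β)) := by gcongr; linarith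
        _ = α/8 := by field_simp
    obtain ⟨-, c2⟩ := zstep _ (sT n) _ (rb n) (ind n)
    have z0 := hΓ₀_nonneg (t - n)
    have w1 : Γp σ ≤ Γp (t - n) := hΓp_mono (by linarith)
    have w2 : Γ₀ (t - n - 1) ≤ Γ₀ σ := hΓ₀_mono (by linarith)
    have w3 : Γp (t - n) ≤ (3/8 * α) * Γ₀ (t - n) := (ind n).trans (by gcongr; linarith)
    have w4 : α * (3/4 * Γ₀ (t - n)) ≤ α * Γ₀ σ := by gcongr; linarith
    have w5 : Γp σ ≤ α/2 * Γ₀ σ := by linarith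
    obtain ⟨h1, -, -⟩ := hT σ (by have := sT N; linarith)
    have zs := hΓ₀_nonneg σ
    have w6 : d * (Γp σ + Γ₀ σ) ≤ d * ((2 + β + α) * Γ₀ σ) := by
      gcongr; nlinarith
    have w7 : d * ((2 + β + α) * Γ₀ σ) = η * Γ₀ σ := by rw [← hdη]; ring
    have w8 : η * Γ₀ σ ≤ α/16 * Γ₀ σ := by gcongr
    have w9 : 0 ≤ α * Γ₀ σ := by positivity
    linarith
  · left
    push Not at H
    intro α hα
    obtain ⟨d, hd, hd1, hd2⟩ : ∃ d > (0:ℝ), d ≤ 1 ∧ d ≤ α/4 :=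
      ⟨min 1 (α/4), by positivity, min_le_left _ _, min_le_right _ _⟩
    obtain ⟨T1, hT1⟩ := core d hd
    obtain ⟨T2, hT2⟩ := H (4/α) (by positivity)
    refine ⟨min T1 T2, fun τ hτ => ?_⟩
    obtain ⟨h1, -, -⟩ := hT1 τ (hτ.trans (min_le_left _ _))
    have h2 := hT2 τ (hτ.trans (min_le_right _ _))
    have p0 := hΓp_nonneg τ
    have z0 := hΓ₀_nonneg τ
    have h3 : Γ₀ τ ≤ α/4 * Γp τ := by
      have : α/4 * (4/α * Γ₀ τ) ≤ α/4 * Γp τ := by gcongr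
      have e : α/4 * (4/α * Γ₀ τ) = Γ₀ τ := by field_simp
      linarith
    have h4 : d * Γp τ ≤ α/4 * Γp τ := by gcongr
    have h5 : d * Γ₀ τ ≤ 1 * Γ₀ τ := by gcongr
    have h6 : 0 ≤ α * Γp τ := by positivity
    linarith
end

section
/- Let τ₀ ∈ ℝ and let f : (-∞, τ₀] → [0,∞) be bounded. Suppose there exists ε : (-∞, τ₀] → [0,∞) with ε(τ) → 0 as τ → -∞ such that f(τ-1) ≤ (e^{-1} + ε(τ)) f(τ) for all τ ≤ τ₀. Then there exists a constant C > 0 such that f(τ) ≤ C e^{τ/2} for all τ ≤ τ₀. -/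
open Real Filter

/-- Let `f : (-∞, τ₀] → [0,∞)` be bounded and suppose `f(τ-1) ≤ (e⁻¹ + ε(τ)) f(τ)` for all
`τ ≤ τ₀`, where `ε ≥ 0` tends to `0` as `τ → -∞`. Then there is a constant `C > 0` with
`f(τ) ≤ C e^{τ/2}` for all `τ ≤ τ₀`. -/
theorem exponential_decay_from_discrete_inequality (τ₀ : ℝ) (f ε : ℝ → ℝ)
    (hf_nonneg : ∀ τ ≤ τ₀, 0 ≤ f τ)
    (hf_bdd : ∃ M : ℝ, ∀ τ ≤ τ₀, f τ ≤ M)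
    (hε_nonneg : ∀ τ ≤ τ₀, 0 ≤ ε τ)
    (hε : Tendsto ε atBot (nhds 0))
    (h : ∀ τ ≤ τ₀, f (τ - 1) ≤ ((Real.exp 1)⁻¹ + ε τ) * f τ) :
    ∃ C > (0 : ℝ), ∀ τ ≤ τ₀, f τ ≤ C * Real.exp (τ / 2) := by
  obtain ⟨M, hM⟩ := hf_bdd
  have hlt : (Real.exp 1)⁻¹ < Real.exp (-1/2) := by
    rw [← Real.exp_neg]
    exact Real.exp_lt_exp.2 (by norm_num)
  have hev : ∀ᶠ τ in atBot, ε τ < Real.exp (-1/2) - (Real.exp 1)⁻¹ :=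
    hε.eventually (gt_mem_nhds (sub_pos.2 hlt))
  obtain ⟨T', hT'⟩ := eventually_atBot.1 hev
  obtain ⟨T, hT0, hT1⟩ : ∃ T, T ≤ τ₀ ∧ T ≤ T' := ⟨min τ₀ T', min_le_left _ _, min_le_right _ _⟩
  have hC : 0 < (|M| + 1) * Real.exp (-(T - 1) / 2) := by positivity
  refine ⟨(|M| + 1) * Real.exp (-(T - 1) / 2), hC, ?_⟩
  have hbase : ∀ τ ≤ τ₀, T - 1 ≤ τ →
      f τ ≤ (|M| + 1) * Real.exp (-(T - 1) / 2) * Real.exp (τ / 2) := by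
    intro τ h1 h2
    rw [mul_assoc, ← Real.exp_add]
    have h3 : 1 ≤ Real.exp (-(T - 1) / 2 + τ / 2) := Real.one_le_exp (by linarith)
    have h4 := hM τ h1
    have h5 := le_abs_self M
    have h6 := abs_nonneg M
    nlinarith
  have key : ∀ n : ℕ, ∀ τ ≤ τ₀, T - 1 - n ≤ τ →
      f τ ≤ (|M| + 1) * Real.exp (-(T - 1) / 2) * Real.exp (τ / 2) := by
    intro n
    induction n with
    | zero =>
      intro τ h1 h2
      exact hbase τ h1 (by simpa using h2)
    | succ n ih =>
      intro τ h1 h2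
      push_cast at h2
      rcases le_or_gt (T - 1) τ with h3 | h3
      · exact hbase τ h1 h3
      have h4 := ih (τ + 1) (by linarith) (by linarith)
      have h5 := h (τ + 1) (by linarith)
      rw [add_sub_cancel_right] at h5
      have h6 := hT' (τ + 1) (by linarith)
      have h7 := hf_nonneg (τ + 1) (by linarith)
      calc f τ ≤ ((Real.exp 1)⁻¹ + ε (τ + 1)) * f (τ + 1) := h5
        _ ≤ Real.exp (-1/2) * f (τ + 1) := mul_le_mul_of_nonneg_right (by linarith) h7
        _ ≤ Real.exp (-1/2) *
            ((|M| + 1) * Real.exp (-(T - 1) / 2) * Real.exp ((τ + 1) / 2)) :=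
          mul_le_mul_of_nonneg_left h4 (Real.exp_pos _).le
        _ = (|M| + 1) * Real.exp (-(T - 1) / 2) *
            (Real.exp (-1/2) * Real.exp ((τ + 1) / 2)) := by ring
        _ = _ := by
          rw [← Real.exp_add]
          congr 2
          ring
  intro τ h1
  obtain ⟨n, hn⟩ := exists_nat_ge (T - 1 - τ)
  exact key n τ h1 (by linarith)
end

section
/- Let α : ℝ → ℝ be differentiable with α(τ) → 0 as τ → -∞, and for each τ set A(τ) := sup_{σ ≤ τ} |α(σ)| (which is finite). Suppose there exists ε : ℝ → [0,∞) with ε(τ) → 0 as τ → -∞ such that |α'(τ) + 8 α(τ)²| ≤ ε(τ) A(τ)² for all τ. Then there exists τ₀ such that A(τ) = |α(τ)| for all τ ≤ τ₀. -/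
open Real Filter Set

/-- Let `α : ℝ → ℝ` be differentiable with `α(τ) → 0` as `τ → -∞`, and let
`A(τ) = sup_{σ ≤ τ} |α(σ)|` (assumed finite). If `|α'(τ) + 8 α(τ)²| ≤ ε(τ) A(τ)²` for all `τ`,
with `ε ≥ 0` tending to `0` at `-∞`, then `A(τ) = |α(τ)|` for all sufficiently negative `τ`. -/
theorem running_sup_eventually_attained (α ε : ℝ → ℝ)
    (hα_diff : Differentiable ℝ α)
    (hα_lim : Tendsto α atBot (nhds 0))
    (hbdd : ∀ τ : ℝ, BddAbove ((fun σ => |α σ|) '' Set.Iic τ))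
    (hε_nonneg : ∀ τ, 0 ≤ ε τ)
    (hε : Tendsto ε atBot (nhds 0))
    (h : ∀ τ, |deriv α τ + 8 * α τ ^ 2| ≤ ε τ * (sSup ((fun σ => |α σ|) '' Set.Iic τ)) ^ 2) :
    ∃ τ₀ : ℝ, ∀ τ ≤ τ₀, sSup ((fun σ => |α σ|) '' Set.Iic τ) = |α τ| := by
  obtain ⟨τ₀, hτ₀⟩ := eventually_atBot.1 (hε.eventually (gt_mem_nhds (zero_lt_one : (0:ℝ) < 1)))
  refine ⟨τ₀, fun τ hτ => ?_⟩
  have hge : ∀ t s : ℝ, s ≤ t → |α s| ≤ sSup ((fun σ => |α σ|) '' Set.Iic t) :=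
    fun t s hs => le_csSup (hbdd t) ⟨s, hs, rfl⟩
  refine le_antisymm (csSup_le ⟨_, τ, le_refl τ, rfl⟩ ?_) (hge τ τ le_rfl)
  rintro _ ⟨x, hx, rfl⟩
  have hx' : x ≤ τ := hx
  show |α x| ≤ |α τ|
  by_contra! hlt
  have hxpos : 0 < |α x| := lt_of_le_of_lt (abs_nonneg _) hlt
  have hlim : Tendsto (fun s => |α s|) atBot (nhds 0) := by simpa using hα_lim.abs
  obtain ⟨T, hT⟩ := eventually_atBot.1 (hlim.eventually (gt_mem_nhds hxpos))
  have hTx : T < x := by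
    by_contra! hc
    exact lt_irrefl _ (hT x hc)
  have hcont : Continuous (fun s => |α s|) := hα_diff.continuous.abs
  obtain ⟨σ, hσ, hmax⟩ := (isCompact_Icc (a := T) (b := τ)).exists_isMaxOn
    ⟨x, hTx.le, hx'⟩ hcont.continuousOn
  have hxσ : |α x| ≤ |α σ| := hmax ⟨hTx.le, hx'⟩
  have hall : ∀ s ≤ τ, |α s| ≤ |α σ| := by
    intro s hs
    rcases le_total s T with h1 | h1
    · exact (hT s h1).le.trans hxσ
    · exact hmax ⟨h1, hs⟩
  have hστ : σ < τ := by
    refine lt_of_le_of_ne hσ.2 ?_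
    rintro rfl
    linarith
  have hsup : sSup ((fun σ => |α σ|) '' Set.Iic σ) = |α σ| := by
    refine le_antisymm (csSup_le ⟨_, σ, le_refl σ, rfl⟩ ?_) (hge σ σ le_rfl)
    rintro _ ⟨s, hs, rfl⟩
    exact hall s (le_trans hs hστ.le)
  have hloc : IsLocalMax (fun s => α s ^ 2) σ := by
    filter_upwards [Iio_mem_nhds hστ] with s hs
    exact sq_le_sq.2 (hall s (le_of_lt hs))
  have hd := hloc.hasDerivAt_eq_zero ((hα_diff σ).hasDerivAt.pow 2)
  have hne : α σ ≠ 0 := abs_pos.1 (hxpos.trans_le hxσ)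
  have hd0 : deriv α σ = 0 := by simpa [hne] using hd
  have hh := h σ
  rw [hsup, hd0, sq_abs, zero_add] at hh
  have he := hτ₀ σ (hσ.2.trans hτ)
  have hp : 0 < α σ ^ 2 := by positivity
  have := (le_abs_self _).trans hh
  nlinarith
end

section
/- Let α : ℝ → ℝ be differentiable with α(τ) → 0 as τ → -∞, and for each τ set A(τ) := sup_{σ ≤ τ} |α(σ)| (which is finite). Assume A(τ) > 0 for every τ. Suppose there exists ε : ℝ → [0,∞) with ε(τ) → 0 as τ → -∞ such that |α'(τ) + 8 α(τ)²| ≤ ε(τ) A(τ)² for all τ. Then there exists τ₀ such that α(τ) < 0 for all τ ≤ τ₀, and moreover τ · α(τ) → 1/8 as τ → -∞. -/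
open Real Filter Set

theorem aux_right {f : ℝ → ℝ} {x d : ℝ} (hf : HasDerivAt f d x) (hd : d < 0) :
    (∀ᶠ y in nhdsWithin x (Set.Ioi x), f y < f x) ∧
    (∀ᶠ y in nhdsWithin x (Set.Iio x), f x < f y) := by
  have h1 := (hasDerivAt_iff_tendsto_slope.1 hf).eventually (gt_mem_nhds hd)
  constructor
  · have h2 : ∀ᶠ y in nhdsWithin x (Set.Ioi x), slope f x y < 0 :=
      h1.filter_mono (nhdsWithin_mono _ (fun y hy => (ne_of_gt hy : y ≠ x)))
    filter_upwards [h2, self_mem_nhdsWithin] with y hy hxy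
    have hxy' : 0 < y - x := sub_pos.2 hxy
    rw [slope_def_field, div_neg_iff] at hy
    rcases hy with hy | hy <;> linarith [hy.1, hy.2]
  · have h2 : ∀ᶠ y in nhdsWithin x (Set.Iio x), slope f x y < 0 :=
      h1.filter_mono (nhdsWithin_mono _ (fun y hy => (ne_of_lt hy : y ≠ x)))
    filter_upwards [h2, self_mem_nhdsWithin] with y hy hxy
    have hxy' : y - x < 0 := sub_neg.2 hxy
    rw [slope_def_field, div_neg_iff] at hy
    rcases hy with hy | hy <;> linarith [hy.1, hy.2]

theorem aux_max {α : ℝ → ℝ} (hc : Continuous α) (hl : Tendsto α atBot (nhds 0)) (τ : ℝ)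
    (hpos : 0 < sSup ((fun σ => |α σ|) '' Set.Iic τ)) :
    ∃ σ ≤ τ, ∀ s ≤ τ, |α s| ≤ |α σ| := by
  obtain ⟨_, ⟨x, hx, rfl⟩, hx0⟩ := exists_lt_of_lt_csSup (by simp) hpos
  have hl' : Tendsto (fun s => |α s|) atBot (nhds 0) := by simpa using hl.abs
  obtain ⟨B, hB⟩ := eventually_atBot.1 (hl'.eventually (gt_mem_nhds hx0))
  have hBx : B < x := by
    by_contra! hh
    exact lt_irrefl _ (hB x hh)
  obtain ⟨σ, hσ, hm⟩ := (isCompact_Icc (a := B) (b := τ)).exists_isMaxOn ⟨x, hBx.le, hx⟩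
    (hc.abs.continuousOn)
  refine ⟨σ, hσ.2, fun s hs => ?_⟩
  rcases le_total s B with h1 | h1
  · exact (hB s h1).le.trans (hm ⟨hBx.le, hx⟩)
  · exact hm ⟨h1, hs⟩

/-- Let `α : ℝ → ℝ` be differentiable with `α(τ) → 0` as `τ → -∞`, and let
`A(τ) = sup_{σ ≤ τ} |α(σ)|` (assumed finite and positive). If
`|α'(τ) + 8 α(τ)²| ≤ ε(τ) A(τ)²` for all `τ`, with `ε ≥ 0` tending to `0` at `-∞`, then
`α(τ) < 0` for all sufficiently negative `τ`, and `τ α(τ) → 1/8` as `τ → -∞`. -/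
theorem asymptotics_of_alpha (α ε : ℝ → ℝ)
    (hα_diff : Differentiable ℝ α)
    (hα_lim : Tendsto α atBot (nhds 0))
    (hbdd : ∀ τ : ℝ, BddAbove ((fun σ => |α σ|) '' Set.Iic τ))
    (hpos : ∀ τ : ℝ, 0 < sSup ((fun σ => |α σ|) '' Set.Iic τ))
    (hε_nonneg : ∀ τ, 0 ≤ ε τ)
    (hε : Tendsto ε atBot (nhds 0))
    (h : ∀ τ, |deriv α τ + 8 * α τ ^ 2| ≤ ε τ * (sSup ((fun σ => |α σ|) '' Set.Iic τ)) ^ 2) :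
    (∃ τ₀ : ℝ, ∀ τ ≤ τ₀, α τ < 0) ∧
    Tendsto (fun τ => τ * α τ) atBot (nhds (1 / 8)) := by
  have key : ∃ T : ℝ, ∀ τ ≤ T, α τ < 0 ∧ sSup ((fun σ => |α σ|) '' Set.Iic τ) = |α τ| := by
    obtain ⟨T, hT⟩ := eventually_atBot.1 (hε.eventually (gt_mem_nhds (show (0:ℝ) < 4 by norm_num)))
    refine ⟨T, fun τ hτ => ?_⟩
    obtain ⟨σ, hσ, hm⟩ := aux_max hα_diff.continuous hα_lim τ (hpos τ)
    have hA : ∀ r, σ ≤ r → r ≤ τ → sSup ((fun σ => |α σ|) '' Set.Iic r) = |α σ| := by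
      intro r h1 h2
      apply le_antisymm
      · apply csSup_le (by simp)
        rintro _ ⟨s, hs, rfl⟩
        exact hm s (le_trans hs h2)
      · exact le_csSup (hbdd r) ⟨σ, h1, rfl⟩
    have hσ0 : 0 < |α σ| := by rw [← hA τ hσ le_rfl]; exact hpos τ
    have hd : deriv α σ < 0 := by
      have h1 := h σ
      rw [hA σ le_rfl hσ, sq_abs] at h1
      have h2 := hT σ (hσ.trans hτ)
      have h3 : 0 < α σ ^ 2 := by rw [← sq_abs]; positivity
      have h4 := (abs_le.1 h1).2
      nlinarith
    obtain ⟨hr, hl⟩ := aux_right (hα_diff σ).hasDerivAt hd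
    have hneg : α σ < 0 := by
      by_contra! hn
      obtain ⟨y, hy, hyσ⟩ := (hl.and self_mem_nhdsWithin).exists
      have h1 := hm y ((le_of_lt hyσ).trans hσ)
      rw [abs_of_nonneg hn, abs_of_nonneg (hn.trans hy.le)] at h1
      linarith
    have hστ : σ = τ := by
      by_contra hne
      have hlt : σ < τ := lt_of_le_of_ne hσ hne
      obtain ⟨y, hy, hyσ⟩ := (hr.and (Ioo_mem_nhdsGT hlt)).exists
      have h1 := hm y hyσ.2.le
      rw [abs_of_neg hneg, abs_of_neg (hy.trans hneg)] at h1
      linarith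
    subst hστ
    exact ⟨hneg, hA σ le_rfl le_rfl⟩
  obtain ⟨T, hT⟩ := key
  refine ⟨⟨T, fun τ hτ => (hT τ hτ).1⟩, ?_⟩
  have hu : Tendsto (fun τ => ((α τ)⁻¹ - 8 * τ) / τ) atBot (nhds 0) := by
    rw [Metric.tendsto_nhds]
    intro δ hδ
    obtain ⟨T1, hT1⟩ := eventually_atBot.1 (hε.eventually (gt_mem_nhds (show (0:ℝ) < δ / 4 by linarith)))
    set S := min T T1 with hS
    have hder : ∀ x ∈ Set.Iic S, HasDerivWithinAt (fun τ => (α τ)⁻¹ - 8 * τ)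
        (-deriv α x / α x ^ 2 - 8 * 1) (Set.Iic S) x := by
      intro x hx
      have hx0 := (hT x (le_trans hx (min_le_left _ _))).1
      exact (((hα_diff x).hasDerivAt.inv hx0.ne).sub
        ((hasDerivAt_id x).const_mul 8)).hasDerivWithinAt
    have hbd : ∀ x ∈ Set.Iic S, ‖-deriv α x / α x ^ 2 - 8 * 1‖ ≤ δ / 4 := by
      intro x hx
      obtain ⟨hx0, hxA⟩ := hT x (le_trans hx (min_le_left _ _))
      have hx1 := hT1 x (le_trans hx (min_le_right _ _))
      have h1 := h x
      rw [hxA, sq_abs] at h1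
      have h3 : 0 < α x ^ 2 := by have := hx0.ne; positivity
      have h4 : -deriv α x / α x ^ 2 - 8 * 1 = -((deriv α x + 8 * α x ^ 2) / α x ^ 2) := by
        have hne := hx0.ne
        field_simp
        ring
      rw [h4, norm_neg, Real.norm_eq_abs, abs_div, abs_of_pos h3, div_le_iff₀ h3]
      exact h1.trans (by gcongr)
    have hmv : ∀ x ≤ S, |((α x)⁻¹ - 8 * x) - ((α S)⁻¹ - 8 * S)| ≤ δ / 4 * |x - S| := by
      intro x hx
      exact (convex_Iic S).norm_image_sub_le_of_norm_hasDerivWithin_le hder hbd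
        (Set.mem_Iic.2 le_rfl) hx
    set C := |(α S)⁻¹ - 8 * S| + δ / 4 * |S| with hC
    have hC0 : 0 ≤ C := by positivity
    filter_upwards [eventually_le_atBot S, eventually_le_atBot (-1), eventually_le_atBot (-(4 * C / δ))]
      with x h1 h2 h3
    have h4 := hmv x h1
    have hx : 0 < |x| := abs_pos.2 (by linarith)
    rw [dist_zero_right, Real.norm_eq_abs, abs_div, div_lt_iff₀ hx]
    have h5 : |x - S| ≤ |x| + |S| := abs_sub x S
    have h6 : |(α x)⁻¹ - 8 * x| ≤ |((α x)⁻¹ - 8 * x) - ((α S)⁻¹ - 8 * S)| + |(α S)⁻¹ - 8 * S| := by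
      have := abs_add_le (((α x)⁻¹ - 8 * x) - ((α S)⁻¹ - 8 * S)) ((α S)⁻¹ - 8 * S)
      simpa using this
    have h7 : 4 * C ≤ |x| * δ := by
      rw [← div_le_iff₀ hδ, abs_of_neg (by linarith)]
      linarith
    nlinarith
  have hv : Tendsto (fun τ => (((α τ)⁻¹ - 8 * τ) / τ + 8)⁻¹) atBot (nhds (1 / 8)) := by
    have := (hu.add_const 8).inv₀ (by norm_num)
    simpa using this
  refine hv.congr' ?_
  filter_upwards [eventually_le_atBot T, eventually_le_atBot (-1)] with x h1 h2
  have h3 := (hT x h1).1.ne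
  have h4 : x ≠ 0 := by linarith
  have h5 : ((α x)⁻¹ - 8 * x) / x + 8 = (x * α x)⁻¹ := by
    field_simp
    ring
  rw [h5, inv_inv]
end

section
/- Let t₀ < 0 and let R : (-∞, t₀] → (0,∞) be differentiable. Suppose there exists ε : (-∞, t₀] → [0,∞) with ε(t) → 0 as t → -∞ such that R'(t) ≤ ε(t) R(t)² for all t ≤ t₀. Then (-t) · R(t) → ∞ as t → -∞. -/
open Real Filter

/-- Let `t₀ < 0` and let `R : (-∞, t₀] → (0,∞)` be differentiable with
`R'(t) ≤ ε(t) R(t)²` for all `t ≤ t₀`, where `ε ≥ 0` tends to `0` as `t → -∞`.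
Then `(-t) R(t) → ∞` as `t → -∞`. -/
theorem neg_t_mul_R_tendsto_atTop (t₀ : ℝ) (ht₀ : t₀ < 0) (R ε : ℝ → ℝ)
    (hR_pos : ∀ t ≤ t₀, 0 < R t)
    (hR_diff : ∀ t ≤ t₀, DifferentiableAt ℝ R t)
    (hε_nonneg : ∀ t ≤ t₀, 0 ≤ ε t)
    (hε : Tendsto ε atBot (nhds 0))
    (h : ∀ t ≤ t₀, deriv R t ≤ ε t * R t ^ 2) :
    Tendsto (fun t => (-t) * R t) atBot atTop := by
  rw [tendsto_atTop]
  intro b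
  obtain ⟨B, hB, hbB⟩ : ∃ B : ℝ, 0 < B ∧ b ≤ B := ⟨|b| + 1, by positivity, by
    linarith [le_abs_self b]⟩
  obtain ⟨δ, hδ, hδB⟩ : ∃ δ : ℝ, 0 < δ ∧ 2 * δ * B = 1 :=
    ⟨1 / (2 * B), by positivity, by field_simp⟩
  have hev : ∀ᶠ t in atBot, ε t < δ := hε.eventually (gt_mem_nhds hδ)
  obtain ⟨T₁, hT₁⟩ := eventually_atBot.1 hev
  obtain ⟨T, hTt, hTT⟩ : ∃ T, T ≤ t₀ ∧ T ≤ T₁ := ⟨min t₀ T₁, min_le_left _ _, min_le_right _ _⟩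
  have hd : ∀ t ≤ T, HasDerivAt (fun s => (R s)⁻¹ + δ * s) (-deriv R t / R t ^ 2 + δ * 1) t := by
    intro t ht
    have h1 := (hR_diff t (ht.trans hTt)).hasDerivAt
    exact (h1.fun_inv (hR_pos t (ht.trans hTt)).ne').add ((hasDerivAt_id t).const_mul δ)
  have hmono : MonotoneOn (fun s => (R s)⁻¹ + δ * s) (Set.Iic T) := by
    apply monotoneOn_of_deriv_nonneg (convex_Iic T)
    · intro t ht
      exact (hd t ht).continuousAt.continuousWithinAt
    · intro t ht
      exact (hd t (Set.mem_Iic.1 (interior_subset ht))).differentiableAt.differentiableWithinAt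
    · intro t ht
      have ht' : t ≤ T := Set.mem_Iic.1 (interior_subset ht)
      rw [(hd t ht').deriv]
      have hp := hR_pos t (ht'.trans hTt)
      have h2 := h t (ht'.trans hTt)
      have h3 := hT₁ t (ht'.trans hTT)
      have h4 : deriv R t / R t ^ 2 ≤ ε t := by
        rw [div_le_iff₀ (by positivity)]
        exact h2
      rw [neg_div]
      linarith
  filter_upwards [eventually_le_atBot T, eventually_le_atBot (-((R T)⁻¹ / δ))] with t ht ht2
  have hp := hR_pos t (ht.trans hTt)
  have hm : (R t)⁻¹ + δ * t ≤ (R T)⁻¹ + δ * T := hmono ht (Set.mem_Iic.2 le_rfl) ht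
  have h5 : (R T)⁻¹ ≤ -t * δ := by
    rw [← div_le_iff₀ hδ]
    linarith
  have h6 : δ * T ≤ 0 := by nlinarith
  have h7 : (R t)⁻¹ ≤ 2 * δ * (-t) := by linarith
  have h8 : 1 ≤ 2 * δ * (-t) * R t := by
    have := mul_le_mul_of_nonneg_right h7 hp.le
    rwa [inv_mul_cancel₀ hp.ne'] at this
  have h9 := mul_le_mul_of_nonneg_left h8 hB.le
  have h10 : B * (2 * δ * (-t) * R t) = (2 * δ * B) * (-t * R t) := by ring
  rw [h10, hδB] at h9
  linarith
end

section
/- Let α ∈ (0,1) and C > 0. Then there exists T = T(C, α) > 0 with the following property. Let t₀ ≤ -T and let φ : (-∞, t₀] → ℝ be continuously differentiable with φ(t₀) ≥ -2 t₀. Suppose that φ'(t) ≤ -2 (1 − C (-t)^{-α}) holds for every t ≤ t₀ at which φ(t) ≥ -t. Then φ(t) ≥ -2t − (2C/(1-α)) · (-t)^{1-α} for all t ≤ t₀. -/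
open Real Set

/-- Continuity argument: for `α ∈ (0,1)` and `C > 0` there is `T > 0` such that for every
`t₀ ≤ -T` and every continuously differentiable `φ : (-∞, t₀] → ℝ` with `φ(t₀) ≥ -2t₀` and
`φ'(t) ≤ -2(1 − C(-t)^{-α})` whenever `t ≤ t₀` and `φ(t) ≥ -t`, one has
`φ(t) ≥ -2t − (2C/(1-α)) (-t)^{1-α}` for all `t ≤ t₀`. -/
theorem backward_lower_bound (α C : ℝ) (hα : α ∈ Set.Ioo (0 : ℝ) 1) (hC : 0 < C) :
    ∃ T > (0 : ℝ), ∀ t₀ ≤ -T, ∀ φ : ℝ → ℝ,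
      ContDiffOn ℝ 1 φ (Set.Iic t₀) →
      φ t₀ ≥ -2 * t₀ →
      (∀ t ≤ t₀, φ t ≥ -t → derivWithin φ (Set.Iic t₀) t ≤ -2 * (1 - C * (-t) ^ (-α))) →
      ∀ t ≤ t₀, φ t ≥ -2 * t - 2 * C / (1 - α) * (-t) ^ (1 - α) := by
  obtain ⟨hα0, hα1⟩ := hα
  have h1α : 0 < 1 - α := by linarith
  set K : ℝ := 2 * C / (1 - α) with hK
  have hK0 : 0 < K := by positivity
  have hKC : K * (1 - α) = 2 * C := by rw [hK]; field_simp
  refine ⟨(K + 1) ^ (1 / α), by positivity, ?_⟩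
  intro t₀ ht₀ φ hφ h0 hd t1 ht1
  have hTpos : 0 < (K + 1) ^ (1 / α) := by positivity
  have key : ∀ t ≤ t₀, K * (-t) ^ (1 - α) < -t := by
    intro t ht
    have hp : 0 < -t := by linarith
    have h1 : K + 1 ≤ (-t) ^ α := by
      have h2 : ((K + 1) ^ (1 / α)) ^ α ≤ (-t) ^ α :=
        Real.rpow_le_rpow hTpos.le (by linarith) hα0.le
      rwa [← Real.rpow_mul (by positivity), one_div_mul_cancel hα0.ne', Real.rpow_one] at h2
    have h3 : (-t) ^ α * (-t) ^ (1 - α) = -t := by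
      rw [← Real.rpow_add hp]; simp
    have h4 : 0 < (-t) ^ (1 - α) := Real.rpow_pos_of_pos hp _
    nlinarith
  have hneg : ∀ t ≤ t₀, t < 0 := fun t ht => by linarith
  set ψ : ℝ → ℝ := fun t => φ t + 2 * t + K * (-t) ^ (1 - α) with hψ
  suffices h : 0 ≤ ψ t1 by
    simp only [hψ] at h
    linarith
  by_contra hcon
  push Not at hcon
  have hcont : ContinuousOn ψ (Set.Iic t₀) := by
    have h1 : ContinuousOn (fun t : ℝ => (-t) ^ (1 - α)) (Set.Iic t₀) :=
      continuousOn_id.neg.rpow_const (fun x hx => Or.inr h1α.le)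
    exact (hφ.continuousOn.add (by fun_prop)).add (continuousOn_const.mul h1)
  have hsub : Set.Icc t1 t₀ ⊆ Set.Iic t₀ := Set.Icc_subset_Iic_self
  have hcomp : IsCompact (Set.Icc t1 t₀ ∩ ψ ⁻¹' Set.Iic 0) :=
    isCompact_Icc.of_isClosed_subset
      ((hcont.mono hsub).preimage_isClosed_of_isClosed isClosed_Icc isClosed_Iic)
      Set.inter_subset_left
  obtain ⟨s, ⟨hs1, hs2⟩, hsmax⟩ := hcomp.exists_isGreatest ⟨t1, ⟨le_refl _, ht1⟩, hcon.le⟩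
  have hs2' : ψ s ≤ 0 := hs2
  have hpos : ∀ t, s < t → t ≤ t₀ → 0 < ψ t := by
    intro t h1 h2
    by_contra h3
    have := hsmax ⟨⟨hs1.1.trans h1.le, h2⟩, not_lt.mp h3⟩
    linarith
  have hder : ∀ t, t < t₀ → HasDerivAt ψ (deriv φ t + 2 - 2 * C * (-t) ^ (-α)) t := by
    intro t ht
    have hn := hneg t ht.le
    have hdφ : HasDerivAt φ (deriv φ t) t :=
      ((hφ.differentiableOn one_ne_zero).differentiableAt (Iic_mem_nhds ht)).hasDerivAt
    have h1 : HasDerivAt (fun t : ℝ => (-t) ^ (1 - α)) (-1 * (1 - α) * (-t) ^ (1 - α - 1)) t :=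
      (hasDerivAt_neg t).rpow_const (Or.inl (by linarith))
    have h2 := (hdφ.add ((hasDerivAt_id t).const_mul 2)).add (h1.const_mul K)
    refine h2.congr_deriv ?_
    rw [← hKC, show 1 - α - 1 = -α by ring]
    ring
  have hanti : AntitoneOn ψ (Set.Icc s t₀) := by
    refine antitoneOn_of_deriv_nonpos (convex_Icc _ _)
      (hcont.mono Set.Icc_subset_Iic_self) ?_ ?_
    · rw [interior_Icc]
      exact fun t ht => (hder t ht.2).differentiableAt.differentiableWithinAt
    · rw [interior_Icc]
      intro t ht
      rw [(hder t ht.2).deriv]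
      have h1 := hpos t ht.1 ht.2.le
      have h2 := key t ht.2.le
      simp only [hψ] at h1
      have h3 := hd t ht.2.le (by linarith)
      rw [derivWithin_of_mem_nhds (Iic_mem_nhds ht.2)] at h3
      linarith
  have hfin := hanti ⟨le_refl _, hs1.2⟩ ⟨hs1.2, le_refl _⟩ hs1.2
  have hp : 0 < ψ t₀ := by
    have := Real.rpow_pos_of_pos (neg_pos.mpr (hneg t₀ le_rfl)) (1 - α)
    have := mul_pos hK0 this
    simp only [hψ]
    linarith
  linarith
end

section
/- Let t₀ < -1, let d : (-∞, t₀] → (0,∞) be differentiable, and let R : (-∞, t₀] → (0,∞) be nondecreasing. Assume: (a) for every ε ∈ (0,1) there exists T > 0 such that (1-ε) √(R(t)) ≤ -d'(t) ≤ (1+ε) √(R(t)) for all t ≤ -T; and (b) d(t) / √((-t) · log(-t)) → 2 as t → -∞. Then (-t) · R(t) / log(-t) → 1 as t → -∞. -/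
open Real Filter Set

lemma tip_ratio (l : ℝ) (hl : 0 < l) :
    Tendsto (fun s : ℝ => Real.sqrt ((l * s) * Real.log (l * s)) / Real.sqrt (s * Real.log s))
      atTop (nhds (Real.sqrt l)) := by
  have h1 : Tendsto (fun s : ℝ => l * (Real.log l / Real.log s + 1)) atTop (nhds l) := by
    have : Tendsto (fun s : ℝ => Real.log l / Real.log s) atTop (nhds 0) :=
      Real.tendsto_log_atTop.const_div_atTop _
    simpa using (this.add_const 1).const_mul l
  refine ((Real.continuous_sqrt.tendsto l).comp h1).congr' ?_
  filter_upwards [eventually_gt_atTop 1] with s hs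
  have hlog := Real.log_pos hs
  have hs0 : 0 < s := by linarith
  have hp : 0 ≤ s * Real.log s := by positivity
  rw [← Real.sqrt_div' _ hp, Function.comp_apply, Real.log_mul hl.ne' hs0.ne']
  congr 1
  field_simp

lemma tip_quot (f : ℝ → ℝ)
    (hb : Tendsto (fun s => f s / Real.sqrt (s * Real.log s)) atTop (nhds 2))
    (x : ℝ) (hx : -1 < x) (hx0 : x ≠ 0) :
    Tendsto (fun s => (f ((1 + x) * s) - f s) / Real.sqrt (s * Real.log s) / (x * (1 + x)))
      atTop (nhds (2 / ((1 + x) * (Real.sqrt (1 + x) + 1)))) := by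
  have hl : 0 < 1 + x := by linarith
  have h1 : Tendsto (fun s : ℝ => (1 + x) * s) atTop atTop := tendsto_id.const_mul_atTop hl
  have h2 := (((hb.comp h1).mul (tip_ratio _ hl)).sub hb).div_const (x * (1 + x))
  have e : (2 * Real.sqrt (1 + x) - 2) / (x * (1 + x)) = 2 / ((1 + x) * (Real.sqrt (1 + x) + 1)) := by
    have hq := Real.sq_sqrt hl.le
    have hn := Real.sqrt_nonneg (1 + x)
    rw [div_eq_div_iff (by positivity) (by positivity)]
    linear_combination (2 * (1 + x)) * hq
  rw [e] at h2
  refine h2.congr' ?_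
  filter_upwards [h1.eventually_gt_atTop 1, eventually_gt_atTop 1] with s hs hs1
  have hlog := Real.log_pos hs
  have hlog1 := Real.log_pos hs1
  have hp : 0 < Real.sqrt ((1 + x) * s * Real.log ((1 + x) * s)) := Real.sqrt_pos.2 (by positivity)
  simp only [Function.comp_apply]
  rw [div_mul_div_cancel₀ hp.ne', ← sub_div]

lemma tip_h_lim : Tendsto (fun x : ℝ => 2 / ((1 + x) * (Real.sqrt (1 + x) + 1))) (nhds 0) (nhds 1) := by
  have : ContinuousAt (fun x : ℝ => 2 / ((1 + x) * (Real.sqrt (1 + x) + 1))) 0 := by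
    apply ContinuousAt.div
    · fun_prop
    · fun_prop
    · norm_num
  have h := this.tendsto
  norm_num at h
  exact h

lemma tip_core (f r : ℝ → ℝ) (S : ℝ)
    (hf : ∀ s ≥ S, DifferentiableAt ℝ f s)
    (hr : ∀ s u : ℝ, S ≤ s → s ≤ u → r u ≤ r s)
    (ha : ∀ ε ∈ Set.Ioo (0 : ℝ) 1, ∃ T : ℝ, ∀ s ≥ T,
      (1 - ε) * r s ≤ deriv f s ∧ deriv f s ≤ (1 + ε) * r s)
    (hb : Tendsto (fun s => f s / Real.sqrt (s * Real.log s)) atTop (nhds 2)) :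
    Tendsto (fun s => r s * s / Real.sqrt (s * Real.log s)) atTop (nhds 1) := by
  rw [tendsto_order]
  constructor
  · intro a ha1
    have h1 : ∀ᶠ x in nhdsWithin (0:ℝ) (Ioi 0), a < 2 / ((1 + x) * (Real.sqrt (1 + x) + 1)) :=
      (tip_h_lim.eventually_const_lt ha1).filter_mono nhdsWithin_le_nhds
    obtain ⟨x, hax, hx0, hx1⟩ := (h1.and (Ioo_mem_nhdsGT (zero_lt_one' ℝ))).exists
    obtain ⟨T, hT⟩ := ha x ⟨hx0, hx1⟩
    filter_upwards [(tip_quot f hb x (by linarith) hx0.ne').eventually_const_lt hax,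
      eventually_gt_atTop 1, eventually_ge_atTop S, eventually_ge_atTop T] with s hs hs1 hsS hsT
    refine hs.trans_le ?_
    have hlt : s < (1 + x) * s := by nlinarith
    obtain ⟨c, hc, hc'⟩ := exists_deriv_eq_slope f hlt
      (fun y hy => (hf y (hsS.trans hy.1)).continuousAt.continuousWithinAt)
      (fun y hy => (hf y (hsS.trans hy.1.le)).differentiableWithinAt)
    have h2 := (hT c (hsT.trans hc.1.le)).2
    have h3 := hr s c hsS hc.1.le
    rw [hc', div_le_iff₀ (by linarith)] at h2
    have h4 : f ((1 + x) * s) - f s ≤ (1 + x) * r s * (x * s) := by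
      refine h2.trans ?_
      have : (1 + x) * s - s = x * s := by ring
      rw [this]
      gcongr
    rw [div_right_comm]
    gcongr
    rw [div_le_iff₀ (by positivity)]
    linarith
  · intro b hb1
    have h1 : ∀ᶠ x in nhdsWithin (0:ℝ) (Iio 0), 2 / ((1 + x) * (Real.sqrt (1 + x) + 1)) < b :=
      (tip_h_lim.eventually_lt_const hb1).filter_mono nhdsWithin_le_nhds
    obtain ⟨x, hax, hx1, hx0⟩ := (h1.and (Ioo_mem_nhdsLT (neg_one_lt_zero (R := ℝ)))).exists
    obtain ⟨T, hT⟩ := ha (-x) ⟨by linarith, by linarith⟩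
    have hl : 0 < 1 + x := by linarith
    have hm : Tendsto (fun s : ℝ => (1 + x) * s) atTop atTop := tendsto_id.const_mul_atTop hl
    filter_upwards [(tip_quot f hb x (by linarith) hx0.ne).eventually_lt_const hax,
      eventually_gt_atTop 1, hm.eventually_ge_atTop S, hm.eventually_ge_atTop T] with s hs hs1 hsS hsT
    refine lt_of_le_of_lt ?_ hs
    have hlt : (1 + x) * s < s := by nlinarith
    obtain ⟨c, hc, hc'⟩ := exists_deriv_eq_slope f hlt
      (fun y hy => (hf y (hsS.trans hy.1)).continuousAt.continuousWithinAt)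
      (fun y hy => (hf y (hsS.trans hy.1.le)).differentiableWithinAt)
    have h2 := (hT c (hsT.trans hc.1.le)).1
    have h3 := hr c s (hsS.trans hc.1.le) hc.2.le
    rw [hc', le_div_iff₀ (by linarith)] at h2
    have hxs : 0 < -x * s := mul_pos (by linarith) (by linarith)
    have h4 : (1 + x) * r s * (-x * s) ≤ f s - f ((1 + x) * s) := by
      refine le_trans ?_ h2
      have : s - (1 + x) * s = -x * s := by ring
      rw [this, sub_neg_eq_add]
      gcongr
    rw [div_right_comm]
    gcongr
    rw [le_div_iff_of_neg (mul_neg_of_neg_of_pos hx0 hl)]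
    linarith

/-- Scalar curvature asymptotics at the tips: let `t₀ < -1`, let `d : (-∞, t₀] → (0,∞)` be
differentiable and `R : (-∞, t₀] → (0,∞)` nondecreasing. If (a) for every `ε ∈ (0,1)` there
is `T > 0` with `(1-ε)√R(t) ≤ -d'(t) ≤ (1+ε)√R(t)` for all `t ≤ -T` (with `t ≤ t₀`), and
(b) `d(t)/√((-t)log(-t)) → 2` as `t → -∞`, then `(-t)R(t)/log(-t) → 1` as `t → -∞`. -/
theorem tip_curvature_asymptotics (t₀ : ℝ) (ht₀ : t₀ < -1) (d R : ℝ → ℝ)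
    (hd_pos : ∀ t ≤ t₀, 0 < d t)
    (hd_diff : ∀ t ≤ t₀, DifferentiableAt ℝ d t)
    (hR_pos : ∀ t ≤ t₀, 0 < R t)
    (hR_mono : ∀ s t : ℝ, s ≤ t → t ≤ t₀ → R s ≤ R t)
    (ha : ∀ ε ∈ Set.Ioo (0 : ℝ) 1, ∃ T > (0 : ℝ), ∀ t ≤ t₀, t ≤ -T →
      (1 - ε) * Real.sqrt (R t) ≤ -deriv d t ∧ -deriv d t ≤ (1 + ε) * Real.sqrt (R t))
    (hb : Tendsto (fun t => d t / Real.sqrt ((-t) * Real.log (-t))) atBot (nhds 2)) :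
    Tendsto (fun t => (-t) * R t / Real.log (-t)) atBot (nhds 1) := by
  have hcore := tip_core (fun s => d (-s)) (fun s => Real.sqrt (R (-s))) (-t₀)
    (fun s hs => by
      have h := hd_diff (-s) (by linarith)
      exact h.comp s differentiableAt_id.neg)
    (fun s u hs hu => Real.sqrt_le_sqrt (hR_mono _ _ (by linarith) (by linarith)))
    (fun ε hε => by
      obtain ⟨T, -, hT⟩ := ha ε hε
      refine ⟨max T (-t₀), fun s hs => ?_⟩
      have h1 := (le_max_left _ _).trans hs
      have h2 := (le_max_right _ _).trans hs
      have h := hT (-s) (by linarith) (by linarith)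
      rw [deriv_comp_neg]
      exact h)
    (by
      have := hb.comp tendsto_neg_atTop_atBot
      refine this.congr fun s => ?_
      simp)
  have h2 := (hcore.pow 2).comp tendsto_neg_atBot_atTop
  rw [one_pow] at h2
  refine h2.congr' ?_
  filter_upwards [eventually_le_atBot t₀] with t ht
  have hlog : 0 < Real.log (-t) := Real.log_pos (by linarith)
  have hn : 0 < -t := by linarith
  have hne : t ≠ 0 := by linarith
  simp only [Function.comp_apply, neg_neg]
  rw [div_pow, mul_pow, Real.sq_sqrt (hR_pos t ht).le, Real.sq_sqrt (by positivity)]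
  field_simp
end
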